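/- Let d ≥ 3 and (d²+1)/(d(d−1)) < p < ∞. Then the local variation operator V_r^I A is bounded from L^p(ℝ^d) to L^{pd}(ℝ^d) if and only if r ≥ p. -/

import Mathlib

open MeasureTheory Metric Set
open scoped ENNReal NNReal FourierTransform

noncomputable section

/-- Euclidean `d`-space. -/
abbrev Euc (d : ℕ) : Type := EuclideanSpace ℝ (Fin d)

/-- The normalized surface measure `σ` on the unit sphere `S^{d-1} ⊆ ℝ^d`. -/
def sphereMeasure (d : ℕ) : Measure (Euc d) :=
  (((volume : Measure (Euc d)).toSphere Set.univ)⁻¹ : ℝ≥0∞) •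
    ((volume : Measure (Euc d)).toSphere.map Subtype.val)

/-- The spherical average `A_t f(x) = ∫_{S^{d-1}} f(x - t y) dσ(y)`. -/
def sphAvg {d : ℕ} (f : Euc d → ℂ) (t : ℝ) (x : Euc d) : ℂ :=
  ∫ y, f (x - t • y) ∂(sphereMeasure d)

/-- The `r`-variation of the family `t ↦ a t` over the set `E ⊆ ℝ`. -/
def rVar (r : ℝ) (E : Set ℝ) (a : ℝ → ℂ) : ℝ≥0∞ :=
  ⨆ (N : ℕ) (t : Fin (N + 1) → ℝ) (_ : StrictMono t) (_ : ∀ i, t i ∈ E),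
    (∑ i : Fin N, (‖a (t i.succ) - a (t i.castSucc)‖₊ : ℝ≥0∞) ^ r) ^ (1 / r)

/-- The global variation operator `V_r A` for the spherical means. -/
def VrA {d : ℕ} (r : ℝ) (f : Euc d → ℂ) (x : Euc d) : ℝ≥0∞ :=
  rVar r (Set.Ioi 0) (fun t => sphAvg f t x)

/-- The local variation operator `V_r^I A`, `I = [1,2]`. -/
def VrIA {d : ℕ} (r : ℝ) (f : Euc d → ℂ) (x : Euc d) : ℝ≥0∞ :=
  rVar r (Set.Icc 1 2) (fun t => sphAvg f t x)

/-- `L^q` norm (with respect to `μ`) of an `ℝ≥0∞`-valued function, `1 ≤ q ≤ ∞`. -/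
def lqNorm {α : Type*} [MeasurableSpace α] (q : ℝ≥0∞) (g : α → ℝ≥0∞)
    (μ : Measure α) : ℝ≥0∞ :=
  if q = ∞ then essSup g μ else (∫⁻ x, g x ^ q.toReal ∂μ) ^ (1 / q.toReal)

/-- `V_r^I A` is bounded from `L^p(ℝ^d)` to `L^q(ℝ^d)` (real exponents). -/
def IsBddR (d : ℕ) (r p q : ℝ) : Prop :=
  ∃ C : ℝ≥0, ∀ f : Euc d → ℂ, MemLp f (ENNReal.ofReal p) volume →
    lqNorm (ENNReal.ofReal q) (VrIA r f) volume ≤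
      C * eLpNorm f (ENNReal.ofReal p) volume


/-- total mass of the (unnormalized) sphere measure -/
def cS (d : ℕ) : ℝ≥0∞ := (volume : Measure (Euc d)).toSphere Set.univ

instance instNontrivialEuc {d : ℕ} [NeZero d] : Nontrivial (Euc d) := by
  haveI : Nonempty (Fin d) := ⟨0⟩
  infer_instance

lemma cS_ne_zero {d : ℕ} [NeZero d] : cS d ≠ 0 := by
  unfold cS
  rw [Ne, Measure.measure_univ_eq_zero]
  exact Measure.toSphere_ne_zero _

lemma cS_ne_top {d : ℕ} : cS d ≠ ∞ := by
  unfold cS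
  exact measure_ne_top _ _

instance instProbSphere {d : ℕ} [NeZero d] : IsProbabilityMeasure (sphereMeasure d) := by
  constructor
  unfold sphereMeasure
  rw [Measure.smul_apply, Measure.map_apply measurable_subtype_coe MeasurableSet.univ,
    preimage_univ, smul_eq_mul]
  exact ENNReal.inv_mul_cancel cS_ne_zero cS_ne_top

lemma sphere_ae_norm {d : ℕ} : ∀ᵐ y ∂(sphereMeasure d), ‖y‖ = 1 := by
  unfold sphereMeasure
  apply Measure.ae_smul_measure
  rw [ae_map_iff measurable_subtype_coe.aemeasurable]
  · refine Filter.Eventually.of_forall fun y => ?_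
    simpa using y.2
  · exact measurableSet_eq_fun measurable_norm measurable_const

lemma lintegral_sphere {d : ℕ} {g : Euc d → ℝ≥0∞} (hg : Measurable g) :
    ∫⁻ y, g y ∂(sphereMeasure d) =
      (cS d)⁻¹ * ∫⁻ y : sphere (0 : Euc d) 1, g y ∂((volume : Measure (Euc d)).toSphere) := by
  unfold sphereMeasure cS
  rw [lintegral_smul_measure, lintegral_map hg measurable_subtype_coe, smul_eq_mul]

/-- polar coordinates -/
lemma lintegral_polar {d : ℕ} [NeZero d] {g : Euc d → ℝ≥0∞} (hg : Measurable g) :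
    ∫⁻ x, g x = cS d * ∫⁻ t in Ioi (0 : ℝ), ENNReal.ofReal (t ^ (d - 1)) *
      ∫⁻ y, g (t • y) ∂(sphereMeasure d) := by
  have h1 : ∫⁻ x, g x = ∫⁻ x : ({(0)}ᶜ : Set (Euc d)), g x.1 ∂((volume : Measure (Euc d)).comap Subtype.val) := by
    rw [lintegral_subtype_comap (measurableSet_singleton _).compl g, restrict_compl_singleton]
  have h2 := (volume : Measure (Euc d)).measurePreserving_homeomorphUnitSphereProd
  have h3 : ∫⁻ x : ({(0)}ᶜ : Set (Euc d)), g x.1 ∂((volume : Measure (Euc d)).comap Subtype.val) =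
      ∫⁻ z : sphere (0 : Euc d) 1 × Ioi (0 : ℝ), g (z.2.1 • z.1.1)
        ∂((volume : Measure (Euc d)).toSphere.prod
          (Measure.volumeIoiPow (Module.finrank ℝ (Euc d) - 1))) := by
    rw [← h2.lintegral_comp (by fun_prop)]
    refine lintegral_congr fun x => ?_
    congr 1
    have := (homeomorphUnitSphereProd (Euc d)).symm_apply_apply x
    conv_lhs => rw [← this]
    rfl
  rw [h1, h3, lintegral_prod_symm' _ (by fun_prop)]
  have hfr : Module.finrank ℝ (Euc d) = d := by simp
  rw [hfr, Measure.volumeIoiPow, lintegral_withDensity_eq_lintegral_mul₀ (by fun_prop)]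
  · simp only [Pi.mul_apply]
    rw [← lintegral_const_mul' _ _ cS_ne_top]
    rw [lintegral_subtype_comap measurableSet_Ioi (μ := volume)
      (fun t : ℝ => ENNReal.ofReal (t ^ (d - 1)) *
        ∫⁻ y : sphere (0 : Euc d) 1, g (t • y.1) ∂((volume : Measure (Euc d)).toSphere))]
    refine lintegral_congr fun t => ?_
    rw [lintegral_sphere (by fun_prop), mul_left_comm (cS d), ← mul_assoc (cS d),
      ENNReal.mul_inv_cancel cS_ne_zero cS_ne_top, one_mul]
  · apply Measurable.aemeasurable
    apply Measurable.lintegral_prod_left' (f := fun z : sphere (0 : Euc d) 1 × Ioi (0 : ℝ) =>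
      g (z.2.1 • z.1.1))
    fun_prop

/-- rotation invariance -/
lemma lintegral_sphere_rot {d : ℕ} [NeZero d] (R : Euc d ≃ₗᵢ[ℝ] Euc d) {g : Euc d → ℝ≥0∞}
    (hg : Measurable g) :
    ∫⁻ y, g (R y) ∂(sphereMeasure d) = ∫⁻ y, g y ∂(sphereMeasure d) := by
  -- test with `x ↦ g (x/|x|)` on the unit ball
  have key : ∀ h : Euc d → ℝ≥0∞, Measurable h →
      ∫⁻ x, (ball (0:Euc d) 1).indicator (fun x => h (‖x‖⁻¹ • x)) x =
        (cS d * ∫⁻ t in Ioi (0 : ℝ), ENNReal.ofReal (t ^ (d - 1)) * (Iio (1:ℝ)).indicator 1 t)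
         * ∫⁻ y, h y ∂(sphereMeasure d) := by
    intro h hh
    rw [lintegral_polar (Measurable.indicator (by fun_prop) measurableSet_ball), mul_assoc,
      ← lintegral_mul_const]
    swap
    · exact Measurable.mul (by fun_prop) (Measurable.indicator measurable_one measurableSet_Iio)
    congr 1
    refine setLIntegral_congr_fun measurableSet_Ioi fun t ht => ?_
    rw [mul_assoc]
    congr 1
    have : ∫⁻ y, (ball (0:Euc d) 1).indicator (fun x => h (‖x‖⁻¹ • x)) (t • y) ∂(sphereMeasure d)
        = ∫⁻ y, (Iio (1:ℝ)).indicator 1 t * h y ∂(sphereMeasure d) := by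
      refine lintegral_congr_ae ?_
      filter_upwards [sphere_ae_norm] with y hy
      have ht0 : (0:ℝ) < t := ht
      have hn : ‖t • y‖ = t := by rw [norm_smul, hy, mul_one, Real.norm_of_nonneg ht0.le]
      by_cases h1 : t < 1
      · rw [indicator_of_mem (by simpa [hn] using h1), indicator_of_mem (by simpa using h1), hn,
          smul_smul, inv_mul_cancel₀ ht0.ne', one_smul, Pi.one_apply, one_mul]
      · rw [indicator_of_notMem (by simpa [hn] using h1), indicator_of_notMem (by simpa using h1),
          zero_mul]
    rw [this, lintegral_const_mul _ hh]
  have hpos : (cS d * ∫⁻ t in Ioi (0 : ℝ), ENNReal.ofReal (t ^ (d - 1)) *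
      (Iio (1:ℝ)).indicator 1 t) = volume (ball (0:Euc d) 1) := by
    have := key (fun _ => 1) measurable_const
    rw [lintegral_const, measure_univ, mul_one, mul_one] at this
    rw [← this, lintegral_indicator measurableSet_ball]
    simp
  have hb0 : volume (ball (0:Euc d) 1) ≠ 0 := (measure_ball_pos _ _ one_pos).ne'
  have hbt : volume (ball (0:Euc d) 1) ≠ ∞ := measure_ball_lt_top.ne
  have e1 := key g hg
  have e2 := key (fun y => g (R y)) (hg.comp R.continuous.measurable)
  rw [hpos] at e1 e2
  have e3 : ∫⁻ x, (ball (0:Euc d) 1).indicator (fun x => g (R (‖x‖⁻¹ • x))) x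
      = ∫⁻ x, (ball (0:Euc d) 1).indicator (fun x => g (‖x‖⁻¹ • x)) x := by
    have hm : Measurable ((ball (0:Euc d) 1).indicator (fun x => g (‖x‖⁻¹ • x))) :=
      Measurable.indicator (by fun_prop) measurableSet_ball
    rw [← (R.measurePreserving).lintegral_comp hm]
    refine lintegral_congr fun x => ?_
    by_cases hx : x ∈ ball (0:Euc d) 1
    · rw [indicator_of_mem hx, indicator_of_mem (by simpa using hx)]
      simp
    · rw [indicator_of_notMem hx, indicator_of_notMem (by simpa using hx)]
  rw [e3, e1] at e2
  exact ((ENNReal.mul_right_inj hb0 hbt).1 e2).symm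

lemma map_rot_sphere {d : ℕ} [NeZero d] (R : Euc d ≃ₗᵢ[ℝ] Euc d) :
    (sphereMeasure d).map R = sphereMeasure d := by
  ext s hs
  have h := lintegral_sphere_rot R (g := s.indicator 1) (measurable_one.indicator hs)
  rw [lintegral_indicator_one hs] at h
  rw [Measure.map_apply R.continuous.measurable hs, ← h, ← lintegral_indicator_one
    (R.continuous.measurable hs)]
  rfl

lemma integral_sphere_rot {d : ℕ} [NeZero d] {F : Type*} [NormedAddCommGroup F] [NormedSpace ℝ F]
    (R : Euc d ≃ₗᵢ[ℝ] Euc d) (g : Euc d → F) :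
    ∫ y, g (R y) ∂(sphereMeasure d) = ∫ y, g y ∂(sphereMeasure d) := by
  conv_rhs => rw [← map_rot_sphere R]
  exact (R.toHomeomorph.measurableEmbedding.integral_map (μ := sphereMeasure d) g).symm

/-- cosine transform of the sphere measure along the axis `0` -/
def mS (d : ℕ) [NeZero d] (s : ℝ) : ℝ := ∫ y, Real.cos (s * y 0) ∂(sphereMeasure d)
def mS1 (d : ℕ) [NeZero d] (s : ℝ) : ℝ := ∫ y, -(y 0 * Real.sin (s * y 0)) ∂(sphereMeasure d)
def mS2 (d : ℕ) [NeZero d] (s : ℝ) : ℝ := ∫ y, -((y 0)^2 * Real.cos (s * y 0)) ∂(sphereMeasure d)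

lemma sphere_ae_coord {d : ℕ} : ∀ᵐ y ∂(sphereMeasure d), ∀ i : Fin d, |y i| ≤ 1 := by
  filter_upwards [sphere_ae_norm] with y hy i
  rw [← hy]; exact PiLp.norm_apply_le y i

/-- bounded continuous functions are integrable on the sphere -/
lemma integrable_sphere {d : ℕ} [NeZero d] {F : Type*} [NormedAddCommGroup F]
    {g : Euc d → F} (hg : Continuous g) :
    Integrable g (sphereMeasure d) := by
  obtain ⟨C, hC⟩ := (isCompact_sphere (0 : Euc d) 1).exists_bound_of_continuousOn hg.continuousOn
  refine Integrable.of_bound hg.aestronglyMeasurable C ?_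
  filter_upwards [sphere_ae_norm] with y hy
  exact hC y (by simpa using hy)

lemma hasDerivAt_sphere {d : ℕ} [NeZero d] (g g' : ℝ → Euc d → ℝ) (C : ℝ)
    (hc : ∀ s, Continuous (g s)) (hc' : ∀ s, Continuous (g' s))
    (hd : ∀ s y, HasDerivAt (fun s => g s y) (g' s y) s)
    (hb : ∀ s y, ‖y‖ = 1 → |g' s y| ≤ C) (s : ℝ) :
    HasDerivAt (fun s => ∫ y, g s y ∂(sphereMeasure d)) (∫ y, g' s y ∂(sphereMeasure d)) s := by
  refine (hasDerivAt_integral_of_dominated_loc_of_deriv_le (bound := fun _ => C)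
    (Filter.univ_mem) (Filter.Eventually.of_forall fun s => (hc s).aestronglyMeasurable)
    (integrable_sphere (hc s)) (hc' s).aestronglyMeasurable ?_ (integrable_const _) ?_).2
  · filter_upwards [sphere_ae_norm] with y hy x _
    exact hb x y hy
  · exact Filter.Eventually.of_forall fun y x _ => hd x y

lemma coord_le {d : ℕ} (y : Euc d) (i : Fin d) (hy : ‖y‖ = 1) : |y i| ≤ 1 := by
  rw [← hy]; exact PiLp.norm_apply_le y i

lemma mS_deriv {d : ℕ} [NeZero d] (s : ℝ) : HasDerivAt (mS d) (mS1 d s) s := by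
  refine hasDerivAt_sphere (fun s y => Real.cos (s * y 0)) (fun s y => -(y 0 * Real.sin (s * y 0)))
    1 (fun s => by fun_prop) (fun s => by fun_prop) (fun s y => ?_) (fun s y hy => ?_) s
  · have := ((hasDerivAt_id' s).mul_const (y 0)).cos
    refine this.congr_deriv ?_
    ring
  · rw [abs_neg, abs_mul]
    exact mul_le_one₀ (coord_le y 0 hy) (abs_nonneg _) (Real.abs_sin_le_one _)

lemma mS1_deriv {d : ℕ} [NeZero d] (s : ℝ) : HasDerivAt (mS1 d) (mS2 d s) s := by
  refine hasDerivAt_sphere (fun s y => -(y 0 * Real.sin (s * y 0)))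
    (fun s y => -((y 0)^2 * Real.cos (s * y 0)))
    1 (fun s => by fun_prop) (fun s => by fun_prop) (fun s y => ?_) (fun s y hy => ?_) s
  · have := ((((hasDerivAt_id' s).mul_const (y 0)).sin).const_mul (y 0)).neg
    refine this.congr_deriv ?_
    ring
  · rw [abs_neg, abs_mul, abs_pow]
    exact mul_le_one₀ (pow_le_one₀ (abs_nonneg _) (coord_le y 0 hy)) (abs_nonneg _)
      (Real.abs_cos_le_one _)

lemma sphere_ibp {d : ℕ} [NeZero d] (s : ℝ) (k : Fin d) (hk : k ≠ 0) :
    ∫ y, y 0 * Real.sin (s * y 0) ∂(sphereMeasure d) =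
      s * ∫ y, (y k)^2 * Real.cos (s * y 0) ∂(sphereMeasure d) := by
  -- coordinates of the reflected point
  let X : ℝ → Euc d → ℝ := fun a y =>
    2 * (Real.cos a * y 0 + Real.sin a * y k) * Real.cos a - y 0
  let Y : ℝ → Euc d → ℝ := fun a y =>
    2 * (Real.cos a * y 0 + Real.sin a * y k) * Real.sin a - y k
  have hconst : ∀ a, ∫ y, Y a y * Real.sin (s * X a y) ∂(sphereMeasure d) =
      ∫ y, y k * Real.sin (s * y 0) ∂(sphereMeasure d) := by
    intro a
    let u : Euc d := Real.cos a • EuclideanSpace.single 0 1 + Real.sin a • EuclideanSpace.single k 1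
    have hu0 : u 0 = Real.cos a := by simp [u, hk.symm]
    have huk : u k = Real.sin a := by simp [u, hk]
    have hin : ∀ y, inner ℝ u y = Real.cos a * y 0 + Real.sin a * y k := by
      intro y
      simp [u, inner_add_left, inner_smul_left, EuclideanSpace.inner_single_left]
    have hun : ‖u‖ ^ 2 = 1 := by
      rw [← real_inner_self_eq_norm_sq, hin, hu0, huk]
      nlinarith [Real.sin_sq_add_cos_sq a]
    have hR : ∀ y, (Submodule.reflection (ℝ ∙ u)) y =
        (2 * (Real.cos a * y 0 + Real.sin a * y k)) • u - y := by
      intro y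
      rw [Submodule.reflection_singleton_apply, hin]
      simp [hun, two_smul, mul_smul]
    have := integral_sphere_rot (Submodule.reflection (ℝ ∙ u))
      (fun y : Euc d => y k * Real.sin (s * y 0))
    rw [← this]
    refine integral_congr_ae (Filter.Eventually.of_forall fun y => ?_)
    simp only [hR, PiLp.sub_apply, PiLp.smul_apply, smul_eq_mul, hu0, huk, X, Y]
  let X' : ℝ → Euc d → ℝ := fun a y =>
    2 * (-Real.sin a * y 0 + Real.cos a * y k) * Real.cos a
      + 2 * (Real.cos a * y 0 + Real.sin a * y k) * (-Real.sin a)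
  let Y' : ℝ → Euc d → ℝ := fun a y =>
    2 * (-Real.sin a * y 0 + Real.cos a * y k) * Real.sin a
      + 2 * (Real.cos a * y 0 + Real.sin a * y k) * (Real.cos a)
  have hXd : ∀ a y, HasDerivAt (fun a => X a y) (X' a y) a := by
    intro a y
    exact ((((((Real.hasDerivAt_cos a).mul_const (y 0)).add
      ((Real.hasDerivAt_sin a).mul_const (y k))).const_mul 2).mul (Real.hasDerivAt_cos a)).sub_const
      (y 0))
  have hYd : ∀ a y, HasDerivAt (fun a => Y a y) (Y' a y) a := by
    intro a y
    exact ((((((Real.hasDerivAt_cos a).mul_const (y 0)).add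
      ((Real.hasDerivAt_sin a).mul_const (y k))).const_mul 2).mul (Real.hasDerivAt_sin a)).sub_const
      (y k))
  have hder := hasDerivAt_sphere (d := d) (fun a y => Y a y * Real.sin (s * X a y))
    (fun a y => Y' a y * Real.sin (s * X a y) + Y a y * (Real.cos (s * X a y) * (s * X' a y)))
    (8 + 5 * (|s| * 8)) (fun a => by simp only [X, Y]; fun_prop)
    (fun a => by simp only [X, Y, X', Y']; fun_prop)
    (fun a y => (hYd a y).mul ((hXd a y).const_mul s).sin) ?_ 0
  · simp only [hconst] at hder
    have h0 := hder.unique (hasDerivAt_const _ _)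
    have e1 : ∀ y : Euc d, Y' 0 y * Real.sin (s * X 0 y) +
        Y 0 y * (Real.cos (s * X 0 y) * (s * X' 0 y)) =
        2 * (y 0 * Real.sin (s * y 0)) - 2 * (s * ((y k)^2 * Real.cos (s * y 0))) := by
      intro y
      have : X 0 y = y 0 := by simp [X]; ring
      rw [this]
      simp [Y, X', Y']; ring
    simp only [e1] at h0
    rw [integral_sub (integrable_sphere (by fun_prop)) (integrable_sphere (by fun_prop)),
      integral_const_mul, integral_const_mul, integral_const_mul] at h0
    linarith
  · intro a y hy
    have h1 := coord_le y 0 hy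
    have h2 := coord_le y k hy
    have hs := Real.abs_sin_le_one a
    have hcs := Real.abs_cos_le_one a
    have P : ∀ u v w z : ℝ, |u| ≤ 1 → |v| ≤ 1 → |w| ≤ 1 → |z| ≤ 1 →
      |u * y 0 + v * y k| ≤ 2 := by
      intro u v w z hu hv _ _
      calc _ ≤ |u * y 0| + |v * y k| := abs_add_le _ _
        _ ≤ 1 + 1 := by
          rw [abs_mul, abs_mul]
          exact add_le_add (mul_le_one₀ hu (abs_nonneg _) h1) (mul_le_one₀ hv (abs_nonneg _) h2)
        _ = 2 := by norm_num
    have hns : |(-Real.sin a)| ≤ 1 := by rwa [abs_neg]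
    have p1 := P _ _ _ _ hcs hs hs hs
    have p2 := P _ _ _ _ hns hcs hs hs
    have Q : ∀ u v : ℝ, |u| ≤ 2 → |v| ≤ 1 → |2 * u * v| ≤ 4 := by
      intro u v hu hv
      rw [abs_mul, abs_mul, abs_two]
      nlinarith [abs_nonneg u, abs_nonneg v]
    have q1 : |X' a y| ≤ 8 := (abs_add_le _ _).trans (by linarith [Q _ _ p2 hcs, Q _ _ p1 hns])
    have q2 : |Y' a y| ≤ 8 := (abs_add_le _ _).trans (by linarith [Q _ _ p2 hs, Q _ _ p1 hcs])
    have q3 : |Y a y| ≤ 5 := (abs_sub _ _).trans (by linarith [Q _ _ p1 hs])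
    refine (abs_add_le _ _).trans (add_le_add ?_ ?_)
    · rw [abs_mul]
      calc _ ≤ 8 * 1 := mul_le_mul q2 (Real.abs_sin_le_one _) (abs_nonneg _) (by norm_num)
        _ = 8 := by norm_num
    · rw [abs_mul, abs_mul, abs_mul]
      have c1 : |Real.cos (s * X a y)| * (|s| * |X' a y|) ≤ 1 * (|s| * 8) :=
        mul_le_mul (Real.abs_cos_le_one _) (mul_le_mul_of_nonneg_left q1 (abs_nonneg _))
          (by positivity) zero_le_one
      rw [one_mul] at c1
      exact mul_le_mul q3 c1 (by positivity) (by norm_num)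

lemma mS_ode {d : ℕ} [NeZero d] (s : ℝ) :
    s * (mS d s + mS2 d s) = -((d:ℝ) - 1) * mS1 d s := by
  have h1 : mS d s + mS2 d s = ∑ k ∈ Finset.univ.erase (0 : Fin d),
      ∫ y, (y k)^2 * Real.cos (s * y 0) ∂(sphereMeasure d) := by
    rw [← integral_finsetSum _ (fun k _ => integrable_sphere (by fun_prop)), mS, mS2,
      ← integral_add (integrable_sphere (by fun_prop)) (integrable_sphere (by fun_prop))]
    refine integral_congr_ae ?_
    filter_upwards [sphere_ae_norm] with y hy
    have h2 : ∑ k, (y k)^2 = 1 := by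
      have := EuclideanSpace.real_norm_sq_eq y
      rw [hy] at this
      linarith
    rw [← Finset.sum_mul]
    rw [← Finset.add_sum_erase _ _ (Finset.mem_univ (0 : Fin d))] at h2
    have : ∑ k ∈ Finset.univ.erase (0 : Fin d), (y k)^2 = 1 - (y 0)^2 := by linarith
    rw [this]; ring
  rw [h1, Finset.mul_sum]
  have h3 : ∀ k ∈ Finset.univ.erase (0 : Fin d),
      s * ∫ y, (y k)^2 * Real.cos (s * y 0) ∂(sphereMeasure d) = - mS1 d s := by
    intro k hk
    rw [← sphere_ibp s k (Finset.ne_of_mem_erase hk), mS1, integral_neg, neg_neg]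
  rw [Finset.sum_congr rfl h3, Finset.sum_const, Finset.card_erase_of_mem (Finset.mem_univ _)]
  simp only [Finset.card_univ, Fintype.card_fin, nsmul_eq_mul]
  rw [Nat.cast_sub (Nat.one_le_iff_ne_zero.2 (NeZero.ne d))]
  push_cast; ring

lemma abs_mS_le_one {d : ℕ} [NeZero d] (s : ℝ) : |mS d s| ≤ 1 := by
  have := norm_integral_le_of_norm_le_const (μ := sphereMeasure d)
    (f := fun y => Real.cos (s * y 0)) (C := 1)
    (Filter.Eventually.of_forall fun y => Real.abs_cos_le_one _)
  simpa [mS] using this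

lemma mS_decay_aux {d : ℕ} [NeZero d] : ∃ C : ℝ, 0 ≤ C ∧ ∀ s : ℝ, 1 ≤ s →
    |mS d s| ≤ C * s ^ (-(((d:ℝ) - 1) / 2)) := by
  set n : ℝ := ((d:ℝ) - 1) / 2 with hn
  let w : ℝ → ℝ := fun s => s ^ n * mS d s
  let w1 : ℝ → ℝ := fun s => n * s ^ (n - 1) * mS d s + s ^ n * mS1 d s
  have hw : ∀ s, 0 < s → HasDerivAt w (w1 s) s := fun s hs =>
    (Real.hasDerivAt_rpow_const (Or.inl hs.ne')).mul (mS_deriv s)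
  have hw1 : ∀ s, 0 < s → HasDerivAt w1 ((n * (n - 1) / s ^ 2 - 1) * w s) s := by
    intro s hs
    have h := (((Real.hasDerivAt_rpow_const (p := n - 1) (Or.inl hs.ne')).const_mul n).mul
      (mS_deriv (d := d) s)).add ((Real.hasDerivAt_rpow_const (p := n) (Or.inl hs.ne')).mul
      (mS1_deriv (d := d) s))
    refine h.congr_deriv ?_
    have hode := mS_ode (d := d) s
    have e2 : mS2 d s = -(2 * n / s) * mS1 d s - mS d s := by
      have : (d:ℝ) - 1 = 2 * n := by rw [hn]; ring
      rw [this] at hode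
      field_simp
      linarith
    rw [e2]
    have r1 : s ^ (n - 1) = s ^ n / s := by rw [Real.rpow_sub hs, Real.rpow_one]
    have r2 : s ^ (n - 1 - 1) = s ^ n / s ^ 2 := by
      rw [Real.rpow_sub hs, r1, Real.rpow_one]; field_simp
    simp only [w, r1, r2]
    field_simp
    ring
  set c : ℝ := n * (n - 1) with hc
  let En : ℝ → ℝ := fun s => (w s ^ 2 + w1 s ^ 2) * Real.exp (|c| / s)
  have hE : ∀ s, 0 < s → HasDerivAt En
      ((2 * w s * w1 s + 2 * w1 s * ((c / s ^ 2 - 1) * w s)) * Real.exp (|c| / s) +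
        (w s ^ 2 + w1 s ^ 2) * (Real.exp (|c| / s) * (-|c| / s ^ 2))) s := by
    intro s hs
    have h1 := ((hw s hs).pow 2).add ((hw1 s hs).pow 2)
    have h2 := ((hasDerivAt_const s |c|).div (hasDerivAt_id' s) hs.ne').exp
    refine (h1.mul h2).congr_deriv ?_
    simp
  have hanti : AntitoneOn En (Ici 1) := by
    refine antitoneOn_of_deriv_nonpos (convex_Ici 1) ?_ ?_ ?_
    · intro s hs
      exact (hE s (lt_of_lt_of_le one_pos hs)).continuousAt.continuousWithinAt
    · intro s hs
      rw [interior_Ici] at hs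
      exact (hE s (lt_trans one_pos hs)).differentiableAt.differentiableWithinAt
    · intro s hs
      rw [interior_Ici] at hs
      have hs0 : 0 < s := lt_trans one_pos hs
      rw [(hE s hs0).deriv]
      have : (2 * w s * w1 s + 2 * w1 s * ((c / s ^ 2 - 1) * w s)) * Real.exp (|c| / s) +
        (w s ^ 2 + w1 s ^ 2) * (Real.exp (|c| / s) * (-|c| / s ^ 2)) =
        (Real.exp (|c| / s) / s ^ 2) * (c * (2 * w s * w1 s) - |c| * (w s ^ 2 + w1 s ^ 2)) := by
        field_simp
        ring
      rw [this]
      refine mul_nonpos_of_nonneg_of_nonpos (by positivity) ?_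
      rcases abs_cases c with ⟨h, h'⟩ | ⟨h, h'⟩
      · rw [h]; nlinarith [sq_nonneg (w s - w1 s)]
      · rw [h]; nlinarith [sq_nonneg (w s + w1 s)]
  refine ⟨Real.sqrt (En 1), Real.sqrt_nonneg _, fun s hs => ?_⟩
  have hs0 : 0 < s := lt_of_lt_of_le one_pos hs
  have h1 : En s ≤ En 1 := hanti (by simp) hs hs
  have h2 : w s ^ 2 ≤ En s := by
    have : 1 ≤ Real.exp (|c| / s) := Real.one_le_exp (by positivity)
    calc w s ^ 2 ≤ w s ^ 2 + w1 s ^ 2 := by nlinarith [sq_nonneg (w1 s)]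
      _ = (w s ^ 2 + w1 s ^ 2) * 1 := (mul_one _).symm
      _ ≤ En s := mul_le_mul_of_nonneg_left this (by positivity)
  have h3 : |w s| ≤ Real.sqrt (En 1) := by
    rw [← Real.sqrt_sq_eq_abs]
    exact Real.sqrt_le_sqrt (h2.trans h1)
  have h4 : mS d s = w s * s ^ (-n) := by
    simp only [w]
    rw [mul_right_comm, ← Real.rpow_add hs0]; simp
  rw [h4, abs_mul, abs_of_pos (Real.rpow_pos_of_pos hs0 _)]
  exact mul_le_mul_of_nonneg_right h3 (Real.rpow_pos_of_pos hs0 _).le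

/-- Fourier transform of the sphere measure -/
def sigH {d : ℕ} [NeZero d] (x : Euc d) : ℝ := mS d (2 * Real.pi * ‖x‖)

lemma exists_rot {d : ℕ} {v w : Euc d} (h : ‖v‖ = ‖w‖) : ∃ R : Euc d ≃ₗᵢ[ℝ] Euc d, R v = w :=
  ⟨_, Submodule.reflection_sub h⟩

lemma sigH_eq {d : ℕ} [NeZero d] (x : Euc d) :
    ∫ y, (Real.fourierChar (inner ℝ x y) : ℂ) ∂(sphereMeasure d) = (sigH x : ℂ) := by
  obtain ⟨R, hR⟩ := exists_rot (v := EuclideanSpace.single (0 : Fin d) ‖x‖) (w := x) (by simp)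
  rw [← integral_sphere_rot R, ← hR]
  simp only [LinearIsometryEquiv.inner_map_map]
  have h1 : ∀ y : Euc d, inner ℝ (EuclideanSpace.single (0 : Fin d) ‖x‖) y = ‖x‖ * y 0 := by
    intro y; simp [EuclideanSpace.inner_single_left]
  have h2 : ∀ y : Euc d, (Real.fourierChar (‖x‖ * y 0) : ℂ) =
      (Real.cos (2 * Real.pi * ‖x‖ * y 0) : ℂ) + (Real.sin (2 * Real.pi * ‖x‖ * y 0) : ℝ) *
        Complex.I := by
    intro y
    rw [Real.fourierChar_apply, Complex.exp_mul_I]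
    push_cast
    ring_nf
  simp only [h1, h2]
  rw [integral_add (integrable_sphere (by fun_prop)) (integrable_sphere (by fun_prop)),
    integral_mul_const]
  have h3 : ∫ y : Euc d, ((Real.sin (2 * Real.pi * ‖x‖ * y 0) : ℝ) : ℂ) ∂(sphereMeasure d) = 0 := by
    have := integral_sphere_rot (LinearIsometryEquiv.neg ℝ)
      (fun y : Euc d => ((Real.sin (2 * Real.pi * ‖x‖ * y 0) : ℝ) : ℂ))
    simp only [LinearIsometryEquiv.coe_neg, PiLp.neg_apply, mul_neg, Real.sin_neg,
      Complex.ofReal_neg, integral_neg] at this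
    exact self_eq_neg.1 this.symm
  have h4 : ∫ y : Euc d, ((Real.cos (2 * Real.pi * ‖x‖ * y 0) : ℝ) : ℂ) ∂(sphereMeasure d)
      = sigH x := by
    rw [integral_complex_ofReal]; rfl
  rw [h3, zero_mul, add_zero, hR]
  exact h4

lemma sigH_decay {d : ℕ} [NeZero d] : ∃ C : ℝ, 0 ≤ C ∧ ∀ x : Euc d, ∀ s : ℝ, 1 ≤ s → s ≤ ‖x‖ →
    |sigH x| ≤ C * s ^ (-(((d:ℝ) - 1) / 2)) := by
  obtain ⟨C, hC0, hC⟩ := mS_decay_aux (d := d)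
  refine ⟨C, hC0, fun x s hs hsx => ?_⟩
  have hpi : 1 ≤ 2 * Real.pi := by linarith [Real.pi_gt_three]
  have h1 : s ≤ 2 * Real.pi * ‖x‖ := hsx.trans (le_mul_of_one_le_left (norm_nonneg _) hpi)
  refine (hC _ (hs.trans h1)).trans (mul_le_mul_of_nonneg_left ?_ hC0)
  refine Real.rpow_le_rpow_of_nonpos (by linarith) h1 ?_
  have : (1:ℝ) ≤ d := by exact_mod_cast Nat.one_le_iff_ne_zero.2 (NeZero.ne d)
  linarith

lemma abs_sigH_le_one {d : ℕ} [NeZero d] (x : Euc d) : |sigH x| ≤ 1 := abs_mS_le_one _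

lemma continuous_sigH {d : ℕ} [NeZero d] : Continuous (sigH (d := d)) := by
  have : Continuous (mS d) := continuous_iff_continuousAt.2 fun s => (mS_deriv s).continuousAt
  unfold sigH
  fun_prop

lemma sigH_neg {d : ℕ} [NeZero d] (x : Euc d) : sigH (-x) = sigH x := by simp [sigH]

lemma threeLines {W Y : Type*} [MeasurableSpace W] [MeasurableSpace Y] (π : Measure W)
    (l : Measure Y) [IsFiniteMeasure π] [IsFiniteMeasure l] (K : W → Y → ℂ)
    (hK : Measurable (Function.uncurry K)) (Gf : Y → ℂ) (Lf : Y → ℝ) (Gg : W → ℂ) (Lg : W → ℝ)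
    (hGf : Measurable Gf) (hLf : Measurable Lf) (hGg : Measurable Gg) (hLg : Measurable Lg)
    (M : ℝ) (bK : ∀ w y, ‖K w y‖ ≤ M) (bGf : ∀ y, ‖Gf y‖ ≤ M) (bLf : ∀ y, |Lf y| ≤ M)
    (bGg : ∀ y, ‖Gg y‖ ≤ M) (bLg : ∀ y, |Lg y| ≤ M) (a b θ : ℝ) (h0 : 0 ≤ θ) (h1 : θ ≤ 1)
    (ha : ∀ z : ℂ, z.re = 0 → ‖∫ w, (Gg w * Complex.exp (z * Lg w)) *
      ∫ y, K w y * (Gf y * Complex.exp (z * Lf y)) ∂l ∂π‖ ≤ a)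
    (hb : ∀ z : ℂ, z.re = 1 → ‖∫ w, (Gg w * Complex.exp (z * Lg w)) *
      ∫ y, K w y * (Gf y * Complex.exp (z * Lf y)) ∂l ∂π‖ ≤ b) :
    ‖∫ w, (Gg w * Complex.exp ((θ : ℂ) * Lg w)) *
      ∫ y, K w y * (Gf y * Complex.exp ((θ : ℂ) * Lf y)) ∂l ∂π‖ ≤ a ^ (1 - θ) * b ^ θ := by
  let Φ : ℂ → ℂ := fun z => ∫ w, (Gg w * Complex.exp (z * Lg w)) *
      ∫ y, K w y * (Gf y * Complex.exp (z * Lf y)) ∂l ∂π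
  let G : W × Y → ℂ := fun v => Gg v.1 * (K v.1 v.2 * Gf v.2)
  let L : W × Y → ℝ := fun v => Lg v.1 + Lf v.2
  have hG : Measurable G := (hGg.comp measurable_fst).mul (hK.mul (hGf.comp measurable_snd))
  have hL : Measurable L := (hLg.comp measurable_fst).add (hLf.comp measurable_snd)
  have hGb : ∀ v, ‖G v‖ ≤ |M| * (|M| * |M|) := by
    intro v
    simp only [G, norm_mul]
    have := fun w y => (bK w y).trans (le_abs_self M)
    have := fun w => (bGg w).trans (le_abs_self M)
    have := fun w => (bGf w).trans (le_abs_self M)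
    gcongr <;> simp_all
  have hLb : ∀ v, |L v| ≤ 2 * |M| := by
    intro v
    refine (abs_add_le _ _).trans ?_
    have := (bLg v.1).trans (le_abs_self M)
    have := (bLf v.2).trans (le_abs_self M)
    linarith
  have hexp : ∀ z v, ‖Complex.exp (z * L v)‖ ≤ Real.exp (|z.re| * (2 * |M|)) := by
    intro z v
    rw [Complex.norm_exp]
    refine Real.exp_le_exp.2 ?_
    have : (z * (L v : ℂ)).re = z.re * L v := by simp
    rw [this]
    refine (le_abs_self _).trans ?_
    rw [abs_mul]
    exact mul_le_mul_of_nonneg_left (hLb v) (abs_nonneg _)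
  have hmeas : ∀ z : ℂ, Measurable fun v => G v * Complex.exp (z * L v) := by
    intro z; fun_prop
  have hIntg : ∀ z : ℂ, Integrable (fun v => G v * Complex.exp (z * L v)) (π.prod l) := by
    intro z
    refine Integrable.of_bound (hmeas z).aestronglyMeasurable
      (|M| * (|M| * |M|) * Real.exp (|z.re| * (2 * |M|))) (Filter.Eventually.of_forall fun v => ?_)
    rw [norm_mul]
    exact mul_le_mul (hGb v) (hexp z v) (norm_nonneg _) (by positivity)
  have hΦ : ∀ z, Φ z = ∫ v, G v * Complex.exp (z * L v) ∂(π.prod l) := by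
    intro z
    rw [integral_prod _ (hIntg z)]
    refine integral_congr_ae (Filter.Eventually.of_forall fun w => ?_)
    simp only
    rw [← integral_const_mul]
    refine integral_congr_ae (Filter.Eventually.of_forall fun y => ?_)
    simp only [G, L]
    push_cast
    rw [mul_add, Complex.exp_add]
    ring
  have hdiff : Differentiable ℂ Φ := by
    intro z₀
    have : Φ = fun z => ∫ v, G v * Complex.exp (z * L v) ∂(π.prod l) := funext hΦ
    rw [this]
    refine (hasDerivAt_integral_of_dominated_loc_of_deriv_le (s := ball z₀ 1)
      (F' := fun z v => G v * (Complex.exp (z * L v) * (1 * L v)))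
      (bound := fun _ => |M| * (|M| * |M|) * (Real.exp ((|z₀.re| + 1) * (2 * |M|)) * (2 * |M|)))
      (ball_mem_nhds z₀ one_pos) (Filter.Eventually.of_forall fun z =>
        (hmeas z).aestronglyMeasurable) (hIntg z₀) ?_ ?_ (integrable_const _) ?_).2.differentiableAt
    · apply Measurable.aestronglyMeasurable; fun_prop
    · refine Filter.Eventually.of_forall fun v z hz => ?_
      rw [norm_mul, norm_mul (Complex.exp _)]
      refine mul_le_mul (hGb v) (mul_le_mul ((hexp z v).trans ?_) ?_ (norm_nonneg _)
        (by positivity)) (by positivity) (by positivity)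
      · refine Real.exp_le_exp.2 (mul_le_mul_of_nonneg_right ?_ (by positivity))
        have h2 : ‖z - z₀‖ < 1 := by simpa [dist_eq_norm] using hz
        have h3 := Complex.abs_re_le_norm (z - z₀)
        have h4 : |z.re| ≤ |z₀.re| + |(z - z₀).re| := by
          have := abs_add_le z₀.re (z - z₀).re
          simpa using this
        linarith
      · simpa using hLb v
    · refine Filter.Eventually.of_forall fun v z _ => ?_
      exact (((hasDerivAt_id' z).mul_const (L v : ℂ)).cexp).const_mul _
  have := Complex.HadamardThreeLines.norm_le_interp_of_mem_verticalClosedStrip₀₁' Φ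
    (z := (θ : ℂ)) (a := a) (b := b) ?_ hdiff.diffContOnCl ?_ ?_ ?_
  · simpa [Φ] using this
  · simp [Complex.HadamardThreeLines.verticalClosedStrip, h0, h1]
  · refine ⟨|M| * (|M| * |M|) * Real.exp (1 * (2 * |M|)) * (π.prod l).real univ, ?_⟩
    rintro _ ⟨z, hz, rfl⟩
    simp only [Function.comp, hΦ]
    refine norm_integral_le_of_norm_le_const (Filter.Eventually.of_forall fun v => ?_)
    rw [norm_mul]
    refine mul_le_mul (hGb v) ((hexp z v).trans ?_) (norm_nonneg _) (by positivity)
    refine Real.exp_le_exp.2 (mul_le_mul_of_nonneg_right ?_ (by positivity))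
    have hz' : 0 ≤ z.re ∧ z.re ≤ 1 := by
      simpa [Complex.HadamardThreeLines.verticalClosedStrip] using hz
    rw [abs_of_nonneg hz'.1]; exact hz'.2
  · intro z hz; exact ha z (by simpa using hz)
  · intro z hz; exact hb z (by simpa using hz)

lemma ofReal_exp_log {a : ℝ≥0∞} (h0 : a ≠ 0) (ht : a ≠ ∞) (c : ℝ) :
    ENNReal.ofReal (Real.exp (c * Real.log a.toReal)) = a ^ c := by
  have hp : 0 < a.toReal := ENNReal.toReal_pos h0 ht
  rw [mul_comm, ← Real.rpow_def_of_pos hp, ← ENNReal.ofReal_rpow_of_pos hp, ENNReal.ofReal_toReal ht]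

lemma enorm_cexp_log {a : ℝ≥0∞} (h0 : a ≠ 0) (ht : a ≠ ∞) (c : ℂ) :
    ‖Complex.exp (c * (Real.log a.toReal : ℂ))‖ₑ = a ^ c.re := by
  rw [← ofReal_norm, Complex.norm_exp]
  have : (c * (Real.log a.toReal : ℂ)).re = c.re * Real.log a.toReal := by
    rw [Complex.re_mul_ofReal]
  rw [this, ofReal_exp_log h0 ht]

def BdM {Y : Type*} [MeasurableSpace Y] (f : Y → ℂ) : Prop :=
  Measurable f ∧ ∃ M : ℝ, ∀ y, ‖f y‖ ≤ M

def opT {W Y : Type*} [MeasurableSpace Y] (K : W → Y → ℂ) (l : Measure Y) (f : Y → ℂ) (w : W) : ℂ :=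
  ∫ y, K w y * f y ∂l

lemma measurable_opT {W Y : Type*} [MeasurableSpace W] [MeasurableSpace Y] {l : Measure Y}
    [SFinite l] {K : W → Y → ℂ}
    (hK : Measurable (Function.uncurry K)) {f : Y → ℂ} (hf : Measurable f) :
    Measurable (opT K l f) := by
  unfold opT
  have : StronglyMeasurable (Function.uncurry fun w y => K w y * f y) :=
    (hK.mul (hf.comp measurable_snd)).stronglyMeasurable
  exact this.integral_prod_right.measurable

lemma norm_opT_le {W Y : Type*} [MeasurableSpace W] [MeasurableSpace Y] {l : Measure Y}
    [IsFiniteMeasure l] {K : W → Y → ℂ} {M M' : ℝ} (bK : ∀ w y, ‖K w y‖ ≤ M) {f : Y → ℂ}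
    (hM : 0 ≤ M) (bf : ∀ y, ‖f y‖ ≤ M') (w : W) : ‖opT K l f w‖ ≤ M * M' * l.real univ := by
  refine norm_integral_le_of_norm_le_const (Filter.Eventually.of_forall fun y => ?_)
  rw [norm_mul]
  exact mul_le_mul (bK w y) (bf y) (norm_nonneg _) hM

lemma rt_core {X Z Y : Type*} [MeasurableSpace X] [MeasurableSpace Z] [MeasurableSpace Y]
    (μ : Measure X) (ν : Measure Z) (l : Measure Y) [IsFiniteMeasure μ] [IsFiniteMeasure ν]
    [IsFiniteMeasure l] (K : X × Z → Y → ℂ)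
    (hK : Measurable (Function.uncurry K)) (M : ℝ) (hM : 0 ≤ M) (bK : ∀ w y, ‖K w y‖ ≤ M)
    (α θ p q q1 : ℝ) (hα0 : 0 ≤ α) (hα1 : α ≤ 1) (h0 : 0 ≤ θ) (h1 : θ ≤ 1) (hp0 : 0 < p)
    (hq0 : 0 < q) (hq1 : 1 < q1)
    (hp : 1 / p = α + θ * (1 / 2 - α)) (hq : 1 / q = θ / q1) (C1 C2 : ℝ≥0)
    (H0 : ∀ x, ∀ f : Y → ℂ, BdM f → ∀ A : Y → ℝ≥0∞, ∀ V : Z → ℝ≥0∞, Measurable A → Measurable V →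
      (∀ y, ‖f y‖ₑ ≤ A y ^ α) → ∫⁻ z, V z ^ (1 - α) * ‖opT K l f (x, z)‖ₑ ∂ν ≤
        C1 * (∫⁻ y, A y ∂l) ^ α * (∫⁻ z, V z ∂ν) ^ (1 - α))
    (H1 : ∀ f : Y → ℂ, BdM f → ∫⁻ x, (∫⁻ z, ‖opT K l f (x, z)‖ₑ ^ (2:ℝ) ∂ν) ^ (q1 / 2) ∂μ ≤
      (C2 * (∫⁻ y, ‖f y‖ₑ ^ (2:ℝ) ∂l) ^ (1 / 2 : ℝ)) ^ q1)
    (f : Y → ℂ) (hf : Measurable f) (ε M' : ℝ) (hε : 0 < ε) (hM' : ∀ y, ‖f y‖ ≤ M')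
    (hfε : ∀ y, f y = 0 ∨ ε ≤ ‖f y‖) :
    ∫⁻ x, ({x | ENNReal.ofReal ε ≤ ∫⁻ z, {w | ε ≤ ‖opT K l f w‖}.indicator
        (fun w => ‖opT K l f w‖ₑ ^ p) (x, z) ∂ν}.indicator
      (fun x => (∫⁻ z, {w | ε ≤ ‖opT K l f w‖}.indicator
        (fun w => ‖opT K l f w‖ₑ ^ p) (x, z) ∂ν) ^ (q / p)) x) ∂μ ≤
      ((C1:ℝ≥0∞) ^ (1 - θ) * (C2:ℝ≥0∞) ^ θ * (∫⁻ y, ‖f y‖ₑ ^ p ∂l) ^ (1 / p)) ^ q := by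
  set F := opT K l f with hF
  set A : Set (X × Z) := {w | ε ≤ ‖F w‖} with hA
  set V : X × Z → ℝ≥0∞ := A.indicator (fun w => ‖F w‖ₑ ^ p) with hV
  set N : X → ℝ≥0∞ := fun x => ∫⁻ z, V (x, z) ∂ν with hN
  set B : Set X := {x | ENNReal.ofReal ε ≤ N x} with hB
  set Q : ℝ≥0∞ := ∫⁻ x, B.indicator (fun x => N x ^ (q / p)) x ∂μ with hQ
  set S : ℝ≥0∞ := ∫⁻ y, ‖f y‖ₑ ^ p ∂l with hS
  have hFm : Measurable F := measurable_opT hK hf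
  have hAm : MeasurableSet A := measurableSet_le measurable_const hFm.norm
  have hVm : Measurable V := (by fun_prop : Measurable fun w => ‖F w‖ₑ ^ p).indicator hAm
  have hNm : Measurable N := hVm.lintegral_prod_right'
  have hBm : MeasurableSet B := measurableSet_le measurable_const hNm
  obtain ⟨MF, hMF⟩ : ∃ MF, ∀ w, ‖F w‖ ≤ MF := ⟨_, norm_opT_le bK hM hM'⟩
  have hVtop : ∀ w, V w ≤ ENNReal.ofReal MF ^ p := by
    intro w
    refine (indicator_le_self' (fun _ _ => zero_le) w).trans ?_
    gcongr
    rw [← ofReal_norm]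
    exact ENNReal.ofReal_le_ofReal (hMF w)
  set NT : ℝ≥0∞ := ENNReal.ofReal MF ^ p * ν univ with hNT
  have hNle : ∀ x, N x ≤ NT := by
    intro x
    calc N x ≤ ∫⁻ z, ENNReal.ofReal MF ^ p ∂ν := lintegral_mono fun z => hVtop _
      _ = NT := by rw [lintegral_const]
  have hNTt : NT ≠ ∞ := ENNReal.mul_ne_top (ENNReal.rpow_ne_top_of_nonneg hp0.le
    ENNReal.ofReal_ne_top) (measure_ne_top _ _)
  have hNt : ∀ x, N x ≠ ∞ := fun x => ne_top_of_le_ne_top hNTt (hNle x)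
  have hN0 : ∀ x ∈ B, N x ≠ 0 := by
    intro x hx h
    have hx' : ENNReal.ofReal ε ≤ N x := hx
    rw [h] at hx'
    simp at hx'
    linarith
  have hQt : Q ≠ ∞ := by
    refine ne_top_of_le_ne_top (b := ∫⁻ x, NT ^ (q / p) ∂μ) ?_ (lintegral_mono fun x => ?_)
    · rw [lintegral_const]
      exact ENNReal.mul_ne_top (ENNReal.rpow_ne_top_of_nonneg (by positivity) hNTt)
        (measure_ne_top _ _)
    · refine (indicator_le_self' (fun _ _ => zero_le) x).trans ?_
      exact ENNReal.rpow_le_rpow (hNle x) (by positivity)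
  have hSt : S ≠ ∞ := by
    refine ne_top_of_le_ne_top (b := ∫⁻ x, ENNReal.ofReal M' ^ p ∂l) ?_ (lintegral_mono fun x => ?_)
    · rw [lintegral_const]
      exact ENNReal.mul_ne_top (ENNReal.rpow_ne_top_of_nonneg hp0.le ENNReal.ofReal_ne_top)
        (measure_ne_top _ _)
    · dsimp only
      gcongr
      rw [← ofReal_norm]
      exact ENNReal.ofReal_le_ofReal (hM' x)
  -- the analytic families
  set lf : Y → ℝ := fun y => if f y = 0 then 0 else Real.log ‖f y‖ with hlf
  set lF : X × Z → ℝ := fun w => if w ∈ A then Real.log ‖F w‖ else 0 with hlF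
  set lN : X × Z → ℝ := fun w => if w.1 ∈ B then Real.log (N w.1).toReal else 0 with hlN
  set Gf : Y → ℂ := fun y => f y / ‖f y‖ * Complex.exp ((p * α * lf y : ℝ)) with hGf
  set Lf : Y → ℝ := fun y => p * (1 / 2 - α) * lf y with hLf
  set AB : Set (X × Z) := A ∩ Prod.fst ⁻¹' B with hAB
  set Gg : X × Z → ℂ := AB.indicator fun w => (starRingEnd ℂ (F w) / ‖F w‖) *
    Complex.exp ((p * (1 - α) * lF w + (q / p - (1 - α)) * lN w : ℝ)) with hGg
  set Lg : X × Z → ℝ := fun w => p * (α - 1 / 2) * lF w +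
    (-(q / p / q1) - 1 / 2 + (1 - α)) * lN w with hLg
  have hlfm : Measurable lf := Measurable.ite (hf (measurableSet_singleton 0)) measurable_const
    (Real.measurable_log.comp hf.norm)
  have hlFm : Measurable lF := Measurable.ite hAm (Real.measurable_log.comp hFm.norm)
    measurable_const
  have hlNm : Measurable lN := Measurable.ite (measurable_fst hBm)
    (Real.measurable_log.comp (hNm.comp measurable_fst).ennreal_toReal) measurable_const
  have hABm : MeasurableSet AB := hAm.inter (measurable_fst hBm)
  have hGfm : Measurable Gf := by fun_prop
  have hLfm : Measurable Lf := by fun_prop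
  have hconj : Measurable fun w => starRingEnd ℂ (F w) :=
    Complex.continuous_conj.measurable.comp hFm
  have hGgm : Measurable Gg := Measurable.indicator (by fun_prop) hABm
  have hLgm : Measurable Lg := by fun_prop
  -- bounds
  have logb : ∀ a b t : ℝ, 0 < a → a ≤ t → t ≤ b → |Real.log t| ≤ |Real.log a| + |Real.log b| := by
    intro a b t ha hat htb
    have l1 := Real.log_le_log ha hat
    have l2 := Real.log_le_log (lt_of_lt_of_le ha hat) htb
    rw [abs_le]
    constructor
    · linarith [neg_abs_le (Real.log a), abs_nonneg (Real.log b)]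
    · linarith [le_abs_self (Real.log b), abs_nonneg (Real.log a)]
  obtain ⟨D1, hD1⟩ : ∃ D, ∀ y, |lf y| ≤ D := by
    refine ⟨|Real.log ε| + |Real.log M'|, fun y => ?_⟩
    simp only [hlf]
    split_ifs with h
    · simp; positivity
    · exact logb _ _ _ hε ((hfε y).resolve_left h) (hM' y)
  obtain ⟨D2, hD2⟩ : ∃ D, ∀ y, |lF y| ≤ D := by
    refine ⟨|Real.log ε| + |Real.log MF|, fun y => ?_⟩
    simp only [hlF]
    split_ifs with h
    · exact logb _ _ _ hε h (hMF y)
    · simp; positivity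
  obtain ⟨D3, hD3⟩ : ∃ D, ∀ y, |lN y| ≤ D := by
    refine ⟨|Real.log ε| + |Real.log NT.toReal|, fun y => ?_⟩
    simp only [hlN]
    split_ifs with h
    · refine logb _ _ _ hε ?_ (ENNReal.toReal_mono hNTt (hNle _))
      exact (ENNReal.ofReal_le_iff_le_toReal (hNt _)).1 h
    · simp; positivity
  have linb : ∀ (c t D : ℝ), |t| ≤ D → |c * t| ≤ |c| * D := by
    intro c t D h; rw [abs_mul]; exact mul_le_mul_of_nonneg_left h (abs_nonneg _)
  have sgnb : ∀ a : ℂ, ‖a / ‖a‖‖ ≤ 1 := by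
    intro a; rw [norm_div, Complex.norm_real, norm_norm]; exact div_self_le_one _
  obtain ⟨E1, hE1⟩ : ∃ D, ∀ y, ‖Gf y‖ ≤ D := by
    refine ⟨1 * Real.exp (|p * α| * D1), fun y => ?_⟩
    simp only [hGf]
    rw [norm_mul]
    refine mul_le_mul (sgnb _) ?_ (norm_nonneg _) zero_le_one
    rw [Complex.norm_exp, Complex.ofReal_re]
    exact Real.exp_le_exp.2 ((le_abs_self _).trans (linb _ _ _ (hD1 y)))
  obtain ⟨E2, hE2⟩ : ∃ D, ∀ y, |Lf y| ≤ D := ⟨_, fun y => linb _ _ _ (hD1 y)⟩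
  obtain ⟨E3, hE3⟩ : ∃ D, ∀ y, ‖Gg y‖ ≤ D := by
    refine ⟨1 * Real.exp (|p * (1 - α)| * D2 + |(q / p - (1 - α))| * D3), fun y => ?_⟩
    refine (norm_indicator_le_norm_self _ _).trans ?_
    rw [norm_mul]
    refine mul_le_mul ?_ ?_ (norm_nonneg _) zero_le_one
    · have := sgnb (starRingEnd ℂ (F y))
      rwa [RCLike.norm_conj] at this
    rw [Complex.norm_exp, Complex.ofReal_re]
    exact Real.exp_le_exp.2 (((le_abs_self _).trans (abs_add_le _ _)).trans
      (add_le_add (linb _ _ _ (hD2 y)) (linb _ _ _ (hD3 y))))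
  obtain ⟨E4, hE4⟩ : ∃ D, ∀ y, |Lg y| ≤ D :=
    ⟨_, fun y => (abs_add_le _ _).trans (add_le_add (linb _ _ _ (hD2 y)) (linb _ _ _ (hD3 y)))⟩
  have hθ0 : 0 < θ := by
    rcases h0.eq_or_lt with h | h
    · rw [← h, zero_div] at hq; exact absurd hq (by positivity)
    · exact h
  let fz : ℂ → Y → ℂ := fun z y => Gf y * Complex.exp (z * Lf y)
  let gz : ℂ → X × Z → ℂ := fun z w => Gg w * Complex.exp (z * Lg w)
  have hfz0 : ∀ z y, f y = 0 → fz z y = 0 := by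
    intro z y h; simp [fz, hGf, h]
  have hfz1 : ∀ z y, f y ≠ 0 → fz z y = f y / ‖f y‖ *
      Complex.exp ((p * α + z * (p * (1 / 2 - α))) * (Real.log (‖f y‖ₑ).toReal : ℂ)) := by
    intro z y h
    simp only [fz, hGf, hLf, hlf, h, if_false, toReal_enorm]
    rw [mul_assoc, ← Complex.exp_add]
    push_cast
    ring_nf
  have esgn : ∀ a : ℂ, a ≠ 0 → ‖a / ‖a‖‖ₑ = 1 := by
    intro a ha
    rw [← ofReal_norm, norm_div, Complex.norm_real, norm_norm, div_self (norm_ne_zero_iff.2 ha),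
      ENNReal.ofReal_one]
  have hfze : ∀ z y, f y ≠ 0 → ‖fz z y‖ₑ = ‖f y‖ₑ ^ (p * α + z.re * (p * (1 / 2 - α))) := by
    intro z y h
    rw [hfz1 z y h, enorm_mul, esgn _ h, one_mul, enorm_cexp_log (enorm_ne_zero.2 h) enorm_ne_top]
    congr 1
    have e : ((p:ℂ) * α + z * (p * (1 / 2 - α))) = ((p * α : ℝ) : ℂ)
      + z * ((p * (1 / 2 - α) : ℝ) : ℂ) := by push_cast; ring
    rw [e, Complex.add_re, Complex.ofReal_re, Complex.re_mul_ofReal]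
  have hF0 : ∀ w ∈ A, F w ≠ 0 := by
    intro w hw h
    have : ε ≤ ‖F w‖ := hw
    rw [h, norm_zero] at this
    linarith
  have hgz0 : ∀ z w, w ∉ AB → gz z w = 0 := by
    intro z w h; simp only [gz, hGg]; rw [indicator_of_notMem h, zero_mul]
  have hgz1 : ∀ z w, w ∈ AB → gz z w = starRingEnd ℂ (F w) / ‖F w‖ *
      (Complex.exp ((p * (1 - α) + z * (p * (α - 1 / 2))) * (Real.log (‖F w‖ₑ).toReal : ℂ)) *
      Complex.exp (((q / p - (1 - α)) + z * (-(q / p / q1) - 1 / 2 + (1 - α))) *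
        (Real.log (N w.1).toReal : ℂ))) := by
    intro z w h
    have hb1 : w.1 ∈ B := h.2
    simp only [gz, hGg, hLg, hlF, hlN]
    rw [indicator_of_mem h, if_pos h.1, if_pos hb1, toReal_enorm, mul_assoc, ← Complex.exp_add,
      ← Complex.exp_add]
    push_cast
    ring_nf
  have hgze : ∀ z w, w ∈ AB → ‖gz z w‖ₑ = ‖F w‖ₑ ^ (p * (1 - α) + z.re * (p * (α - 1 / 2))) *
      N w.1 ^ ((q / p - (1 - α)) + z.re * (-(q / p / q1) - 1 / 2 + (1 - α))) := by
    intro z w h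
    have hs : ‖starRingEnd ℂ (F w) / ‖F w‖‖ₑ = 1 := by
      have := esgn (starRingEnd ℂ (F w)) (by simpa using hF0 w h.1)
      rwa [RCLike.norm_conj] at this
    rw [hgz1 z w h, enorm_mul, hs, one_mul, enorm_mul, enorm_cexp_log
      (enorm_ne_zero.2 (hF0 w h.1)) enorm_ne_top, enorm_cexp_log (hN0 _ h.2) (hNt _)]
    congr 2
    · have e : ((p:ℂ) * (1 - α) + z * (p * (α - 1 / 2))) = ((p * (1 - α) : ℝ) : ℂ)
        + z * ((p * (α - 1 / 2) : ℝ) : ℂ) := by push_cast; ring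
      rw [e, Complex.add_re, Complex.ofReal_re, Complex.re_mul_ofReal]
    · have e : (((q:ℂ) / p - (1 - α)) + z * (-(q / p / q1) - 1 / 2 + (1 - α))) =
        ((q / p - (1 - α) : ℝ) : ℂ)
        + z * ((-(q / p / q1) - 1 / 2 + (1 - α) : ℝ) : ℂ) := by push_cast; ring
      rw [e, Complex.add_re, Complex.ofReal_re, Complex.re_mul_ofReal]
  have hfzm : ∀ z, Measurable (fz z) := fun z => by fun_prop
  have hgzm : ∀ z, Measurable (gz z) := fun z => by fun_prop
  have hfzb : ∀ z, BdM (fz z) := by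
    intro z
    refine ⟨hfzm z, E1 * Real.exp (|z.re| * E2), fun y => ?_⟩
    simp only [fz]
    rw [norm_mul, Complex.norm_exp, Complex.re_mul_ofReal]
    have : z.re * Lf y ≤ |z.re| * E2 := (le_abs_self _).trans (linb _ _ _ (hE2 y))
    exact mul_le_mul (hE1 y) (Real.exp_le_exp.2 this) (Real.exp_pos _).le
      ((norm_nonneg _).trans (hE1 y))
  have hTm : ∀ z, Measurable (opT K l (fz z)) := fun z => measurable_opT hK (hfzm z)
  -- passage to iterated lintegrals
  have iter : ∀ z, ‖∫ w, gz z w * opT K l (fz z) w ∂(μ.prod ν)‖ₑ ≤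
      ∫⁻ x, ∫⁻ ζ, ‖gz z (x, ζ)‖ₑ * ‖opT K l (fz z) (x, ζ)‖ₑ ∂ν ∂μ := by
    intro z
    refine (enorm_integral_le_lintegral_enorm _).trans ?_
    have hmm : Measurable fun w => ‖gz z w * opT K l (fz z) w‖ₑ := ((hgzm z).mul (hTm z)).enorm
    rw [lintegral_prod _ hmm.aemeasurable]
    simp only [enorm_mul]
    exact le_rfl
  have hVA : ∀ w ∈ A, V w = ‖F w‖ₑ ^ p := fun w hw => indicator_of_mem hw _
  have bound0 : ∀ z : ℂ, z.re = 0 → ‖∫ w, gz z w * opT K l (fz z) w ∂(μ.prod ν)‖ₑ ≤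
      C1 * S ^ α * Q := by
    intro z hz
    refine (iter z).trans ?_
    rw [hQ, ← lintegral_const_mul _ ((hNm.pow_const _).indicator hBm)]
    refine lintegral_mono fun x => ?_
    by_cases hx : x ∈ B
    · rw [indicator_of_mem hx]
      calc ∫⁻ ζ, ‖gz z (x, ζ)‖ₑ * ‖opT K l (fz z) (x, ζ)‖ₑ ∂ν
          ≤ ∫⁻ ζ, N x ^ (q / p - (1 - α)) *
              (V (x, ζ) ^ (1 - α) * ‖opT K l (fz z) (x, ζ)‖ₑ) ∂ν := by
            refine lintegral_mono fun ζ => ?_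
            rw [← mul_assoc]
            refine mul_le_mul_left ?_ _
            by_cases hw : (x, ζ) ∈ AB
            · rw [hgze z _ hw, hz, zero_mul, add_zero, zero_mul, add_zero, hVA _ hw.1,
                ← ENNReal.rpow_mul, mul_comm]
            · rw [hgz0 z _ hw]; simp
        _ = N x ^ (q / p - (1 - α)) *
              ∫⁻ ζ, (V (x, ζ) ^ (1 - α) * ‖opT K l (fz z) (x, ζ)‖ₑ) ∂ν := by
            refine lintegral_const_mul _ ?_
            have : Measurable fun ζ => opT K l (fz z) (x, ζ) := (hTm z).comp measurable_prodMk_left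
            have : Measurable fun ζ => V (x, ζ) := hVm.comp measurable_prodMk_left
            fun_prop
        _ ≤ N x ^ (q / p - (1 - α)) * (C1 * S ^ α * N x ^ (1 - α)) := by
            refine mul_le_mul_right ?_ _
            refine H0 x (fz z) (hfzb z) (fun y => ‖f y‖ₑ ^ p) (fun ζ => V (x, ζ)) (by fun_prop)
              (hVm.comp measurable_prodMk_left) fun y => ?_
            by_cases hy : f y = 0
            · rw [hfz0 z y hy]; simp
            · rw [hfze z y hy, hz, zero_mul, add_zero, ENNReal.rpow_mul]
        _ = C1 * S ^ α * N x ^ (q / p) := by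
            have : N x ^ (q / p) = N x ^ (q / p - (1 - α)) * N x ^ (1 - α) := by
              rw [← ENNReal.rpow_add _ _ (hN0 x hx) (hNt x)]; congr 1; ring
            rw [this]; ring
    · rw [indicator_of_notMem hx]
      have : ∀ ζ, gz z (x, ζ) = 0 := fun ζ => hgz0 z _ (fun h => hx h.2)
      simp [this]
  have bound1 : ∀ z : ℂ, z.re = 1 → ‖∫ w, gz z w * opT K l (fz z) w ∂(μ.prod ν)‖ₑ ≤
      Q ^ (1 - 1 / q1) * (C2 * S ^ (1 / 2 : ℝ)) := by
    intro z hz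
    set R : X → ℝ≥0∞ := fun x => ∫⁻ ζ, ‖opT K l (fz z) (x, ζ)‖ₑ ^ (2:ℝ) ∂ν with hR
    have hRm : Measurable R := by
      have : Measurable fun w => ‖opT K l (fz z) w‖ₑ ^ (2:ℝ) := by
        have := hTm z
        fun_prop
      exact this.lintegral_prod_right'
    refine (iter z).trans ?_
    have step : ∀ x, ∫⁻ ζ, ‖gz z (x, ζ)‖ₑ * ‖opT K l (fz z) (x, ζ)‖ₑ ∂ν ≤
        (B.indicator (fun x => N x ^ (q / p * (1 - 1 / q1))) x) * R x ^ (1 / 2 : ℝ) := by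
      intro x
      by_cases hx : x ∈ B
      · rw [indicator_of_mem hx]
        have m1 : Measurable fun ζ => opT K l (fz z) (x, ζ) := (hTm z).comp measurable_prodMk_left
        have m2 : Measurable fun ζ => V (x, ζ) := hVm.comp measurable_prodMk_left
        calc ∫⁻ ζ, ‖gz z (x, ζ)‖ₑ * ‖opT K l (fz z) (x, ζ)‖ₑ ∂ν
            ≤ ∫⁻ ζ, N x ^ (q / p * (1 - 1 / q1) - 1 / 2) *
                (V (x, ζ) ^ (1 / 2 : ℝ) * ‖opT K l (fz z) (x, ζ)‖ₑ) ∂ν := by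
              refine lintegral_mono fun ζ => ?_
              rw [← mul_assoc]
              refine mul_le_mul_left ?_ _
              by_cases hw : (x, ζ) ∈ AB
              · rw [hgze z _ hw, hz, hVA _ hw.1, ← ENNReal.rpow_mul, mul_comm]
                refine le_of_eq ?_
                congr 2 <;> ring
              · rw [hgz0 z _ hw]; simp
          _ = N x ^ (q / p * (1 - 1 / q1) - 1 / 2) *
                ∫⁻ ζ, (V (x, ζ) ^ (1 / 2 : ℝ) * ‖opT K l (fz z) (x, ζ)‖ₑ) ∂ν := by
              refine lintegral_const_mul _ ?_
              fun_prop
          _ ≤ N x ^ (q / p * (1 - 1 / q1) - 1 / 2) * (N x ^ (1 / 2 : ℝ) * R x ^ (1 / 2 : ℝ)) := by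
              refine mul_le_mul_right ?_ _
              have hh := ENNReal.lintegral_mul_le_Lp_mul_Lq ν Real.HolderConjugate.two_two
                (f := fun ζ => V (x, ζ) ^ (1 / 2 : ℝ)) (g := fun ζ => ‖opT K l (fz z) (x, ζ)‖ₑ)
                (by fun_prop) (by fun_prop)
              refine hh.trans (le_of_eq ?_)
              congr 2
              refine lintegral_congr fun ζ => ?_
              rw [← ENNReal.rpow_mul]; norm_num
          _ = N x ^ (q / p * (1 - 1 / q1)) * R x ^ (1 / 2 : ℝ) := by
              rw [← mul_assoc, ← ENNReal.rpow_add _ _ (hN0 x hx) (hNt x)]; congr 2; ring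
      · rw [indicator_of_notMem hx]
        have : ∀ ζ, gz z (x, ζ) = 0 := fun ζ => hgz0 z _ (fun h => hx h.2)
        simp [this]
    refine (lintegral_mono step).trans ?_
    have hc : Real.HolderConjugate (q1 / (q1 - 1)) q1 := (Real.HolderConjugate.conjExponent hq1).symm
    have hh := ENNReal.lintegral_mul_le_Lp_mul_Lq μ hc
      (f := B.indicator (fun x => N x ^ (q / p * (1 - 1 / q1))))
      (g := fun x => R x ^ (1 / 2 : ℝ))
      ((hNm.pow_const _).indicator hBm).aemeasurable (hRm.pow_const _).aemeasurable
    have hq1' : 0 < q1 - 1 := by linarith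
    refine hh.trans (mul_le_mul' (le_of_eq ?_) ?_)
    · have e1 : 1 / (q1 / (q1 - 1)) = 1 - 1 / q1 := by field_simp
      rw [e1, hQ]
      congr 1
      refine lintegral_congr fun x => ?_
      by_cases hx : x ∈ B
      · rw [indicator_of_mem hx, indicator_of_mem hx, ← ENNReal.rpow_mul]
        congr 1
        field_simp
      · rw [indicator_of_notMem hx, indicator_of_notMem hx, ENNReal.zero_rpow_of_pos]
        positivity
    · have h2 := H1 (fz z) (hfzb z)
      have e2 : ∫⁻ x, (R x ^ (1 / 2 : ℝ)) ^ q1 ∂μ = ∫⁻ x, R x ^ (q1 / 2) ∂μ := by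
        refine lintegral_congr fun x => ?_
        rw [← ENNReal.rpow_mul]; congr 1; ring
      have e3 : ∫⁻ y, ‖fz z y‖ₑ ^ (2:ℝ) ∂l = S := by
        refine lintegral_congr fun y => ?_
        by_cases hy : f y = 0
        · rw [hfz0 z y hy, hy]; simp [hp0]
        · rw [hfze z y hy, hz, ← ENNReal.rpow_mul]; congr 1; ring
      rw [e3] at h2
      rw [e2]
      refine (ENNReal.rpow_le_rpow h2 (by positivity)).trans (le_of_eq ?_)
      rw [← ENNReal.rpow_mul, mul_one_div, div_self (by positivity), ENNReal.rpow_one]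
  have exf : p * α + θ * (p * (1 / 2 - α)) = 1 := by
    have : p * α + θ * (p * (1 / 2 - α)) = p * (α + θ * (1 / 2 - α)) := by ring
    rw [this, ← hp]; field_simp
  have hfθ : fz (θ : ℂ) = f := by
    funext y
    by_cases hy : f y = 0
    · rw [hfz0 _ y hy, hy]
    · rw [hfz1 _ y hy]
      have e : ((p:ℂ) * α + (θ:ℂ) * (p * (1 / 2 - α))) = ((p * α + θ * (p * (1 / 2 - α)) : ℝ) : ℂ) := by
        push_cast; ring
      rw [e, exf, toReal_enorm, Complex.ofReal_one, one_mul, ← Complex.ofReal_exp,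
        Real.exp_log (norm_pos_iff.2 hy)]
      have : (‖f y‖ : ℂ) ≠ 0 := by exact_mod_cast (norm_pos_iff.2 hy).ne'
      field_simp
  have hQle : Q ≤ ‖∫ w, gz (θ : ℂ) w * opT K l (fz (θ : ℂ)) w ∂(μ.prod ν)‖ₑ := by
    set r : X × Z → ℝ := AB.indicator fun w => ‖F w‖ ^ p * (N w.1).toReal ^ (q / p - 1) with hr
    have exg : p * (1 - α) + θ * (p * (α - 1 / 2)) = p - 1 := by linarith
    have exn : (q / p - (1 - α)) + θ * (-(q / p / q1) - 1 / 2 + (1 - α)) = q / p - 1 := by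
      have e1 : θ * (q / p / q1) = 1 / p := by
        have : θ * (q / p / q1) = (θ / q1) * q * (1 / p) := by ring
        rw [this, ← hq]; field_simp
      have e2 : α + θ * (1 / 2 - α) = 1 / p := hp.symm
      linarith
    have e : ∀ w, gz (θ : ℂ) w * opT K l (fz (θ : ℂ)) w = (r w : ℂ) := by
      intro w
      rw [hfθ, ← hF]
      by_cases hw : w ∈ AB
      · rw [hgz1 _ w hw, hr, indicator_of_mem hw]
        have i1 : ((p:ℂ) * (1 - α) + (θ:ℂ) * (p * (α - 1 / 2))) = ((p - 1 : ℝ) : ℂ) := by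
          rw [← exg]; push_cast; ring
        have i2 : (((q:ℂ) / p - (1 - α)) + (θ:ℂ) * (-(q / p / q1) - 1 / 2 + (1 - α))) =
            ((q / p - 1 : ℝ) : ℂ) := by
          rw [← exn]; push_cast; ring
        have hFp : 0 < ‖F w‖ := norm_pos_iff.2 (hF0 w hw.1)
        have hNp : 0 < (N w.1).toReal := ENNReal.toReal_pos (hN0 _ hw.2) (hNt _)
        rw [i1, i2, ← Complex.ofReal_mul, ← Complex.ofReal_mul, ← Complex.ofReal_exp,
          ← Complex.ofReal_exp, mul_comm (p - 1), mul_comm (q / p - 1), toReal_enorm,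
          ← Real.rpow_def_of_pos hFp, ← Real.rpow_def_of_pos hNp]
        have c1 : starRingEnd ℂ (F w) * F w = ((‖F w‖ * ‖F w‖ : ℝ) : ℂ) := by
          rw [mul_comm, Complex.mul_conj, Complex.normSq_eq_norm_sq, pow_two]
        have c2 : starRingEnd ℂ (F w) / ‖F w‖ * F w = (‖F w‖ : ℂ) := by
          rw [div_mul_eq_mul_div, c1]; push_cast
          have : (‖F w‖ : ℂ) ≠ 0 := by exact_mod_cast hFp.ne'
          field_simp
        rw [mul_right_comm, c2, Real.rpow_sub_one hFp.ne']
        push_cast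
        have : (‖F w‖ : ℂ) ≠ 0 := by exact_mod_cast hFp.ne'
        field_simp
      · rw [hgz0 _ w hw, hr, indicator_of_notMem hw]; simp
    have hrn : ∀ w, 0 ≤ r w := fun w => indicator_nonneg (fun w _ => by positivity) w
    have hrm : Measurable r := Measurable.indicator
      ((hFm.norm.pow_const _).mul ((hNm.comp measurable_fst).ennreal_toReal.pow_const _)) hABm
    have hgb : ∃ D, ∀ w, ‖gz (θ:ℂ) w‖ ≤ D := by
      refine ⟨E3 * Real.exp (|θ| * E4), fun w => ?_⟩
      simp only [gz]
      rw [norm_mul, Complex.norm_exp, Complex.re_mul_ofReal, Complex.ofReal_re]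
      have : θ * Lg w ≤ |θ| * E4 := (le_abs_self _).trans (linb _ _ _ (hE4 w))
      exact mul_le_mul (hE3 w) (Real.exp_le_exp.2 this) (Real.exp_pos _).le
        ((norm_nonneg _).trans (hE3 w))
    obtain ⟨D, hD⟩ := hgb
    have hri : Integrable r (μ.prod ν) := by
      refine Integrable.of_bound hrm.aestronglyMeasurable (D * MF)
        (Filter.Eventually.of_forall fun w => ?_)
      have : ‖r w‖ = ‖gz (θ : ℂ) w * opT K l (fz (θ : ℂ)) w‖ := by rw [e, Complex.norm_real]
      rw [this, norm_mul, hfθ]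
      exact mul_le_mul (hD w) (hMF w) (norm_nonneg _) ((norm_nonneg _).trans (hD w))
    simp only [e]
    rw [integral_complex_ofReal, ← ofReal_norm, Complex.norm_real,
      Real.norm_of_nonneg (integral_nonneg hrn), ofReal_integral_eq_lintegral_ofReal hri
      (Filter.Eventually.of_forall hrn), lintegral_prod _ hrm.ennreal_ofReal.aemeasurable]
    refine lintegral_mono fun x => ?_
    by_cases hx : x ∈ B
    · rw [indicator_of_mem hx]
      have e1 : ∀ ζ, ENNReal.ofReal (r (x, ζ)) = V (x, ζ) * N x ^ (q / p - 1) := by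
        intro ζ
        by_cases hw : (x, ζ) ∈ A
        · have hw' : (x, ζ) ∈ AB := ⟨hw, hx⟩
          have hFp : 0 < ‖F (x, ζ)‖ := norm_pos_iff.2 (hF0 _ hw)
          have hNp : 0 < (N x).toReal := ENNReal.toReal_pos (hN0 _ hx) (hNt _)
          rw [hr, indicator_of_mem hw', hVA _ hw, ENNReal.ofReal_mul (by positivity),
            ← ENNReal.ofReal_rpow_of_pos hFp, ← ENNReal.ofReal_rpow_of_pos hNp, ofReal_norm,
            ENNReal.ofReal_toReal (hNt _)]
        · have hw' : (x, ζ) ∉ AB := fun h => hw h.1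
          rw [hr, indicator_of_notMem hw', hV, indicator_of_notMem hw]; simp
      simp only [e1]
      have hVx : Measurable fun ζ => V (x, ζ) := hVm.comp measurable_prodMk_left
      rw [lintegral_mul_const _ hVx]
      change N x ^ (q / p) ≤ N x * N x ^ (q / p - 1)
      refine le_of_eq ?_
      have : N x ^ (1 + (q / p - 1)) = N x * N x ^ (q / p - 1) := by
        rw [ENNReal.rpow_add _ _ (hN0 x hx) (hNt x), ENNReal.rpow_one]
      rw [← this]
      congr 1; ring
    · rw [indicator_of_notMem hx]; exact zero_le
  have ha0 : (C1:ℝ≥0∞) * S ^ α * Q ≠ ∞ := ENNReal.mul_ne_top (ENNReal.mul_ne_top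
    ENNReal.coe_ne_top (ENNReal.rpow_ne_top_of_nonneg hα0 hSt)) hQt
  have h1q : 0 ≤ 1 - 1 / q1 := by
    rw [sub_nonneg, div_le_one (by positivity)]; exact hq1.le
  have hb0 : Q ^ (1 - 1 / q1) * (C2 * S ^ (1 / 2 : ℝ)) ≠ ∞ := ENNReal.mul_ne_top
    (ENNReal.rpow_ne_top_of_nonneg h1q hQt) (ENNReal.mul_ne_top
    ENNReal.coe_ne_top (ENNReal.rpow_ne_top_of_nonneg (by norm_num) hSt))
  obtain ⟨MM, m1, m2, m3, m4, m5⟩ : ∃ MM : ℝ, M ≤ MM ∧ E1 ≤ MM ∧ E2 ≤ MM ∧ E3 ≤ MM ∧ E4 ≤ MM := by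
    refine ⟨max M (max E1 (max E2 (max E3 E4))), ?_, ?_, ?_, ?_, ?_⟩ <;> simp
  have tl := threeLines (μ.prod ν) l K hK Gf Lf Gg Lg hGfm hLfm hGgm hLgm MM
    (fun w y => (bK w y).trans m1) (fun y => (hE1 y).trans m2) (fun y => (hE2 y).trans m3)
    (fun y => (hE3 y).trans m4) (fun y => (hE4 y).trans m5)
    ((C1:ℝ≥0∞) * S ^ α * Q).toReal (Q ^ (1 - 1 / q1) * (C2 * S ^ (1 / 2 : ℝ))).toReal θ h0 h1
    (fun z hz => by
      have := ENNReal.toReal_mono ha0 (bound0 z hz)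
      rwa [toReal_enorm] at this)
    (fun z hz => by
      have := ENNReal.toReal_mono hb0 (bound1 z hz)
      rwa [toReal_enorm] at this)
  have main : Q ≤ ((C1:ℝ≥0∞) * S ^ α * Q) ^ (1 - θ) *
      (Q ^ (1 - 1 / q1) * (C2 * S ^ (1 / 2 : ℝ))) ^ θ := by
    refine hQle.trans ?_
    rw [← ofReal_norm]
    refine (ENNReal.ofReal_le_ofReal tl).trans ?_
    rw [ENNReal.ofReal_mul (by positivity), ← ENNReal.ofReal_rpow_of_nonneg (by positivity)
      (by linarith), ← ENNReal.ofReal_rpow_of_nonneg (by positivity) h0, ENNReal.ofReal_toReal ha0,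
      ENNReal.ofReal_toReal hb0]
  have hθ1 : 0 ≤ 1 - θ := by linarith
  rw [ENNReal.mul_rpow_of_nonneg _ _ hθ1, ENNReal.mul_rpow_of_nonneg _ _ hθ1,
    ENNReal.mul_rpow_of_nonneg _ _ h0, ENNReal.mul_rpow_of_nonneg _ _ h0,
    ← ENNReal.rpow_mul, ← ENNReal.rpow_mul, ← ENNReal.rpow_mul] at main
  by_cases hQ0 : Q = 0
  · rw [hQ0]; exact zero_le
  have key : Q ^ (1 / q) ≤ (C1:ℝ≥0∞) ^ (1 - θ) * (C2:ℝ≥0∞) ^ θ * S ^ (1 / p) := by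
    have hexp : S ^ (1 / p) = S ^ (α * (1 - θ)) * S ^ (1 / 2 * θ) := by
      rw [← ENNReal.rpow_add_of_nonneg _ _ (by positivity) (by positivity), hp]; congr 1; ring
    have hQe : Q ^ (1 - θ) * Q ^ ((1 - 1 / q1) * θ) = Q ^ (1 - 1 / q) := by
      rw [← ENNReal.rpow_add _ _ hQ0 hQt, hq]; congr 1; ring
    have hQs : Q = Q ^ (1 - 1 / q) * Q ^ (1 / q) := by
      rw [← ENNReal.rpow_add _ _ hQ0 hQt]; simp
    have main2 : Q ^ (1 - 1 / q) * Q ^ (1 / q) ≤ Q ^ (1 - 1 / q) *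
        ((C1:ℝ≥0∞) ^ (1 - θ) * (C2:ℝ≥0∞) ^ θ * S ^ (1 / p)) := by
      rw [← hQs, ← hQe, hexp]
      refine main.trans (le_of_eq ?_)
      ring
    refine (ENNReal.mul_le_mul_iff_right ?_ ?_).1 main2
    · simp [hQ0, hQt]
    · simp [hQ0, hQt]
  calc Q = (Q ^ (1 / q)) ^ q := by rw [← ENNReal.rpow_mul]; simp [hq0.ne']
    _ ≤ _ := ENNReal.rpow_le_rpow key hq0.le

lemma tendsto_trunc {a : ℕ → ℝ≥0∞} {b : ℝ≥0∞} {e : ℕ → ℝ≥0∞}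
    (ha : Filter.Tendsto a Filter.atTop (nhds b)) (he : Filter.Tendsto e Filter.atTop (nhds 0))
    {r : ℝ} (hr : 0 < r) :
    Filter.Tendsto (fun k => {t | e k ≤ t}.indicator (fun t => t ^ r) (a k)) Filter.atTop
      (nhds (b ^ r)) := by
  have h1 : Filter.Tendsto (fun k => a k ^ r) Filter.atTop (nhds (b ^ r)) :=
    (ENNReal.continuous_rpow_const.tendsto b).comp ha
  by_cases hb : b = 0
  · rw [hb, ENNReal.zero_rpow_of_pos hr] at h1 ⊢
    exact tendsto_of_tendsto_of_tendsto_of_le_of_le tendsto_const_nhds h1 (fun _ => zero_le)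
      (fun k => indicator_le_self' (fun _ _ => zero_le) _)
  · have hlt := he.eventually_lt ha (pos_iff_ne_zero.2 hb)
    refine h1.congr' ?_
    filter_upwards [hlt] with k hk
    rw [indicator_of_mem]
    exact hk.le

lemma rt_main {X Z Y : Type*} [MeasurableSpace X] [MeasurableSpace Z] [MeasurableSpace Y]
    (μ : Measure X) (ν : Measure Z) (l : Measure Y) [IsFiniteMeasure μ] [IsFiniteMeasure ν]
    [IsFiniteMeasure l] (K : X × Z → Y → ℂ)
    (hK : Measurable (Function.uncurry K)) (M : ℝ) (hM : 0 ≤ M) (bK : ∀ w y, ‖K w y‖ ≤ M)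
    (α θ p q q1 : ℝ) (hα0 : 0 ≤ α) (hα1 : α ≤ 1) (h0 : 0 ≤ θ) (h1 : θ ≤ 1) (hp0 : 0 < p)
    (hq0 : 0 < q) (hq1 : 1 < q1)
    (hp : 1 / p = α + θ * (1 / 2 - α)) (hq : 1 / q = θ / q1) (C1 C2 : ℝ≥0)
    (H0 : ∀ x, ∀ f : Y → ℂ, BdM f → ∀ A : Y → ℝ≥0∞, ∀ V : Z → ℝ≥0∞, Measurable A → Measurable V →
      (∀ y, ‖f y‖ₑ ≤ A y ^ α) → ∫⁻ z, V z ^ (1 - α) * ‖opT K l f (x, z)‖ₑ ∂ν ≤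
        C1 * (∫⁻ y, A y ∂l) ^ α * (∫⁻ z, V z ∂ν) ^ (1 - α))
    (H1 : ∀ f : Y → ℂ, BdM f → ∫⁻ x, (∫⁻ z, ‖opT K l f (x, z)‖ₑ ^ (2:ℝ) ∂ν) ^ (q1 / 2) ∂μ ≤
      (C2 * (∫⁻ y, ‖f y‖ₑ ^ (2:ℝ) ∂l) ^ (1 / 2 : ℝ)) ^ q1)
    (f : Y → ℂ) (hfb : BdM f) :
    ∫⁻ x, (∫⁻ z, ‖opT K l f (x, z)‖ₑ ^ p ∂ν) ^ (q / p) ∂μ ≤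
      ((C1:ℝ≥0∞) ^ (1 - θ) * (C2:ℝ≥0∞) ^ θ * (∫⁻ y, ‖f y‖ₑ ^ p ∂l) ^ (1 / p)) ^ q := by
  obtain ⟨hf, M', hM'⟩ := hfb
  let e : ℕ → ℝ := fun k => 1 / ((k:ℝ) + 1)
  have he0 : ∀ k, 0 < e k := fun k => by positivity
  have het : Filter.Tendsto e Filter.atTop (nhds 0) := tendsto_one_div_add_atTop_nhds_zero_nat
  have het' : Filter.Tendsto (fun k => ENNReal.ofReal (e k)) Filter.atTop (nhds 0) := by
    simpa using ENNReal.tendsto_ofReal het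
  let fk : ℕ → Y → ℂ := fun k => {y | e k ≤ ‖f y‖}.indicator f
  have hfkm : ∀ k, Measurable (fk k) := fun k => hf.indicator
    (measurableSet_le measurable_const hf.norm)
  have hfkle : ∀ k y, ‖fk k y‖ ≤ ‖f y‖ := fun k y => norm_indicator_le_norm_self _ _
  have hfke : ∀ k y, fk k y = 0 ∨ e k ≤ ‖fk k y‖ := by
    intro k y
    by_cases h : y ∈ {y | e k ≤ ‖f y‖}
    · right; simp only [fk]; rw [indicator_of_mem h]; exact h
    · left; simp only [fk]; rw [indicator_of_notMem h]
  have hsub : ∀ k y, ‖fk k y - f y‖ ≤ e k := by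
    intro k y
    by_cases h : y ∈ {y | e k ≤ ‖f y‖}
    · simp only [fk]; rw [indicator_of_mem h]; simp [(he0 k).le]
    · simp only [fk]; rw [indicator_of_notMem h]; simp only [mem_setOf_eq, not_le] at h
      simpa using h.le
  have hIntg : ∀ g : Y → ℂ, Measurable g → (∀ y, ‖g y‖ ≤ M') → ∀ w,
      Integrable (fun y => K w y * g y) l := by
    intro g hg hb w
    refine Integrable.of_bound ((hK.comp measurable_prodMk_left).mul hg).aestronglyMeasurable
      (M * M') (Filter.Eventually.of_forall fun y => ?_)
    change ‖K w y * g y‖ ≤ _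
    rw [norm_mul]
    exact mul_le_mul (bK w y) (hb y) (norm_nonneg _) hM
  have hFk : ∀ w, Filter.Tendsto (fun k => opT K l (fk k) w) Filter.atTop (nhds (opT K l f w)) := by
    intro w
    rw [tendsto_iff_norm_sub_tendsto_zero]
    refine squeeze_zero (fun _ => norm_nonneg _) (g := fun k => M * e k * l.real univ) (fun k => ?_)
      (by simpa using (het.const_mul M).mul_const (l.real univ))
    have : opT K l (fk k) w - opT K l f w = opT K l (fun y => fk k y - f y) w := by
      simp only [opT]
      rw [← integral_sub (hIntg _ (hfkm k) (fun y => (hfkle k y).trans (hM' y)) w) (hIntg _ hf hM' w)]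
      simp only [mul_sub]
    rw [this]
    exact norm_opT_le bK hM (hsub k) w
  set Nk : ℕ → X → ℝ≥0∞ := fun k x => ∫⁻ z, {w | e k ≤ ‖opT K l (fk k) w‖}.indicator
        (fun w => ‖opT K l (fk k) w‖ₑ ^ p) (x, z) ∂ν with hNk
  have core : ∀ k, ∫⁻ x, ({x | ENNReal.ofReal (e k) ≤ Nk k x}.indicator
      (fun x => Nk k x ^ (q / p)) x) ∂μ ≤
      ((C1:ℝ≥0∞) ^ (1 - θ) * (C2:ℝ≥0∞) ^ θ * (∫⁻ y, ‖f y‖ₑ ^ p ∂l) ^ (1 / p)) ^ q := by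
    intro k
    refine (rt_core μ ν l K hK M hM bK α θ p q q1 hα0 hα1 h0 h1 hp0 hq0 hq1 hp hq C1 C2 H0 H1 (fk k)
      (hfkm k) (e k) M' (he0 k) (fun y => (hfkle k y).trans (hM' y)) (hfke k)).trans ?_
    gcongr with y
    rw [← ofReal_norm, ← ofReal_norm]
    exact ENNReal.ofReal_le_ofReal (hfkle k y)
  have hFm : ∀ k, Measurable (opT K l (fk k)) := fun k => measurable_opT hK (hfkm k)
  have hVm : ∀ k, Measurable ({w | e k ≤ ‖opT K l (fk k) w‖}.indicator
        (fun w => ‖opT K l (fk k) w‖ₑ ^ p)) := fun k =>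
    Measurable.indicator ((hFm k).enorm.pow_const _) (measurableSet_le measurable_const (hFm k).norm)
  have hNm : ∀ k, Measurable (Nk k) := fun k => (hVm k).lintegral_prod_right'
  have hNlim : ∀ x, Filter.Tendsto (fun k => Nk k x) Filter.atTop
      (nhds (∫⁻ z, ‖opT K l f (x, z)‖ₑ ^ p ∂ν)) := by
    intro x
    refine tendsto_lintegral_of_dominated_convergence
      (fun _ => ENNReal.ofReal (M * M' * l.real univ) ^ p)
      (fun k => (hVm k).comp measurable_prodMk_left) (fun k => ?_) ?_ ?_
    · refine Filter.Eventually.of_forall fun z => ?_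
      refine (indicator_le_self' (fun _ _ => zero_le) _).trans ?_
      refine ENNReal.rpow_le_rpow ?_ hp0.le
      rw [← ofReal_norm]
      exact ENNReal.ofReal_le_ofReal (norm_opT_le bK hM (fun y => (hfkle k y).trans (hM' y)) _)
    · rw [lintegral_const]
      exact ENNReal.mul_ne_top (ENNReal.rpow_ne_top_of_nonneg hp0.le ENNReal.ofReal_ne_top)
        (measure_ne_top _ _)
    · refine Filter.Eventually.of_forall fun z => ?_
      have h2 := tendsto_trunc ((hFk (x, z)).enorm) het' hp0
      refine h2.congr fun k => ?_
      simp only [indicator, mem_setOf_eq]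
      have : ENNReal.ofReal (e k) ≤ ‖opT K l (fk k) (x, z)‖ₑ ↔ e k ≤ ‖opT K l (fk k) (x, z)‖ := by
        rw [← ofReal_norm, ENNReal.ofReal_le_ofReal_iff (norm_nonneg _)]
      simp only [this]
  have hlim : ∀ x, Filter.Tendsto (fun k => {x | ENNReal.ofReal (e k) ≤ Nk k x}.indicator
      (fun x => Nk k x ^ (q / p)) x) Filter.atTop
      (nhds ((∫⁻ z, ‖opT K l f (x, z)‖ₑ ^ p ∂ν) ^ (q / p))) := by
    intro x
    refine (tendsto_trunc (hNlim x) het' (r := q / p) (by positivity)).congr fun k => ?_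
    simp only [indicator, mem_setOf_eq]
  calc _ = ∫⁻ x, Filter.liminf (fun k => {x | ENNReal.ofReal (e k) ≤ Nk k x}.indicator
      (fun x => Nk k x ^ (q / p)) x) Filter.atTop ∂μ := by
        refine lintegral_congr fun x => ?_
        rw [(hlim x).liminf_eq]
    _ ≤ Filter.liminf (fun k => ∫⁻ x, {x | ENNReal.ofReal (e k) ≤ Nk k x}.indicator
      (fun x => Nk k x ^ (q / p)) x ∂μ) Filter.atTop := lintegral_liminf_le fun k =>
        ((hNm k).pow_const _).indicator (measurableSet_le measurable_const (hNm k))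
    _ ≤ _ := by
        refine Filter.liminf_le_of_le (by isBoundedDefault) ?_
        intro b hb
        obtain ⟨k, hk⟩ := hb.exists
        exact hk.trans (core k)

section plancherel
variable {V : Type*} [NormedAddCommGroup V] [InnerProductSpace ℝ V] [FiniteDimensional ℝ V]
  [MeasurableSpace V] [BorelSpace V]

lemma fourier_swap {f g : V → ℂ} (hf : Integrable f) (hg : Integrable g) :
    ∫ x, 𝓕 f x * g x = ∫ x, f x * 𝓕 g x := by
  have := VectorFourier.integral_fourierIntegral_smul_eq_flip (L := innerₗ V) (μ := volume)
    (ν := volume) Real.continuous_fourierChar continuous_inner hf hg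
  simpa only [flip_innerₗ, smul_eq_mul] using! this

lemma continuous_fourier {f : V → ℂ} (hf : Integrable f) : Continuous (𝓕 f) :=
  VectorFourier.fourierIntegral_continuous Real.continuous_fourierChar continuous_inner hf

lemma fourier_ae_eq {f : V → ℂ} (hf : Integrable f) (h2 : MemLp f 2) :
    (𝓕 (h2.toLp f) : Lp ℂ 2 (volume : Measure V)) =ᵐ[volume] 𝓕 f := by
  apply ae_eq_of_integral_contDiff_smul_eq
  · exact (Lp.memLp _).locallyIntegrable (by norm_num)
  · exact (continuous_fourier hf).locallyIntegrable
  · intro g hg hgs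
    have h1 := MeasureTheory.Lp.fourier_toTemperedDistribution_eq (h2.toLp f)
    let G : V → ℂ := fun x => (g x : ℂ)
    have hG : ContDiff ℝ (⊤ : ℕ∞) G := Complex.ofRealCLM.contDiff.comp hg
    have hGs : HasCompactSupport G := hgs.comp_left (g := fun x : ℝ => (x : ℂ)) (by simp)
    have h3 := congrArg (fun T : TemperedDistribution V ℂ => T (hGs.toSchwartzMap hG)) h1
    simp only [TemperedDistribution.fourier_apply, Lp.toTemperedDistribution_apply] at h3
    have e1 : ∀ x, (hGs.toSchwartzMap hG) x = G x := fun x => rfl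
    simp only [e1] at h3
    have e2 : ∀ x, (𝓕 (hGs.toSchwartzMap hG) : SchwartzMap V ℂ) x = 𝓕 G x := fun x => by
      rw [SchwartzMap.fourier_coe]; rfl
    simp only [e2] at h3
    have hGi : Integrable G := hG.continuous.integrable_of_hasCompactSupport hGs
    calc _ = ∫ x, G x • (𝓕 (h2.toLp f) : Lp ℂ 2 (volume : Measure V)) x := by
            simp [G, Complex.real_smul]
      _ = ∫ x, 𝓕 G x * f x := by
            rw [← h3]; apply integral_congr_ae
            filter_upwards [h2.coeFn_toLp] with x hx
            rw [hx, smul_eq_mul]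
      _ = _ := by rw [fourier_swap hGi hf]; simp [G, Complex.real_smul]

lemma plancherel {f : V → ℂ} (hf : Integrable f) (h2 : MemLp f 2) :
    ∫⁻ x, ‖𝓕 f x‖ₑ ^ (2:ℝ) = ∫⁻ x, ‖f x‖ₑ ^ (2:ℝ) := by
  have h := MeasureTheory.Lp.norm_fourier_eq (h2.toLp f)
  have e0 : eLpNorm (𝓕 f) 2 volume = eLpNorm f 2 volume := by
    rw [← eLpNorm_congr_ae (fourier_ae_eq hf h2), ← eLpNorm_congr_ae h2.coeFn_toLp]
    rw [Lp.norm_def, Lp.norm_def] at h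
    exact (ENNReal.toReal_eq_toReal_iff' (Lp.eLpNorm_ne_top _) (Lp.eLpNorm_ne_top _)).1 h
  rw [eLpNorm_eq_lintegral_rpow_enorm_toReal (by norm_num) (by norm_num),
    eLpNorm_eq_lintegral_rpow_enorm_toReal (by norm_num) (by norm_num)] at e0
  have := congrArg (fun a : ℝ≥0∞ => a ^ (2:ℝ)) e0
  simpa only [← ENNReal.rpow_mul, ENNReal.toReal_ofNat, one_div,
    inv_mul_cancel₀ (two_ne_zero : (2:ℝ) ≠ 0), ENNReal.rpow_one] using this

lemma plancherel_inv {f : V → ℂ} (hf : Integrable f) (h2 : MemLp f 2) :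
    ∫⁻ x, ‖𝓕⁻ f x‖ₑ ^ (2:ℝ) = ∫⁻ x, ‖f x‖ₑ ^ (2:ℝ) := by
  rw [← plancherel hf h2]
  have : ∀ x, 𝓕⁻ f x = 𝓕 f (-x) := fun x => by
    rw [Real.fourierInv_eq_fourier_neg]
  simp only [this]
  exact lintegral_neg_eq_self (fun x => ‖𝓕 f x‖ₑ ^ (2:ℝ))
end plancherel

/-- `exp (2 π i s)` -/
def ee (s : ℝ) : ℂ := Complex.exp (((2 * Real.pi * s : ℝ) : ℂ) * Complex.I)

lemma ee_smul (s : ℝ) (z : ℂ) : Real.fourierChar s • z = ee s * z := by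
  rw [Circle.smul_def, smul_eq_mul, Real.fourierChar_apply]; rfl
lemma norm_ee (s : ℝ) : ‖ee s‖ = 1 := Complex.norm_exp_ofReal_mul_I _
lemma enorm_ee (s : ℝ) : ‖ee s‖ₑ = 1 := by rw [← ofReal_norm, norm_ee]; simp
lemma ee_add (s t : ℝ) : ee (s + t) = ee s * ee t := by
  unfold ee; rw [← Complex.exp_add]; congr 1; push_cast; ring
lemma ee_conj (s : ℝ) : (starRingEnd ℂ) (ee s) = ee (-s) := by
  unfold ee; rw [← Complex.exp_conj]; congr 1
  rw [map_mul, Complex.conj_ofReal, Complex.conj_I]; push_cast; ring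
lemma continuous_ee : Continuous ee := by unfold ee; fun_prop
lemma sigH_ee {d : ℕ} [NeZero d] (x : Euc d) :
    ∫ y, ee (inner ℝ x y) ∂(sphereMeasure d) = (sigH x : ℂ) := by
  rw [← sigH_eq]; congr 1

/-- Smooth radial bump: `1` on the unit ball, `0` when `‖x‖^2 ≥ 2`. -/
def bB {d : ℕ} (x : Euc d) : ℝ := Real.smoothTransition (2 - ‖x‖ ^ 2)

lemma bB_contDiff {d : ℕ} : ContDiff ℝ (⊤ : ℕ∞) (bB : Euc d → ℝ) :=
  Real.smoothTransition.contDiff.comp (contDiff_const.sub (contDiff_norm_sq ℝ))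

lemma bB_nonneg {d : ℕ} (x : Euc d) : 0 ≤ bB x := Real.smoothTransition.nonneg _
lemma bB_le_one {d : ℕ} (x : Euc d) : bB x ≤ 1 := Real.smoothTransition.le_one _
lemma bB_one {d : ℕ} {x : Euc d} (h : ‖x‖ ≤ 1) : bB x = 1 :=
  Real.smoothTransition.one_of_one_le (by nlinarith [norm_nonneg x])
lemma bB_zero {d : ℕ} {x : Euc d} (h : 2 ≤ ‖x‖ ^ 2) : bB x = 0 :=
  Real.smoothTransition.zero_of_nonpos (by linarith)
lemma bB_supp {d : ℕ} : HasCompactSupport (bB : Euc d → ℝ) := by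
  apply HasCompactSupport.of_support_subset_isCompact (isCompact_closedBall (0 : Euc d) 2)
  intro x hx
  by_contra h
  apply hx
  apply bB_zero
  simp only [mem_closedBall, dist_zero_right, not_le] at h
  nlinarith

/-- The bump as a Schwartz function. -/
def bBS (d : ℕ) : SchwartzMap (Euc d) ℂ :=
  HasCompactSupport.toSchwartzMap (f := fun x : Euc d => (bB x : ℂ))
    (bB_supp.comp_left (g := fun x : ℝ => (x : ℂ)) (by simp))
    (Complex.ofRealCLM.contDiff.comp bB_contDiff)

/-- The annular bump `B(x) - B(2 x)` as a Schwartz function. -/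
def bAS (d : ℕ) : SchwartzMap (Euc d) ℂ :=
  HasCompactSupport.toSchwartzMap (f := fun x : Euc d => ((bB x - bB ((2:ℝ) • x) : ℝ) : ℂ))
    (HasCompactSupport.comp_left (g := fun x : ℝ => (x : ℂ))
      (bB_supp.sub (bB_supp.comp_smul (by norm_num))) (by simp))
    (Complex.ofRealCLM.contDiff.comp
      (bB_contDiff.sub (bB_contDiff.comp (contDiff_const_smul (2:ℝ)))))

lemma bBS_apply {d : ℕ} (x : Euc d) : bBS d x = (bB x : ℂ) := rfl
lemma bAS_apply {d : ℕ} (x : Euc d) : bAS d x = ((bB x - bB ((2:ℝ) • x) : ℝ) : ℂ) := rfl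

lemma schwartz_bound {d : ℕ} (χ : SchwartzMap (Euc d) ℂ) (N : ℕ) :
    ∃ C : ℝ, 0 ≤ C ∧ ∀ u, ‖χ u‖ ≤ C * ((1 + ‖u‖) ^ N)⁻¹ := by
  have h := fun u => SchwartzMap.one_add_le_sup_seminorm_apply (𝕜 := ℝ) (m := (N, 0))
    (k := N) (n := 0) le_rfl le_rfl χ u
  simp only [norm_iteratedFDeriv_zero] at h
  generalize (2:ℝ) ^ N * ((Finset.Iic (N, 0)).sup fun m => SchwartzMap.seminorm ℝ m.1 m.2) χ = C
    at h
  refine ⟨C, le_trans (by positivity) (h 0), fun u => ?_⟩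
  rw [← div_eq_mul_inv, le_div_iff₀ (by positivity), mul_comm]
  exact h u

lemma lintegral_weight_lt_top (d : ℕ) :
    ∫⁻ u : Euc d, ENNReal.ofReal (((1 + ‖u‖) ^ (d+1))⁻¹) < ⊤ := by
  have := integrable_one_add_norm (E := Euc d) (μ := volume) (r := (d:ℝ)+1) (by simp)
  have h2 := this.lintegral_lt_top
  refine lt_of_eq_of_lt (lintegral_congr fun u => ?_) h2
  congr 1
  rw [Real.rpow_neg (by positivity)]
  norm_cast

/-- Scaled weight. -/
lemma lintegral_weight_scale (d : ℕ) (l : ℝ) (hl : 0 < l) (ξ : Euc d) :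
    ∫⁻ u : Euc d, ENNReal.ofReal (((1 + l * ‖ξ - u‖) ^ (d+1))⁻¹)
      = ENNReal.ofReal (l ^ d)⁻¹ * ∫⁻ u : Euc d, ENNReal.ofReal (((1 + ‖u‖) ^ (d+1))⁻¹) := by
  let w : Euc d → ℝ≥0∞ := fun u => ENNReal.ofReal (((1 + ‖u‖) ^ (d+1))⁻¹)
  have e1 : ∀ u : Euc d, ENNReal.ofReal (((1 + l * ‖ξ - u‖) ^ (d+1))⁻¹) = w (l • (ξ - u)) := by
    intro u; simp only [w]; rw [norm_smul, Real.norm_of_nonneg hl.le]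
  simp only [e1]
  rw [lintegral_sub_left_eq_self (fun u => w (l • u)) ξ]
  have h := Measure.map_addHaar_smul (volume : Measure (Euc d)) hl.ne'
  have hw : Measurable w := by fun_prop
  rw [← lintegral_map hw (measurable_const_smul l), h, lintegral_smul_measure]
  congr 1
  rw [abs_of_nonneg (by positivity)]; simp

lemma sphere_weight (d : ℕ) [NeZero d] : ∃ C : ℝ≥0∞, C ≠ ⊤ ∧ ∀ l : ℝ, 1 ≤ l → ∀ ξ : Euc d,
    ENNReal.ofReal (l ^ d) * ∫⁻ ω, ENNReal.ofReal (((1 + l * ‖ξ - ω‖) ^ (d+1))⁻¹) ∂(sphereMeasure d)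
      ≤ C * ENNReal.ofReal l := by
  set W := ∫⁻ u : Euc d, ENNReal.ofReal (((1 + ‖u‖) ^ (d+1))⁻¹)
  refine ⟨2 ^ (d+1) * ((cS d)⁻¹ * W), ?_, fun l hl ξ => ?_⟩
  · exact ENNReal.mul_ne_top (by simp) (ENNReal.mul_ne_top (by simp [cS_ne_zero])
      (lintegral_weight_lt_top d).ne)
  have hl0 : 0 < l := by linarith
  set S := ∫⁻ ω, ENNReal.ofReal (((1 + l * ‖ξ - ω‖) ^ (d+1))⁻¹) ∂(sphereMeasure d) with hS
  have key : ∀ s ∈ Icc 1 (1 + l⁻¹), S ≤ 2 ^ (d+1) * (ENNReal.ofReal (s ^ (d-1)) *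
      ∫⁻ ω, ENNReal.ofReal (((1 + l * ‖ξ - s • ω‖) ^ (d+1))⁻¹) ∂(sphereMeasure d)) := by
    intro s hs
    have h1 : (1:ℝ≥0∞) ≤ ENNReal.ofReal (s ^ (d-1)) := by
      rw [ENNReal.one_le_ofReal]; exact one_le_pow₀ hs.1
    calc S ≤ 2 ^ (d+1) * ∫⁻ ω, ENNReal.ofReal (((1 + l * ‖ξ - s • ω‖) ^ (d+1))⁻¹)
            ∂(sphereMeasure d) := by
          rw [← lintegral_const_mul' _ _ (by simp)]
          apply lintegral_mono_ae
          filter_upwards [sphere_ae_norm] with ω hω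
          have e2 : (2:ℝ≥0∞) ^ (d+1) = ENNReal.ofReal (2 ^ (d+1)) := by
            rw [ENNReal.ofReal_pow (by norm_num)]; simp
          rw [e2, ← ENNReal.ofReal_mul (by positivity)]
          apply ENNReal.ofReal_le_ofReal
          have hn : ‖ξ - s • ω‖ ≤ ‖ξ - ω‖ + l⁻¹ := by
            have : ξ - s • ω = (ξ - ω) - (s - 1) • ω := by module
            rw [this]
            refine (norm_sub_le _ _).trans ?_
            rw [norm_smul, hω, Real.norm_of_nonneg (by linarith [hs.1])]
            linarith [hs.2]
          have h3 : l * ‖ξ - s • ω‖ ≤ l * ‖ξ - ω‖ + 1 := by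
            have := mul_le_mul_of_nonneg_left hn hl0.le
            rwa [mul_add, mul_inv_cancel₀ hl0.ne'] at this
          rw [← div_eq_mul_inv, le_div_iff₀ (by positivity), inv_mul_le_iff₀ (by positivity),
            ← mul_pow]
          apply pow_le_pow_left₀ (by positivity)
          have : 0 ≤ l * ‖ξ - ω‖ := by positivity
          nlinarith
      _ ≤ _ := by gcongr; exact le_mul_of_one_le_left' h1
  have hm : Measurable (fun u : Euc d => ENNReal.ofReal (((1 + l * ‖ξ - u‖) ^ (d+1))⁻¹)) := by
    fun_prop
  have hpol := lintegral_polar hm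
  rw [lintegral_weight_scale d l hl0 ξ] at hpol
  have hI : ENNReal.ofReal l⁻¹ * S ≤ 2 ^ (d+1) * ((cS d)⁻¹ * (ENNReal.ofReal (l ^ d)⁻¹ * W)) := by
    calc ENNReal.ofReal l⁻¹ * S = ∫⁻ s in Icc 1 (1 + l⁻¹), S := by
          rw [setLIntegral_const, Real.volume_Icc, mul_comm]; congr 2; ring
      _ ≤ ∫⁻ s in Icc 1 (1 + l⁻¹), 2 ^ (d+1) * (ENNReal.ofReal (s ^ (d-1)) *
            ∫⁻ ω, ENNReal.ofReal (((1 + l * ‖ξ - s • ω‖) ^ (d+1))⁻¹) ∂(sphereMeasure d)) :=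
          setLIntegral_mono' measurableSet_Icc key
      _ ≤ ∫⁻ s in Ioi 0, 2 ^ (d+1) * (ENNReal.ofReal (s ^ (d-1)) *
            ∫⁻ ω, ENNReal.ofReal (((1 + l * ‖ξ - s • ω‖) ^ (d+1))⁻¹) ∂(sphereMeasure d)) :=
          lintegral_mono_set fun s hs => lt_of_lt_of_le one_pos hs.1
      _ = _ := by
          rw [lintegral_const_mul' _ _ (by simp), hpol, ← mul_assoc (cS d)⁻¹,
            ENNReal.inv_mul_cancel cS_ne_zero cS_ne_top, one_mul]
  have a1 : ENNReal.ofReal l * ENNReal.ofReal l⁻¹ = 1 := by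
    rw [← ENNReal.ofReal_mul hl0.le, mul_inv_cancel₀ hl0.ne', ENNReal.ofReal_one]
  have a2 : ENNReal.ofReal (l^d) * ENNReal.ofReal (l^d)⁻¹ = 1 := by
    rw [← ENNReal.ofReal_mul (by positivity), mul_inv_cancel₀ (by positivity), ENNReal.ofReal_one]
  calc ENNReal.ofReal (l^d) * S
      = ENNReal.ofReal (l^d) * ENNReal.ofReal l * (ENNReal.ofReal l⁻¹ * S) := by
        rw [show ENNReal.ofReal (l^d) * ENNReal.ofReal l * (ENNReal.ofReal l⁻¹ * S) =
          ENNReal.ofReal (l^d) * (ENNReal.ofReal l * ENNReal.ofReal l⁻¹) * S by ring, a1, mul_one]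
    _ ≤ ENNReal.ofReal (l^d) * ENNReal.ofReal l *
        (2 ^ (d+1) * ((cS d)⁻¹ * (ENNReal.ofReal (l ^ d)⁻¹ * W))) := by gcongr
    _ = ENNReal.ofReal (l^d) * ENNReal.ofReal (l ^ d)⁻¹ *
        (2 ^ (d+1) * ((cS d)⁻¹ * W) * ENNReal.ofReal l) := by ring
    _ = _ := by rw [a2, one_mul]

lemma fourier_scale {d : ℕ} (χ : Euc d → ℂ) (l : ℝ) (hl : 0 < l) (η : Euc d) :
    𝓕 (fun x => χ (l⁻¹ • x)) η = (l ^ d : ℝ) * 𝓕 χ (l • η) := by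
  rw [Real.fourier_eq, Real.fourier_eq]
  have := Measure.integral_comp_inv_smul (volume : Measure (Euc d))
    (fun v => Real.fourierChar (-(inner ℝ v (l • η))) • χ v) l
  rw [abs_of_nonneg (by positivity)] at this
  simp only [finrank_euclideanSpace, Fintype.card_fin] at this
  rw [Complex.real_smul] at this
  rw [← this]
  congr 1; ext v
  rw [inner_smul_left, inner_smul_right]
  simp only [conj_trivial]
  rw [inv_mul_cancel_left₀ hl.ne']

lemma fourier_kernel_bound {d : ℕ} [NeZero d] (χ : SchwartzMap (Euc d) ℂ) :
    ∃ C : ℝ, 0 ≤ C ∧ ∀ l : ℝ, 1 ≤ l → ∀ ξ : Euc d,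
      ‖𝓕 (fun x : Euc d => (sigH x : ℂ) * χ (l⁻¹ • x)) ξ‖ ≤ C * l := by
  obtain ⟨C1, hC1, h1⟩ := schwartz_bound (𝓕 χ) (d+1)
  obtain ⟨C2, hC2, h2⟩ := sphere_weight d
  refine ⟨C1 * C2.toReal, by positivity, fun l hl ξ => ?_⟩
  have hl0 : 0 < l := by linarith
  have hχi : Integrable (fun x => χ (l⁻¹ • x)) :=
    (χ.integrable (μ := volume)).comp_smul (inv_ne_zero hl0.ne')
  have e1 : 𝓕 (fun x : Euc d => (sigH x : ℂ) * χ (l⁻¹ • x)) ξ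
      = ∫ ω, 𝓕 (fun x => χ (l⁻¹ • x)) (ξ - ω) ∂(sphereMeasure d) := by
    rw [Real.fourier_eq]
    simp only [Real.fourier_eq]
    rw [integral_integral_swap]
    · congr 1; ext x
      simp only [ee_smul]
      rw [← sigH_ee]
      rw [← integral_mul_const, ← integral_const_mul]
      congr 1; ext ω
      rw [inner_sub_right, neg_sub, sub_eq_neg_add, ee_add]
      ring
    · have hc : Continuous (fun q : Euc d × Euc d =>
          ee (-(inner ℝ q.2 (ξ - q.1)))) :=
        continuous_ee.comp (by fun_prop)
      have hh := (integrable_const (1:ℂ) (μ := sphereMeasure d)).mul_prod hχi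
      refine (hh.bdd_mul (c := 1) hc.aestronglyMeasurable ?_).congr ?_
      · exact Filter.Eventually.of_forall fun q => by rw [norm_ee]
      · exact Filter.Eventually.of_forall fun q => by
          simp [Function.uncurry, ee_smul]
  rw [e1]
  have key : ‖∫ ω, 𝓕 (fun x => χ (l⁻¹ • x)) (ξ - ω) ∂(sphereMeasure d)‖ₑ
      ≤ ENNReal.ofReal (C1 * C2.toReal * l) := by
    calc _ ≤ ∫⁻ ω, ‖𝓕 (fun x => χ (l⁻¹ • x)) (ξ - ω)‖ₑ ∂(sphereMeasure d) :=
          enorm_integral_le_lintegral_enorm _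
      _ ≤ ∫⁻ ω, ENNReal.ofReal C1 * (ENNReal.ofReal (l^d) *
            ENNReal.ofReal (((1 + l * ‖ξ - ω‖) ^ (d+1))⁻¹)) ∂(sphereMeasure d) := by
          apply lintegral_mono; intro ω
          simp only
          rw [fourier_scale _ _ hl0, ← ENNReal.ofReal_mul (by positivity),
            ← ENNReal.ofReal_mul (by positivity), ← ofReal_norm]
          apply ENNReal.ofReal_le_ofReal
          rw [norm_mul, Complex.norm_real, Real.norm_of_nonneg (by positivity)]
          have h3 := h1 (l • (ξ - ω))
          rw [SchwartzMap.fourier_coe, norm_smul, Real.norm_of_nonneg hl0.le] at h3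
          calc _ ≤ l^d * (C1 * ((1 + l * ‖ξ - ω‖) ^ (d + 1))⁻¹) := by gcongr
            _ = _ := by ring
      _ ≤ ENNReal.ofReal C1 * (C2 * ENNReal.ofReal l) := by
          rw [lintegral_const_mul' _ _ (by simp), lintegral_const_mul' _ _ (by simp)]
          exact mul_le_mul_right (h2 l hl ξ) _
      _ = _ := by
          rw [ENNReal.ofReal_mul (by positivity), ENNReal.ofReal_mul (by positivity),
            ENNReal.ofReal_toReal hC2, mul_assoc]
  rw [← ofReal_norm] at key
  exact (ENNReal.ofReal_le_ofReal_iff (by positivity)).1 key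

lemma memLp2_of_bdd {X : Type*} [MeasurableSpace X] {μ : Measure X} {g : X → ℂ}
    (hg : Integrable g μ) (M : ℝ) (hM : ∀ x, ‖g x‖ ≤ M) : MemLp g 2 μ := by
  rw [memLp_two_iff_integrable_sq_norm hg.aestronglyMeasurable]
  refine (hg.norm.const_mul M).mono' (hg.aestronglyMeasurable.norm.pow 2) ?_
  filter_upwards with x
  rw [Real.norm_of_nonneg (by positivity), sq]
  exact mul_le_mul_of_nonneg_right (hM x) (norm_nonneg _)

lemma conv_L2 {d : ℕ} {k f : Euc d → ℂ} (hk : Integrable k) (a : ℝ) (ha : ∀ x, ‖k x‖ ≤ a)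
    (hf : Integrable f) (hf2 : MemLp f 2) (b : ℝ≥0) (hb : ∀ ξ, ‖𝓕 k ξ‖ ≤ b) :
    ∫⁻ x, ‖∫ y, k (x - y) * f y‖ₑ ^ (2:ℝ) ≤ (b:ℝ≥0∞) ^ (2:ℝ) * ∫⁻ x, ‖f x‖ₑ ^ (2:ℝ) := by
  set g : Euc d → ℂ := convolution k f (ContinuousLinearMap.mul ℂ ℂ) volume with hg
  have e1 : ∀ x, ∫ y, k (x - y) * f y = g x := by
    intro x; rw [hg, convolution_eq_swap]; rfl
  have hgi : Integrable g := hk.integrable_convolution _ hf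
  have hgb : ∀ x, ‖g x‖ ≤ ∫ y, a * ‖f y‖ := by
    intro x; rw [← e1]
    refine norm_integral_le_of_norm_le (hf.norm.const_mul a) ?_
    filter_upwards with y
    rw [norm_mul]; exact mul_le_mul_of_nonneg_right (ha _) (norm_nonneg _)
  have hg2 := memLp2_of_bdd hgi _ hgb
  simp only [e1]
  rw [← plancherel hgi hg2, ← plancherel hf hf2, ← lintegral_const_mul' _ _ (by simp)]
  apply lintegral_mono; intro ξ
  simp only
  rw [hg, Real.fourier_mul_convolution_eq hk hf, enorm_mul, ENNReal.mul_rpow_of_nonneg _ _ (by norm_num)]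
  gcongr
  rw [← ofReal_norm, ← ENNReal.ofReal_coe_nnreal]
  exact ENNReal.ofReal_le_ofReal (hb ξ)

lemma kernel_rt {d : ℕ} (k : Euc d → ℂ) (hk : Continuous k) (hks : HasCompactSupport k)
    (a b : ℝ≥0) (ha : ∀ x, ‖k x‖ ≤ a) (hb : ∀ ξ, ‖𝓕 k ξ‖ ≤ b) (p q : ℝ) (hq : 2 < q)
    (hp0 : 0 < p) (hpq : 1 / p = 1 - 1 / q) (R : ℝ) (f : Euc d → ℂ) (hf : BdM f) :
    ∫⁻ x in ball 0 R, ‖∫ y in ball 0 R, k (x - y) * f y‖ₑ ^ q ≤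
      ((a:ℝ≥0∞) ^ (1 - 2 / q) * (b:ℝ≥0∞) ^ (2 / q) *
        (∫⁻ y in ball 0 R, ‖f y‖ₑ ^ p) ^ (1 / p)) ^ q := by
  let l : Measure (Euc d) := volume.restrict (ball 0 R)
  haveI : IsFiniteMeasure l := ⟨by simp [l]; exact measure_ball_lt_top⟩
  let K : Euc d × Unit → Euc d → ℂ := fun w y => k (w.1 - y)
  have hKm : Measurable (Function.uncurry K) := hk.measurable.comp (by fun_prop)
  have h := rt_main l (Measure.dirac ()) l K hKm a a.2 (fun w y => ha _) 1 (2/q) p q 2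
    (by norm_num) le_rfl (by positivity) (by rw [div_le_one (by linarith)]; linarith) hp0 (by linarith)
    (by norm_num) (by rw [hpq]; field_simp; ring) (by field_simp) a b ?_ ?_ f hf
  · have e : ∀ x : Euc d, (∫⁻ z, ‖opT K l f (x, z)‖ₑ ^ p ∂(Measure.dirac ())) ^ (q/p)
        = ‖∫ y in ball 0 R, k (x - y) * f y‖ₑ ^ q := by
      intro x
      rw [lintegral_dirac, ← ENNReal.rpow_mul, mul_div_cancel₀ _ hp0.ne']
      rfl
    simpa only [e] using h
  · intro x f hf A V hA hV hfA
    simp only [sub_self, ENNReal.rpow_zero, one_mul, mul_one, ENNReal.rpow_one] at hfA ⊢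
    rw [lintegral_dirac]
    calc _ ≤ ∫⁻ y, ‖K (x, ()) y * f y‖ₑ ∂l := enorm_integral_le_lintegral_enorm _
      _ ≤ ∫⁻ y, a * A y ∂l := by
          apply lintegral_mono; intro y
          simp only [enorm_mul]
          gcongr
          · rw [← ofReal_norm, ← ENNReal.ofReal_coe_nnreal]
            exact ENNReal.ofReal_le_ofReal (ha _)
          · exact hfA y
      _ = _ := lintegral_const_mul' _ _ (by simp)
  · intro f hf
    obtain ⟨hfm, M, hM⟩ := hf
    simp only [lintegral_dirac]
    simp only [div_self (two_ne_zero' ℝ), ENNReal.rpow_one]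
    have hi : Integrable ((ball 0 R).indicator f) := by
      rw [integrable_indicator_iff measurableSet_ball]
      exact Integrable.of_bound hfm.aestronglyMeasurable M (Filter.Eventually.of_forall hM)
    have hib : ∀ x, ‖(ball (0 : Euc d) R).indicator f x‖ ≤ M := fun x =>
      (norm_indicator_le_norm_self _ _).trans (hM x)
    have h2 := conv_L2 (hk.integrable_of_hasCompactSupport hks) a ha hi (memLp2_of_bdd hi M hib) b hb
    have e1 : ∀ x, ∫ y, k (x - y) * (ball 0 R).indicator f y = opT K l f (x, ()) := by
      intro x
      simp only [opT, l, K]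
      rw [← integral_indicator measurableSet_ball]
      congr 1; ext y
      by_cases hy : y ∈ ball (0 : Euc d) R <;> simp [hy]
    have e2 : ∫⁻ x, ‖(ball (0 : Euc d) R).indicator f x‖ₑ ^ (2:ℝ) = ∫⁻ y, ‖f y‖ₑ ^ (2:ℝ) ∂l := by
      rw [← lintegral_indicator measurableSet_ball]
      congr 1; ext y
      by_cases hy : y ∈ ball (0 : Euc d) R <;> simp [hy]
    simp only [e1, e2] at h2
    rw [ENNReal.mul_rpow_of_nonneg _ _ (by norm_num), ← ENNReal.rpow_mul]
    norm_num
    refine (lintegral_mono' Measure.restrict_le_self le_rfl).trans ?_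
    simpa using h2

/-- extension operator -/
def extE {d : ℕ} (h : Euc d → ℂ) (x : Euc d) : ℂ :=
  ∫ ω, ee (inner ℝ x ω) * h ω ∂(sphereMeasure d)

/-- dyadic pieces of the kernel -/
def kL (d : ℕ) [NeZero d] (n : ℕ) (x : Euc d) : ℂ :=
  (sigH x : ℂ) * (if n = 0 then bBS d x else bAS d (((2:ℝ)^n)⁻¹ • x))

lemma kL_sum {d : ℕ} [NeZero d] (L : ℕ) (x : Euc d) :
    ∑ n ∈ Finset.range (L+1), kL d n x = (sigH x : ℂ) * bB ((((2:ℝ)^L)⁻¹) • x) := by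
  induction L with
  | zero => simp [kL, bBS_apply]
  | succ L ih =>
    rw [Finset.sum_range_succ, ih]
    simp only [kL, bAS_apply]
    have : (2:ℝ) • ((2:ℝ)^(L+1))⁻¹ • x = ((2:ℝ)^L)⁻¹ • x := by
      rw [smul_smul]; congr 1; rw [pow_succ]; field_simp
    rw [this]
    simp
    ring

lemma kL_sum_eq {d : ℕ} [NeZero d] {L : ℕ} {x : Euc d} (hx : ‖x‖ ≤ 2^L) :
    ∑ n ∈ Finset.range (L+1), kL d n x = (sigH x : ℂ) := by
  rw [kL_sum, bB_one]
  · simp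
  · rw [norm_smul, norm_inv, norm_pow, Real.norm_ofNat, inv_mul_le_iff₀ (by positivity)]
    simpa using hx

lemma kL_cont {d : ℕ} [NeZero d] (n : ℕ) : Continuous (kL d n) := by
  unfold kL
  have := continuous_sigH (d := d)
  split_ifs
  · exact (Complex.continuous_ofReal.comp this).mul (bBS d).continuous
  · exact (Complex.continuous_ofReal.comp this).mul ((bAS d).continuous.comp (continuous_const_smul _))

lemma kL_supp {d : ℕ} [NeZero d] (n : ℕ) : HasCompactSupport (kL d n) := by
  apply HasCompactSupport.of_support_subset_isCompact (isCompact_closedBall (0 : Euc d) (2^(n+1)))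
  intro x hx
  by_contra h
  apply hx
  simp only [mem_closedBall, dist_zero_right, not_le] at h
  unfold kL
  split_ifs with hn
  · subst hn
    rw [bBS_apply, bB_zero]; simp
    norm_num at h; nlinarith
  · rw [bAS_apply]
    have h2 : 2 ≤ ‖((2:ℝ)^n)⁻¹ • x‖ := by
      rw [norm_smul, norm_inv, norm_pow, Real.norm_ofNat, ← div_eq_inv_mul,
        le_div_iff₀ (by positivity)]
      rw [pow_succ] at h; linarith
    have h3 : ‖(2:ℝ) • ((2:ℝ)^n)⁻¹ • x‖ = 2 * ‖((2:ℝ)^n)⁻¹ • x‖ := by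
      rw [norm_smul]; simp
    rw [bB_zero (by nlinarith), bB_zero (by rw [h3]; nlinarith)]; simp

lemma kL_bound (d : ℕ) [NeZero d] : ∃ C : ℝ≥0, ∀ n x,
    ‖kL d n x‖ ≤ C * ((2:ℝ) ^ (-(((d:ℝ)-1)/2))) ^ n := by
  obtain ⟨C, hC, hdec⟩ := sigH_decay (d := d)
  set e := ((d:ℝ)-1)/2 with he
  have he0 : 0 ≤ e := by
    have : (1:ℝ) ≤ d := by exact_mod_cast Nat.one_le_iff_ne_zero.2 (NeZero.ne d)
    rw [he]; linarith
  refine ⟨Real.toNNReal (1 + C * 2 ^ e), fun n x => ?_⟩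
  rw [Real.coe_toNNReal _ (by positivity)]
  unfold kL
  split_ifs with hn
  · subst hn
    rw [bBS_apply, norm_mul, Complex.norm_real, Complex.norm_real, Real.norm_eq_abs,
      Real.norm_of_nonneg (bB_nonneg _), pow_zero, mul_one]
    have := abs_sigH_le_one x
    have h2 := bB_le_one x
    have : 0 ≤ C * (2:ℝ)^e := by positivity
    nlinarith [bB_nonneg x, abs_nonneg (sigH x)]
  · rw [bAS_apply, norm_mul, Complex.norm_real, Complex.norm_real, Real.norm_eq_abs]
    by_cases hx : ‖x‖ ≤ 2^(n-1)
    · have h1 : ‖((2:ℝ)^n)⁻¹ • x‖ ≤ 1/2 := by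
        rw [norm_smul, norm_inv, norm_pow, Real.norm_ofNat, inv_mul_le_iff₀ (by positivity)]
        have : (2:ℝ)^n = 2 * 2^(n-1) := by rw [← pow_succ']; congr 1; omega
        rw [this]; linarith
      have h3 : ‖(2:ℝ) • ((2:ℝ)^n)⁻¹ • x‖ = 2 * ‖((2:ℝ)^n)⁻¹ • x‖ := by
        rw [norm_smul]; simp
      rw [bB_one (by linarith), bB_one (by rw [h3]; linarith)]
      simp; positivity
    · have h4 := hdec x (2^(n-1)) (one_le_pow₀ (by norm_num)) (by linarith)
      have h5 : ‖bB (((2:ℝ)^n)⁻¹ • x) - bB ((2:ℝ) • ((2:ℝ)^n)⁻¹ • x)‖ ≤ 1 := by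
        rw [Real.norm_eq_abs, abs_le]
        constructor <;> linarith [bB_nonneg (((2:ℝ)^n)⁻¹ • x), bB_le_one (((2:ℝ)^n)⁻¹ • x),
          bB_nonneg ((2:ℝ) • ((2:ℝ)^n)⁻¹ • x), bB_le_one ((2:ℝ) • ((2:ℝ)^n)⁻¹ • x)]
      have h6 : ((2:ℝ)^(n-1)) ^ (-e) = 2^e * ((2:ℝ)^(-e))^n := by
        rw [← Real.rpow_natCast, ← Real.rpow_natCast, ← Real.rpow_mul (by norm_num),
          ← Real.rpow_mul (by norm_num), ← Real.rpow_add (by norm_num)]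
        congr 1
        rw [Nat.cast_sub (by omega)]; push_cast; ring
      calc _ ≤ C * ((2:ℝ)^(n-1)) ^ (-e) * 1 :=
            mul_le_mul h4 h5 (norm_nonneg _) (by positivity)
        _ = C * 2^e * ((2:ℝ)^(-e))^n := by rw [h6]; ring
        _ ≤ _ := by gcongr; linarith

lemma kL_fourier (d : ℕ) [NeZero d] : ∃ C : ℝ≥0, ∀ n ξ, ‖𝓕 (kL d n) ξ‖ ≤ C * (2:ℝ) ^ n := by
  obtain ⟨C1, hC1, h1⟩ := fourier_kernel_bound (bBS d)
  obtain ⟨C2, hC2, h2⟩ := fourier_kernel_bound (bAS d)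
  refine ⟨Real.toNNReal (C1 + C2), fun n ξ => ?_⟩
  rw [Real.coe_toNNReal _ (by positivity)]
  by_cases hn : n = 0
  · subst hn
    have := h1 1 le_rfl ξ
    simp only [inv_one, one_smul] at this
    have e : kL d 0 = fun x => (sigH x : ℂ) * bBS d x := by ext x; simp [kL]
    rw [e]; simp; linarith
  · have := h2 (2^n) (one_le_pow₀ (by norm_num)) ξ
    have e : kL d n = fun x => (sigH x : ℂ) * bAS d (((2:ℝ)^n)⁻¹ • x) := by ext x; simp [kL, hn]
    rw [e]; refine this.trans ?_
    gcongr; linarith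

lemma swap_bdd {X Y : Type*} [MeasurableSpace X] [MeasurableSpace Y] {μ : Measure X} {ν : Measure Y}
    [IsFiniteMeasure μ] [IsFiniteMeasure ν] (F : X → Y → ℂ) (hF : Measurable (Function.uncurry F))
    (M : ℝ) (hM : ∀ x y, ‖F x y‖ ≤ M) :
    ∫ x, ∫ y, F x y ∂ν ∂μ = ∫ y, ∫ x, F x y ∂μ ∂ν :=
  integral_integral_swap (Integrable.of_bound hF.aestronglyMeasurable M
    (Filter.Eventually.of_forall fun q => hM q.1 q.2))

lemma rpow_cancel {I A : ℝ≥0∞} {p q : ℝ} (hI : I ≠ ⊤) (hq : 0 < q) (hpq : 1 / p = 1 - 1 / q)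
    (h : I ≤ A * I ^ (1 / p)) : I ≤ A ^ q := by
  by_cases h0 : I = 0
  · simp [h0]
  have h1 : I ^ (1 / q) ≤ A := by
    have e : I = I ^ (1/q) * I ^ (1/p) := by
      rw [← ENNReal.rpow_add _ _ h0 hI, hpq]; simp
    rw [e] at h
    have h2 : I ^ (1/p) ≠ 0 := by
      rw [Ne, ENNReal.rpow_eq_zero_iff]; push Not; exact ⟨fun a => absurd a h0, fun a => absurd a hI⟩
    have h3 : I ^ (1/p) ≠ ⊤ := by
      rw [Ne, ENNReal.rpow_eq_top_iff]; push Not; exact ⟨fun a => absurd a h0, fun a => absurd a hI⟩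
    have h4 : I ^ (1/q) * I ^ (1/p) ≤ A * I ^ (1/p) := by
      refine h.trans (le_of_eq ?_); rw [← e]
    exact (ENNReal.mul_le_mul_iff_left h2 h3).1 h4
  calc I = (I ^ (1/q)) ^ q := by rw [← ENNReal.rpow_mul]; field_simp; simp
    _ ≤ A ^ q := by gcongr

lemma measurable_ee_inner {d : ℕ} : Measurable (fun q : Euc d × Euc d => ee (inner ℝ q.1 q.2)) :=
  (continuous_ee.comp (by fun_prop)).measurable

lemma ST_dual (d : ℕ) (hd : 2 ≤ d) [NeZero d] (p q : ℝ) (hq : 2 * ((d:ℝ)+1) / ((d:ℝ)-1) < q)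
    (hpq : 1 / p = 1 - 1 / q) :
    ∃ C : ℝ≥0, ∀ R : ℝ, ∀ g : Euc d → ℂ, BdM g →
      ∫⁻ ω, ‖∫ x in ball 0 R, ee (inner ℝ ω x) * g x‖ₑ ^ (2:ℝ) ∂(sphereMeasure d) ≤
        (C * (∫⁻ x in ball 0 R, ‖g x‖ₑ ^ p) ^ (1 / p)) ^ (2:ℝ) := by
  have hd1 : (0:ℝ) < (d:ℝ) - 1 := by
    have : (2:ℝ) ≤ d := by exact_mod_cast hd
    linarith
  have hq2 : 2 < q := by
    refine lt_trans ?_ hq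
    rw [lt_div_iff₀ hd1]; linarith
  have hp0 : 0 < p := by
    have : 0 < 1 / p := by
      rw [hpq, sub_pos, div_lt_one (by linarith)]; linarith
    exact one_div_pos.1 this
  obtain ⟨C1, h1⟩ := kL_bound d
  obtain ⟨C2, h2⟩ := kL_fourier d
  set e := ((d:ℝ)-1)/2 with he
  let ρ : ℝ≥0 := (2:ℝ≥0) ^ (-e * (1 - 2/q) + 2/q)
  have hρ : ρ < 1 := by
    apply NNReal.rpow_lt_one_of_one_lt_of_neg (by norm_num)
    rw [div_lt_iff₀ hd1] at hq
    have : -e * (1 - 2/q) + 2/q = ((d + 1) - q * e) / q := by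
      rw [he]; field_simp; ring
    rw [this]
    apply div_neg_of_neg_of_pos _ (by linarith)
    rw [he]; linarith
  let C3 : ℝ≥0 := C1 ^ (1 - 2/q) * C2 ^ (2/q)
  have hs : Summable (fun n : ℕ => C3 * ρ ^ n) :=
    (NNReal.summable_geometric hρ).mul_left C3
  let C4 : ℝ≥0 := ∑' n, C3 * ρ ^ n
  refine ⟨NNReal.sqrt C4, fun R g hg => ?_⟩
  obtain ⟨hgm, M, hM⟩ := id hg
  let l : Measure (Euc d) := volume.restrict (ball 0 R)
  haveI : IsFiniteMeasure l := ⟨by simp [l]; exact measure_ball_lt_top⟩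
  let G : Euc d → ℂ := opT (fun ω x => ee (inner ℝ ω x)) l g
  have hGm : Measurable G := measurable_opT measurable_ee_inner hgm
  have hGb : ∀ ω, ‖G ω‖ ≤ 1 * M * l.real univ :=
    norm_opT_le (fun w y => (norm_ee _).le) (by norm_num) hM
  set N := (∫⁻ x in ball 0 R, ‖g x‖ₑ ^ p) ^ (1 / p) with hN
  have e0 : (starRingEnd ℂ) ∘ G = fun ω => ∫ y, ee (-(inner ℝ ω y)) * (starRingEnd ℂ) (g y) ∂l := by
    ext ω; simp only [Function.comp, G, opT]
    rw [← integral_conj]; simp only [map_mul, ee_conj]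
  have hcg : Measurable fun y => (starRingEnd ℂ) (g y) := Complex.continuous_conj.measurable.comp hgm
  have hcG : Measurable fun y => (starRingEnd ℂ) (G y) := Complex.continuous_conj.measurable.comp hGm
  have hid : ∫ ω, G ω * (starRingEnd ℂ) (G ω) ∂(sphereMeasure d) =
      ∫ x, g x * (∫ y, (sigH (x - y) : ℂ) * (starRingEnd ℂ) (g y) ∂l) ∂l := by
    calc _ = ∫ ω, ∫ x, ee (inner ℝ ω x) * g x * (starRingEnd ℂ) (G ω) ∂l ∂(sphereMeasure d) := by
          congr 1; ext ω; rw [integral_mul_const]; rfl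
      _ = ∫ x, ∫ ω, ee (inner ℝ ω x) * g x * (starRingEnd ℂ) (G ω) ∂(sphereMeasure d) ∂l := by
          apply swap_bdd _ _ (1 * M * (1 * M * l.real univ))
          · intro ω x
            rw [norm_mul, norm_mul, norm_ee, RCLike.norm_conj]
            have := (norm_nonneg _).trans (hM x)
            exact mul_le_mul (by gcongr; exact hM x) (hGb ω) (norm_nonneg _) (by positivity)
          · exact (measurable_ee_inner.mul (hgm.comp measurable_snd)).mul (hcG.comp measurable_fst)
      _ = _ := by
          congr 1; ext x
          calc _ = ∫ ω, ∫ y, g x * (ee (inner ℝ (x - y) ω) * (starRingEnd ℂ) (g y)) ∂l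
                  ∂(sphereMeasure d) := by
                congr 1; ext ω
                have := congrFun e0 ω
                simp only [Function.comp] at this
                rw [this, ← integral_const_mul]
                congr 1; ext y
                rw [inner_sub_left, sub_eq_add_neg, ee_add, real_inner_comm ω x, real_inner_comm ω y]
                ring
            _ = ∫ y, ∫ ω, g x * (ee (inner ℝ (x - y) ω) * (starRingEnd ℂ) (g y))
                  ∂(sphereMeasure d) ∂l := by
                apply swap_bdd _ _ (M * (1 * M))
                · intro ω y
                  rw [norm_mul, norm_mul, norm_ee, RCLike.norm_conj]
                  have := (norm_nonneg _).trans (hM x)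
                  gcongr
                  exacts [hM x, hM y]
                · refine measurable_const.mul (Measurable.mul ?_ (hcg.comp measurable_snd))
                  exact (continuous_ee.comp (by fun_prop)).measurable
            _ = _ := by
                rw [← integral_const_mul]
                congr 1; ext y
                rw [integral_const_mul, integral_mul_const, sigH_ee]
  have hL : ∃ L : ℕ, 2 * R ≤ 2 ^ L := by
    obtain ⟨L, hL⟩ := pow_unbounded_of_one_lt (2 * R) (by norm_num : (1:ℝ) < 2)
    exact ⟨L, hL.le⟩
  obtain ⟨L, hL⟩ := hL
  have hconj : BdM fun y => (starRingEnd ℂ) (g y) :=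
    ⟨hcg, M, fun y => by rw [RCLike.norm_conj]; exact hM y⟩
  have e3 : ∀ y, ‖(starRingEnd ℂ) (g y)‖ₑ = ‖g y‖ₑ := fun y => by
    rw [← ofReal_norm, ← ofReal_norm, RCLike.norm_conj]
  have hpq' : p.HolderConjugate q := by
    rw [Real.holderConjugate_iff]
    constructor
    · have h5 : 1 / p < 1 := by rw [hpq]; have : 0 < 1/q := by positivity
                                linarith
      rw [div_lt_one hp0] at h5; exact h5
    · rw [← one_div, hpq]; field_simp; ring
  have hterm : ∀ n, ∫⁻ x, ‖g x‖ₑ * ‖∫ y, kL d n (x - y) * (starRingEnd ℂ) (g y) ∂l‖ₑ ∂l ≤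
      (C3 * ρ ^ n : ℝ≥0) * (N * N) := by
    intro n
    have hkm : Measurable fun x => ∫ y, kL d n (x - y) * (starRingEnd ℂ) (g y) ∂l :=
      measurable_opT (K := fun x y => kL d n (x - y)) ((kL_cont n).measurable.comp (by fun_prop)) hcg
    refine (ENNReal.lintegral_mul_le_Lp_mul_Lq l hpq' hgm.enorm.aemeasurable
      hkm.enorm.aemeasurable).trans ?_
    have h6 := kernel_rt (kL d n) (kL_cont n) (kL_supp n) (C1 * (2 ^ (-e)) ^ n) (C2 * 2 ^ n)
      (fun x => by simpa using h1 n x) (fun x => by simpa using h2 n x) p q hq2 hp0 hpq R _ hconj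
    simp only [e3] at h6
    have h7 : (∫⁻ x, ‖∫ y, kL d n (x - y) * (starRingEnd ℂ) (g y) ∂l‖ₑ ^ q ∂l) ^ (1/q) ≤
        (C3 * ρ ^ n : ℝ≥0) * N := by
      rw [one_div, ENNReal.rpow_inv_le_iff (by linarith)]
      refine h6.trans (le_of_eq ?_)
      congr 2
      rw [← ENNReal.coe_rpow_of_nonneg _ (by rw [sub_nonneg, div_le_one] <;> linarith),
        ← ENNReal.coe_rpow_of_nonneg _ (by positivity), ← ENNReal.coe_mul]
      congr 1
      simp only [C3, ρ]
      rw [NNReal.mul_rpow, NNReal.mul_rpow]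
      simp only [← NNReal.rpow_natCast, ← NNReal.rpow_mul]
      have e7 : (2:ℝ≥0) ^ ((-e * (1 - 2/q) + 2/q) * n) = 2 ^ (-e * n * (1 - 2/q)) * 2 ^ (n * (2/q)) := by
        rw [← NNReal.rpow_add (by norm_num)]; congr 1; ring
      rw [e7]; ring
    calc _ ≤ N * ((C3 * ρ ^ n : ℝ≥0) * N) := by gcongr
      _ = _ := by ring
  calc ∫⁻ ω, ‖G ω‖ₑ ^ (2:ℝ) ∂(sphereMeasure d)
      = ‖∫ ω, G ω * (starRingEnd ℂ) (G ω) ∂(sphereMeasure d)‖ₑ := by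
        have e5 : ∀ ω, G ω * (starRingEnd ℂ) (G ω) = ((‖G ω‖ ^ 2 : ℝ) : ℂ) := fun ω => by
          rw [Complex.mul_conj']; push_cast; rfl
        simp only [e5]
        rw [integral_complex_ofReal, ← ofReal_norm, Complex.norm_real,
          Real.norm_of_nonneg (integral_nonneg fun _ => by positivity),
          ofReal_integral_eq_lintegral_ofReal]
        · congr 1; ext ω
          rw [ENNReal.ofReal_pow (norm_nonneg _), ofReal_norm]; norm_cast
        · refine Integrable.of_bound (by fun_prop) ((1 * M * l.real univ)^2)
            (Filter.Eventually.of_forall fun ω => ?_)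
          rw [Real.norm_of_nonneg (by positivity)]
          exact pow_le_pow_left₀ (norm_nonneg _) (hGb ω) 2
        · exact Filter.Eventually.of_forall fun ω => by positivity
    _ ≤ ∫⁻ x, ‖g x‖ₑ * ‖∫ y, (sigH (x - y) : ℂ) * (starRingEnd ℂ) (g y) ∂l‖ₑ ∂l := by
        rw [hid]
        refine (enorm_integral_le_lintegral_enorm _).trans (le_of_eq ?_)
        simp only [enorm_mul]
    _ ≤ ∫⁻ x, ∑ n ∈ Finset.range (L+1),
          ‖g x‖ₑ * ‖∫ y, kL d n (x - y) * (starRingEnd ℂ) (g y) ∂l‖ₑ ∂l := by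
        apply setLIntegral_mono_ae
        · refine Measurable.aemeasurable ?_
          refine Finset.measurable_sum _ fun n _ => hgm.enorm.mul (Measurable.enorm ?_)
          exact measurable_opT (K := fun x y => kL d n (x - y))
            ((kL_cont n).measurable.comp (by fun_prop)) hcg
        · filter_upwards with x hx
          rw [← Finset.mul_sum]
          gcongr
          have e6 : ∫ y, (sigH (x - y) : ℂ) * (starRingEnd ℂ) (g y) ∂l =
              ∑ n ∈ Finset.range (L+1), ∫ y, kL d n (x - y) * (starRingEnd ℂ) (g y) ∂l := by
            rw [← integral_finsetSum]
            · apply setIntegral_congr_fun measurableSet_ball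
              intro y hy
              simp only
              rw [← Finset.sum_mul, kL_sum_eq]
              rw [mem_ball_zero_iff] at hx hy
              exact (norm_sub_le _ _).trans (by linarith)
            · intro n _
              refine Integrable.of_bound (Measurable.aestronglyMeasurable ?_)
                (C1 * ((2:ℝ) ^ (-e)) ^ n * M) (Filter.Eventually.of_forall fun y => ?_)
              · exact ((kL_cont n).measurable.comp (by fun_prop)).mul hcg
              · rw [norm_mul, RCLike.norm_conj]
                exact mul_le_mul (h1 n _) (hM y) (norm_nonneg _) (by positivity)
          rw [e6]
          exact enorm_sum_le _ _
    _ = ∑ n ∈ Finset.range (L+1),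
          ∫⁻ x, ‖g x‖ₑ * ‖∫ y, kL d n (x - y) * (starRingEnd ℂ) (g y) ∂l‖ₑ ∂l := by
        refine lintegral_finsetSum _ fun n _ => hgm.enorm.mul (Measurable.enorm ?_)
        exact measurable_opT (K := fun x y => kL d n (x - y))
            ((kL_cont n).measurable.comp (by fun_prop)) hcg
    _ ≤ ∑ n ∈ Finset.range (L+1), (C3 * ρ ^ n : ℝ≥0) * (N * N) := Finset.sum_le_sum fun n _ => hterm n
    _ = (∑ n ∈ Finset.range (L+1), C3 * ρ ^ n : ℝ≥0) * (N * N) := by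
        rw [← Finset.sum_mul]; push_cast; rfl
    _ ≤ C4 * (N * N) := by
        gcongr
        exact hs.sum_le_tsum _ (fun _ _ => zero_le)
    _ = _ := by
        rw [show (2:ℝ) = ((2:ℕ):ℝ) by norm_num, ENNReal.rpow_natCast, mul_pow, sq N,
          ← ENNReal.coe_pow, NNReal.sq_sqrt]

lemma lintegral_of_balls {d : ℕ} {F : Euc d → ℝ≥0∞} {B : ℝ≥0∞}
    (h : ∀ R : ℝ, ∫⁻ x in ball 0 R, F x ≤ B) : ∫⁻ x, F x ≤ B := by
  have h1 : ∫⁻ x in ⋃ n : ℕ, ball (0 : Euc d) n, F x = ⨆ n : ℕ, ∫⁻ x in ball (0 : Euc d) n, F x := by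
    apply setLIntegral_iUnion_of_directed
    exact (monotone_nat_of_le_succ fun n => ball_subset_ball (by push_cast; linarith)).directed_le
  rw [iUnion_ball_nat, setLIntegral_univ] at h1
  rw [h1]
  exact iSup_le fun n => h n

lemma stein_tomas (d : ℕ) (hd : 2 ≤ d) [NeZero d] (q : ℝ)
    (hq : 2 * ((d:ℝ)+1) / ((d:ℝ)-1) < q) :
    ∃ C : ℝ≥0, ∀ h : Euc d → ℂ, BdM h →
      ∫⁻ x, ‖extE h x‖ₑ ^ q ≤ (C * (∫⁻ ω, ‖h ω‖ₑ ^ (2:ℝ) ∂(sphereMeasure d)) ^ (1/2:ℝ)) ^ q := by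
  have hd1 : (0:ℝ) < (d:ℝ) - 1 := by
    have : (2:ℝ) ≤ d := by exact_mod_cast hd
    linarith
  have hq2 : 2 < q := by
    refine lt_trans ?_ hq
    rw [lt_div_iff₀ hd1]; linarith
  set p := q / (q - 1) with hp
  have hpq : 1 / p = 1 - 1 / q := by rw [hp]; field_simp
  have hp0 : 0 < p := by rw [hp]; apply div_pos <;> linarith
  obtain ⟨C, hC⟩ := ST_dual d hd p q hq hpq
  refine ⟨C, fun h hh => ?_⟩
  obtain ⟨hm, M, hM⟩ := hh
  apply lintegral_of_balls
  intro R
  let l : Measure (Euc d) := volume.restrict (ball 0 R)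
  haveI : IsFiniteMeasure l := ⟨by simp [l]; exact measure_ball_lt_top⟩
  let G : Euc d → ℂ := extE h
  have hGm : Measurable G := measurable_opT measurable_ee_inner hm
  have hGb : ∀ x, ‖G x‖ ≤ 1 * M * (sphereMeasure d).real univ :=
    norm_opT_le (fun w y => (norm_ee _).le) (by norm_num) hM
  set MG := 1 * M * (sphereMeasure d).real univ
  have hMG : 0 ≤ MG := (norm_nonneg _).trans (hGb 0)
  let g : Euc d → ℂ := fun x => ((‖G x‖ ^ (q - 2) : ℝ) : ℂ) * (starRingEnd ℂ) (G x)
  have hgm : Measurable g :=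
    (Complex.continuous_ofReal.measurable.comp (hGm.norm.pow_const _)).mul
      (Complex.continuous_conj.measurable.comp hGm)
  have hgn : ∀ x, ‖g x‖ = ‖G x‖ ^ (q - 1) := fun x => by
    simp only [g]
    rw [norm_mul, RCLike.norm_conj, Complex.norm_real, Real.norm_of_nonneg (by positivity)]
    conv_lhs => rw [← Real.rpow_one ‖G x‖, ← Real.rpow_mul (norm_nonneg _)]
    rw [← Real.rpow_add' (norm_nonneg _) (by linarith)]
    congr 1; ring
  have hgb : ∀ x, ‖g x‖ ≤ MG ^ (q - 1) := fun x => by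
    rw [hgn]; exact Real.rpow_le_rpow (norm_nonneg _) (hGb x) (by linarith)
  have hgG : ∀ x, g x * G x = ((‖G x‖ ^ q : ℝ) : ℂ) := fun x => by
    simp only [g]
    rw [mul_assoc, mul_comm _ (G x), Complex.mul_conj']
    have : ‖G x‖ ^ q = ‖G x‖ ^ (q-2) * ‖G x‖ ^ 2 := by
      rw [← Real.rpow_natCast, ← Real.rpow_add' (norm_nonneg _) (by push_cast; linarith)]
      congr 1; push_cast; ring
    rw [this]; push_cast; rfl
  have hgp : ∀ x, ‖g x‖ₑ ^ p = ‖G x‖ₑ ^ q := fun x => by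
    rw [← ofReal_norm, hgn, ← ENNReal.ofReal_rpow_of_nonneg (norm_nonneg _) (by linarith),
      ofReal_norm, ← ENNReal.rpow_mul]
    congr 1; rw [hp]; field_simp
    rw [div_self (by linarith)]
  set I := ∫⁻ x in ball 0 R, ‖extE h x‖ₑ ^ q with hI
  have hgI : ∫⁻ x in ball 0 R, ‖g x‖ₑ ^ p = I := by simp only [hgp]; rfl
  have hIr : Integrable (fun x => ‖G x‖ ^ q) l := by
    refine Integrable.of_bound (hGm.norm.pow_const q).aestronglyMeasurable (MG ^ q)
      (Filter.Eventually.of_forall fun x => ?_)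
    rw [Real.norm_of_nonneg (by positivity)]
    exact Real.rpow_le_rpow (norm_nonneg _) (hGb x) (by linarith)
  have hIe : I = ENNReal.ofReal (∫ x, ‖G x‖ ^ q ∂l) := by
    rw [ofReal_integral_eq_lintegral_ofReal hIr
      (Filter.Eventually.of_forall fun x => by positivity), hI]
    congr 1; ext x
    rw [← ENNReal.ofReal_rpow_of_nonneg (norm_nonneg _) (by linarith), ofReal_norm]
  have hIt : I ≠ ⊤ := by rw [hIe]; exact ENNReal.ofReal_ne_top
  have hid : ∫ x, g x * G x ∂l =
      ∫ ω, h ω * (∫ x, ee (inner ℝ ω x) * g x ∂l) ∂(sphereMeasure d) := by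
    calc _ = ∫ x, ∫ ω, g x * (ee (inner ℝ x ω) * h ω) ∂(sphereMeasure d) ∂l := by
          congr 1; ext x; rw [integral_const_mul]; rfl
      _ = ∫ ω, ∫ x, g x * (ee (inner ℝ x ω) * h ω) ∂l ∂(sphereMeasure d) := by
          apply swap_bdd _ _ (MG ^ (q-1) * (1 * M))
          · intro x ω
            rw [norm_mul (g x), norm_mul (ee _), norm_ee]
            have := (norm_nonneg _).trans (hM ω)
            gcongr
            exacts [hgb x, hM ω]
          · exact (hgm.comp measurable_fst).mul (measurable_ee_inner.mul (hm.comp measurable_snd))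
      _ = _ := by
          congr 1; ext ω
          rw [← integral_const_mul]
          congr 1; ext x
          rw [real_inner_comm]; ring
  have hfin : I ≤ (C * (∫⁻ ω, ‖h ω‖ₑ ^ (2:ℝ) ∂(sphereMeasure d)) ^ (1/2:ℝ)) * I ^ (1/p) := by
    calc I = ‖∫ x, g x * G x ∂l‖ₑ := by
          simp only [hgG]
          rw [integral_complex_ofReal, ← ofReal_norm, Complex.norm_real,
            Real.norm_of_nonneg (integral_nonneg fun _ => by positivity), hIe]
      _ ≤ ∫⁻ ω, ‖h ω‖ₑ * ‖∫ x, ee (inner ℝ ω x) * g x ∂l‖ₑ ∂(sphereMeasure d) := by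
          rw [hid]
          refine (enorm_integral_le_lintegral_enorm _).trans (le_of_eq ?_)
          simp only [enorm_mul]
      _ ≤ (∫⁻ ω, ‖h ω‖ₑ ^ (2:ℝ) ∂(sphereMeasure d)) ^ (1/2:ℝ) *
          (∫⁻ ω, ‖∫ x, ee (inner ℝ ω x) * g x ∂l‖ₑ ^ (2:ℝ) ∂(sphereMeasure d)) ^ (1/2:ℝ) := by
          refine ENNReal.lintegral_mul_le_Lp_mul_Lq _ Real.HolderConjugate.two_two
            hm.enorm.aemeasurable (Measurable.aemeasurable ?_)
          exact (measurable_opT (K := fun ω x => ee (inner ℝ ω x)) measurable_ee_inner hgm).enorm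
      _ ≤ (∫⁻ ω, ‖h ω‖ₑ ^ (2:ℝ) ∂(sphereMeasure d)) ^ (1/2:ℝ) * (C * I ^ (1/p)) := by
          gcongr
          rw [one_div, ENNReal.rpow_inv_le_iff (by norm_num)]
          have := hC R g ⟨hgm, _, hgb⟩
          rwa [hgI] at this
      _ = _ := by ring
  exact rpow_cancel hIt (by linarith) hpq hfin

/-- radial part of Lebesgue measure -/
def radM (d : ℕ) : Measure ℝ :=
  (volume.restrict (Ioi 0)).withDensity (fun t => cS d * ENNReal.ofReal (t ^ (d-1)))

instance instSFiniteRadM (d : ℕ) : SFinite (radM d) := by unfold radM; infer_instance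

lemma radM_lintegral {d : ℕ} {f : ℝ → ℝ≥0∞} (hf : Measurable f) :
    ∫⁻ s, f s ∂(radM d) = ∫⁻ s in Ioi 0, cS d * ENNReal.ofReal (s ^ (d-1)) * f s := by
  unfold radM
  rw [lintegral_withDensity_eq_lintegral_mul _ (by fun_prop) hf]
  rfl

lemma radM_pos {d : ℕ} : ∀ᵐ s ∂(radM d), 0 < s := by
  unfold radM
  exact (withDensity_absolutelyContinuous _ _).ae_le (ae_restrict_mem measurableSet_Ioi)

lemma lintegral_rad {d : ℕ} [NeZero d] {g : Euc d → ℝ≥0∞} (hg : Measurable g) :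
    ∫⁻ x, g x = ∫⁻ s, ∫⁻ ω, g (s • ω) ∂(sphereMeasure d) ∂(radM d) := by
  have hm : Measurable fun s : ℝ => ∫⁻ ω, g (s • ω) ∂(sphereMeasure d) :=
    Measurable.lintegral_prod_right' (f := fun q : ℝ × Euc d => g (q.1 • q.2))
      (hg.comp (by fun_prop))
  rw [radM_lintegral hm, lintegral_polar hg, ← lintegral_const_mul' _ _ cS_ne_top]
  simp only [mul_assoc]

lemma vol_polar (d : ℕ) [NeZero d] : (volume : Measure (Euc d)) =
    ((radM d).prod (sphereMeasure d)).map (fun q : ℝ × Euc d => q.1 • q.2) := by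
  have hm : Measurable (fun q : ℝ × Euc d => q.1 • q.2) := by fun_prop
  ext s hs
  rw [← lintegral_indicator_one hs, ← lintegral_indicator_one hs,
    lintegral_map (measurable_one.indicator hs) hm, lintegral_rad (measurable_one.indicator hs),
    lintegral_prod]
  exact ((measurable_one.indicator hs).comp hm).aemeasurable

lemma integral_rad {d : ℕ} [NeZero d] {g : Euc d → ℂ} (hg : Integrable g) :
    ∫ x, g x = ∫ s, ∫ ω, g (s • ω) ∂(sphereMeasure d) ∂(radM d) := by
  have hm : Measurable (fun q : ℝ × Euc d => q.1 • q.2) := by fun_prop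
  have e := vol_polar d
  have hg' : Integrable g (((radM d).prod (sphereMeasure d)).map (fun q : ℝ × Euc d => q.1 • q.2)) := by
    rw [← e]; exact hg
  conv_lhs => rw [e]
  rw [integral_map hm.aemeasurable hg'.aestronglyMeasurable, integral_prod]
  exact (integrable_map_measure hg'.aestronglyMeasurable hm.aemeasurable).1 hg'

lemma mink {X S : Type*} [MeasurableSpace X] [MeasurableSpace S] {μ : Measure X} {ν : Measure S}
    [SFinite μ] [SFinite ν] (Φ : X → S → ℝ≥0∞) (hΦ : Measurable (Function.uncurry Φ)) (r : ℝ)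
    (hr : 1 < r) (hfin : ∫⁻ x, (∫⁻ s, Φ x s ∂ν) ^ r ∂μ ≠ ⊤) :
    ∫⁻ x, (∫⁻ s, Φ x s ∂ν) ^ r ∂μ ≤ (∫⁻ s, (∫⁻ x, Φ x s ^ r ∂μ) ^ (1/r) ∂ν) ^ r := by
  set N : X → ℝ≥0∞ := fun x => ∫⁻ s, Φ x s ∂ν with hN
  have hNm : Measurable N := hΦ.lintegral_prod_right'
  have hc := Real.HolderConjugate.conjExponent hr
  set r' := r.conjExponent with hr'
  have e1 : (r - 1) * r' = r := by
    rw [hr', Real.conjExponent]; field_simp; rw [div_self (by linarith)]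
  refine rpow_cancel (p := r') hfin (by linarith) ?_ ?_
  · have := hc.inv_add_inv_eq_one
    rw [one_div, one_div]; linarith
  calc ∫⁻ x, N x ^ r ∂μ = ∫⁻ x, ∫⁻ s, Φ x s * N x ^ (r-1) ∂ν ∂μ := by
        congr 1; ext x
        have hx : Measurable (fun s => Φ x s) := hΦ.comp measurable_prodMk_left
        rw [lintegral_mul_const _ hx]
        change N x ^ r = N x * N x ^ (r-1)
        conv_rhs => rw [← ENNReal.rpow_one (N x), ← ENNReal.rpow_mul, one_mul]
        rw [← ENNReal.rpow_add_of_nonneg _ _ (by norm_num) (by linarith)]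
        congr 1; ring
    _ = ∫⁻ s, ∫⁻ x, Φ x s * N x ^ (r-1) ∂μ ∂ν := by
        rw [lintegral_lintegral_swap]
        exact (hΦ.mul ((hNm.comp measurable_fst).pow_const _)).aemeasurable
    _ ≤ ∫⁻ s, (∫⁻ x, Φ x s ^ r ∂μ) ^ (1/r) * (∫⁻ x, N x ^ r ∂μ) ^ (1/r') ∂ν := by
        apply lintegral_mono; intro s
        have hx : Measurable (fun x => Φ x s) := hΦ.comp measurable_prodMk_right
        have h3 := ENNReal.lintegral_mul_le_Lp_mul_Lq μ hc hx.aemeasurable (hNm.pow_const (r-1)).aemeasurable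
        simp only [← ENNReal.rpow_mul, e1] at h3
        exact h3
    _ = _ := by
        rw [lintegral_mul_const]
        refine Measurable.pow_const ?_ _
        exact Measurable.lintegral_prod_left' (f := fun q : X × S => Φ q.1 q.2 ^ r) (hΦ.pow_const r)

/-- spherical average of `U` times a character -/
def hS {d : ℕ} (U : Euc d → ℂ) (x : Euc d) (s : ℝ) : ℂ :=
  ∫ ω, ee (s * inner ℝ x ω) * U (s • ω) ∂(sphereMeasure d)

lemma hS_extE {d : ℕ} (U : Euc d → ℂ) (x : Euc d) (s : ℝ) :
    hS U x s = extE (fun ω => U (s • ω)) (s • x) := by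
  unfold hS extE; simp only [real_inner_smul_left]

lemma hS_meas {d : ℕ} [NeZero d] {U : Euc d → ℂ} (hU : Continuous U) :
    Measurable (fun q : Euc d × ℝ => hS U q.1 q.2) := by
  unfold hS
  apply StronglyMeasurable.measurable
  apply StronglyMeasurable.integral_prod_right' (f := fun q : (Euc d × ℝ) × Euc d =>
    ee (q.1.2 * inner ℝ q.1.1 q.2) * U (q.1.2 • q.2))
  apply Continuous.stronglyMeasurable
  exact (continuous_ee.comp (by fun_prop)).mul (hU.comp (by fun_prop))

lemma hS_bound {d : ℕ} [NeZero d] {U : Euc d → ℂ} {M : ℝ} (hM : ∀ x, ‖U x‖ ≤ M)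
    (x : Euc d) (s : ℝ) : ‖hS U x s‖ ≤ M := by
  unfold hS
  have := norm_integral_le_of_norm_le_const (μ := sphereMeasure d) (C := M)
    (f := fun ω => ee (s * inner ℝ x ω) * U (s • ω))
    (Filter.Eventually.of_forall fun ω => by rw [norm_mul, norm_ee, one_mul]; exact hM _)
  simpa using this

lemma hS_zero {d : ℕ} [NeZero d] {U : Euc d → ℂ} {L : ℝ} (hL : ∀ x, L < ‖x‖ → U x = 0)
    (x : Euc d) (s : ℝ) (hs0 : 0 ≤ s) (hs : L < s) : hS U x s = 0 := by
  unfold hS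
  rw [integral_eq_zero_of_ae]
  filter_upwards [sphere_ae_norm] with ω hω
  rw [hL]; · simp
  rw [norm_smul, hω, Real.norm_of_nonneg hs0]; linarith

lemma hS_cont {d : ℕ} [NeZero d] {U : Euc d → ℂ} (hU : Continuous U) (M : ℝ) (hM : ∀ x, ‖U x‖ ≤ M)
    (x : Euc d) : Continuous (hS U x) := by
  unfold hS
  refine continuous_of_dominated (bound := fun _ => M) ?_ ?_ ?_ ?_
  · intro s
    exact ((continuous_ee.comp (by fun_prop)).mul (hU.comp (by fun_prop))).aestronglyMeasurable
  · intro s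
    exact Filter.Eventually.of_forall fun ω => by rw [norm_mul, norm_ee, one_mul]; exact hM _
  · exact integrable_const _
  · exact Filter.Eventually.of_forall fun ω =>
      (continuous_ee.comp (by fun_prop)).mul (hU.comp (by fun_prop))

lemma lintegral_scale {d : ℕ} (g : Euc d → ℝ≥0∞) (hg : Measurable g) (s : ℝ) (hs : 0 < s) :
    ∫⁻ x, g (s • x) = ENNReal.ofReal (s ^ (-(d:ℝ))) * ∫⁻ x, g x := by
  have h := Measure.map_addHaar_smul (volume : Measure (Euc d)) hs.ne'
  rw [← lintegral_map hg (measurable_const_smul s), h, lintegral_smul_measure]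
  rw [abs_of_nonneg (by positivity)]
  simp [Real.rpow_neg hs.le]

lemma S_core (d : ℕ) (hd : 2 ≤ d) [NeZero d] (q : ℝ) (hq : 2 * ((d:ℝ)+1) / ((d:ℝ)-1) < q) :
    ∃ C : ℝ≥0, ∀ U : Euc d → ℂ, Continuous U → HasCompactSupport U → ∀ w : ℝ → ℝ, Continuous w →
      ∫⁻ x, (∫⁻ s, ENNReal.ofReal (w s) * ‖hS U x s‖ₑ ^ (2:ℝ) ∂(radM d)) ^ (q/2) ≤
        (C * ∫⁻ ξ, ENNReal.ofReal (w ‖ξ‖) * ENNReal.ofReal (‖ξ‖ ^ (-(2 * (d:ℝ) / q))) * ‖U ξ‖ₑ ^ (2:ℝ)) ^ (q/2) := by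
  have hd1 : (0:ℝ) < (d:ℝ) - 1 := by
    have : (2:ℝ) ≤ d := by exact_mod_cast hd
    linarith
  have hq2 : 2 < q := by
    refine lt_trans ?_ hq
    rw [lt_div_iff₀ hd1]; linarith
  obtain ⟨C, hC⟩ := stein_tomas d hd q hq
  refine ⟨C ^ 2, fun U hU hUs w hw => ?_⟩
  obtain ⟨M, hM⟩ := hUs.exists_bound_of_continuous hU
  obtain ⟨L, hL⟩ : ∃ L : ℝ, ∀ x, L < ‖x‖ → U x = 0 := by
    obtain ⟨L, hL⟩ := hUs.isCompact.isBounded.subset_closedBall (0 : Euc d)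
    refine ⟨L, fun x hx => image_eq_zero_of_notMem_tsupport fun h => ?_⟩
    have := hL h
    simp at this; linarith
  have hwm : Measurable w := hw.measurable
  apply lintegral_of_balls
  intro R
  have hΦ : Measurable (Function.uncurry fun (x : Euc d) (s : ℝ) =>
      ENNReal.ofReal (w s) * ‖hS U x s‖ₑ ^ (2:ℝ)) :=
    ((hwm.comp measurable_snd).ennreal_ofReal).mul ((hS_meas hU).enorm.pow_const _)
  refine (mink _ hΦ (q/2) (by linarith) ?_).trans ?_
  · -- finiteness
    obtain ⟨W, hW⟩ := (isCompact_Icc (a := (0:ℝ)) (b := L)).exists_bound_of_continuousOn hw.continuousOn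
    have hb : ∀ x : Euc d, ∫⁻ s, ENNReal.ofReal (w s) * ‖hS U x s‖ₑ ^ (2:ℝ) ∂(radM d) ≤
        ENNReal.ofReal W * ENNReal.ofReal M ^ (2:ℝ) * volume (closedBall (0 : Euc d) L) := by
      intro x
      calc _ ≤ ∫⁻ s, ENNReal.ofReal W * ENNReal.ofReal M ^ (2:ℝ) * ∫⁻ ω,
              (closedBall (0 : Euc d) L).indicator 1 (s • ω) ∂(sphereMeasure d) ∂(radM d) := by
            apply lintegral_mono_ae
            filter_upwards [radM_pos] with s hs
            by_cases hsL : s ≤ L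
            · have : ∫⁻ ω, (closedBall (0 : Euc d) L).indicator 1 (s • ω) ∂(sphereMeasure d) = 1 := by
                have : ∫⁻ ω, (1:ℝ≥0∞) ∂(sphereMeasure d) = 1 := by simp
                rw [← this]
                apply lintegral_congr_ae
                filter_upwards [sphere_ae_norm] with ω hω
                rw [indicator_of_mem]; · rfl
                simp [norm_smul, hω, abs_of_pos hs, hsL]
              rw [this, mul_one]
              gcongr
              · exact (le_abs_self _).trans (hW s ⟨hs.le, hsL⟩)
              · rw [← ofReal_norm]; exact ENNReal.ofReal_le_ofReal (hS_bound hM x s)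
            · rw [hS_zero hL x s hs.le (by linarith)]; simp
        _ = _ := by
            rw [lintegral_const_mul', ← lintegral_rad, lintegral_indicator_one measurableSet_closedBall]
            · exact measurable_one.indicator measurableSet_closedBall
            · exact ENNReal.mul_ne_top ENNReal.ofReal_ne_top
                (ENNReal.rpow_ne_top_of_nonneg (by norm_num) ENNReal.ofReal_ne_top)
    refine ne_top_of_le_ne_top ?_ (lintegral_mono fun x => ENNReal.rpow_le_rpow (hb x) (by linarith))
    rw [setLIntegral_const]
    refine ENNReal.mul_ne_top (ENNReal.rpow_ne_top_of_nonneg (by linarith) ?_) measure_ball_lt_top.ne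
    refine ENNReal.mul_ne_top (ENNReal.mul_ne_top ENNReal.ofReal_ne_top
                (ENNReal.rpow_ne_top_of_nonneg (by norm_num) ENNReal.ofReal_ne_top)) measure_closedBall_lt_top.ne
  · apply ENNReal.rpow_le_rpow _ (by linarith)
    have hUm := hU.measurable
    have key : ∀ᵐ s ∂(radM d), (∫⁻ x in ball 0 R, (ENNReal.ofReal (w s) * ‖hS U x s‖ₑ ^ (2:ℝ)) ^ (q/2)) ^ (1/(q/2))
        ≤ (C ^ 2 : ℝ≥0) * ∫⁻ ω, ENNReal.ofReal (w ‖s • ω‖) * ENNReal.ofReal (‖s • ω‖ ^ (-(2 * (d:ℝ) / q)))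
          * ‖U (s • ω)‖ₑ ^ (2:ℝ) ∂(sphereMeasure d) := by
      filter_upwards [radM_pos] with s hs
      have hh : BdM fun ω => U (s • ω) := ⟨hUm.comp (by fun_prop), M, fun ω => hM _⟩
      have hq0 : q ≠ 0 := by linarith
      set J := ∫⁻ ω, ‖U (s • ω)‖ₑ ^ (2:ℝ) ∂(sphereMeasure d) with hJ
      have h1 : ∫⁻ x : Euc d, ‖hS U x s‖ₑ ^ q ≤ ENNReal.ofReal (s ^ (-(d:ℝ))) * (C * J ^ (1/2:ℝ)) ^ q := by
        simp only [hS_extE]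
        rw [lintegral_scale (fun x => ‖extE (fun ω => U (s • ω)) x‖ₑ ^ q) _ s hs]
        · exact mul_le_mul_right (hC _ hh) _
        · exact (measurable_opT measurable_ee_inner hh.1).enorm.pow_const _
      have e2 : ∀ x : Euc d, (ENNReal.ofReal (w s) * ‖hS U x s‖ₑ ^ (2:ℝ)) ^ (q/2) =
          ENNReal.ofReal (w s) ^ (q/2) * ‖hS U x s‖ₑ ^ q := by
        intro x
        rw [ENNReal.mul_rpow_of_nonneg _ _ (by linarith), ← ENNReal.rpow_mul]
        congr 2; ring
      have e3 : ∫⁻ ω, ENNReal.ofReal (w ‖s • ω‖) * ENNReal.ofReal (‖s • ω‖ ^ (-(2 * (d:ℝ) / q)))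
          * ‖U (s • ω)‖ₑ ^ (2:ℝ) ∂(sphereMeasure d) =
          ENNReal.ofReal (w s) * ENNReal.ofReal (s ^ (-(2 * (d:ℝ) / q))) * J := by
        rw [hJ, ← lintegral_const_mul' _ _ (ENNReal.mul_ne_top ENNReal.ofReal_ne_top ENNReal.ofReal_ne_top)]
        apply lintegral_congr_ae
        filter_upwards [sphere_ae_norm] with ω hω
        rw [norm_smul, hω, Real.norm_of_nonneg hs.le, mul_one]
      rw [e3]
      simp only [e2]
      rw [lintegral_const_mul' _ _ (ENNReal.rpow_ne_top_of_nonneg (by linarith) ENNReal.ofReal_ne_top)]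
      calc _ ≤ (ENNReal.ofReal (w s) ^ (q/2) * (ENNReal.ofReal (s ^ (-(d:ℝ))) * (C * J ^ (1/2:ℝ)) ^ q)) ^ (1/(q/2)) := by
            gcongr
            exact (setLIntegral_le_lintegral _ _).trans h1
        _ = _ := by
            rw [ENNReal.mul_rpow_of_nonneg _ _ (by positivity), ENNReal.mul_rpow_of_nonneg _ _ (by positivity),
              ← ENNReal.rpow_mul, ← ENNReal.rpow_mul, mul_one_div_cancel (by positivity), ENNReal.rpow_one,
              ENNReal.mul_rpow_of_nonneg _ _ (by positivity), ← ENNReal.rpow_mul,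
              ENNReal.ofReal_rpow_of_pos (by positivity), ← Real.rpow_mul hs.le]
            rw [show q * (1/(q/2)) = 2 by field_simp, show (1/2:ℝ) * 2 = 1 by norm_num,
              show -(d:ℝ) * (1/(q/2)) = -(2 * (d:ℝ) / q) by field_simp, ENNReal.rpow_one]
            push_cast
            rw [show ((C:ℝ≥0∞) ^ (2:ℝ)) = (C:ℝ≥0∞)^2 by norm_cast]
            ring
    refine (lintegral_mono_ae key).trans ?_
    have hmeas : Measurable (fun ξ : Euc d => ENNReal.ofReal (w ‖ξ‖) *
        ENNReal.ofReal (‖ξ‖^(-(2*(d:ℝ)/q))) * ‖U ξ‖ₑ^(2:ℝ)) :=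
      ((hwm.comp measurable_norm).ennreal_ofReal.mul
      ((measurable_norm.pow_const _).ennreal_ofReal)).mul (hUm.enorm.pow_const _)
    rw [lintegral_const_mul' _ _ (by simp), lintegral_rad hmeas]

lemma fInv_ee {d : ℕ} (U : Euc d → ℂ) (x : Euc d) :
    𝓕⁻ U x = ∫ ξ, ee (inner ℝ ξ x) * U ξ := by
  rw [Real.fourierInv_eq]; simp only [ee_smul]

lemma sphAvg_inv {d : ℕ} [NeZero d] {U : Euc d → ℂ} (hU : Continuous U) (hUi : Integrable U)
    (t : ℝ) (x : Euc d) :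
    sphAvg (𝓕⁻ U) t x = ∫ ξ, ee (inner ℝ ξ x) * U ξ * (sigH (t • ξ) : ℂ) := by
  unfold sphAvg
  simp only [fInv_ee]
  rw [integral_integral_swap]
  · congr 1; ext ξ
    rw [← sigH_neg, ← sigH_ee, ← integral_const_mul]
    congr 1; ext y
    rw [inner_sub_right, real_inner_smul_right, inner_neg_left, real_inner_smul_left, sub_eq_add_neg, ee_add]
    ring
  · refine (hUi.comp_snd (sphereMeasure d)).mono ?_ ?_
    · apply Continuous.aestronglyMeasurable
      exact (continuous_ee.comp (by fun_prop)).mul (hU.comp continuous_snd)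
    · exact Filter.Eventually.of_forall fun q => by
        simp only [Function.uncurry, norm_mul, norm_ee, one_mul, le_refl]

lemma cpt_zero {d : ℕ} {U : Euc d → ℂ} (hUs : HasCompactSupport U) :
    ∃ L : ℝ, 0 ≤ L ∧ ∀ x, L < ‖x‖ → U x = 0 := by
  obtain ⟨L, hL⟩ := hUs.isCompact.isBounded.subset_closedBall (0 : Euc d)
  refine ⟨max L 0, le_max_right _ _, fun x hx => image_eq_zero_of_notMem_tsupport fun h => ?_⟩
  have := hL h
  simp at this hx; linarith

/-- radial profile -/
def HS {d : ℕ} (U : Euc d → ℂ) (x : Euc d) (η : Euc d) : ℂ := hS U x ‖η‖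

lemma HS_cont {d : ℕ} [NeZero d] {U : Euc d → ℂ} (hU : Continuous U) (hUs : HasCompactSupport U) (x : Euc d) :
    Continuous (HS U x) := by
  obtain ⟨M, hM⟩ := hUs.exists_bound_of_continuous hU
  exact (hS_cont hU M hM x).comp continuous_norm

lemma HS_supp {d : ℕ} [NeZero d] {U : Euc d → ℂ} (hUs : HasCompactSupport U) (x : Euc d) :
    HasCompactSupport (HS U x) := by
  obtain ⟨L, hL0, hL⟩ := cpt_zero hUs
  apply HasCompactSupport.of_support_subset_isCompact (isCompact_closedBall (0 : Euc d) L)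
  intro η hη
  by_contra h
  simp at h
  exact hη (hS_zero hL x _ (norm_nonneg _) h)

lemma sphAvg_HS {d : ℕ} [NeZero d] {U : Euc d → ℂ} (hU : Continuous U) (hUs : HasCompactSupport U)
    (x z : Euc d) : sphAvg (𝓕⁻ U) ‖z‖ x = 𝓕⁻ (HS U x) z := by
  have hUi := hU.integrable_of_hasCompactSupport hUs (μ := volume)
  have hHc := HS_cont hU hUs x
  have hHi := hHc.integrable_of_hasCompactSupport (HS_supp hUs x) (μ := volume)
  have cs := continuous_sigH (d := d)
  rw [sphAvg_inv hU hUi, fInv_ee, integral_rad, integral_rad]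
  · apply integral_congr_ae
    filter_upwards [radM_pos] with s hs
    have e1 : ∫ ω, ee (inner ℝ (s • ω) x) * U (s • ω) * (sigH (‖z‖ • s • ω) : ℂ) ∂(sphereMeasure d)
        = ∫ ω, (ee (s * inner ℝ x ω) * U (s • ω)) * (sigH (s • z) : ℂ) ∂(sphereMeasure d) := by
      apply integral_congr_ae
      filter_upwards [sphere_ae_norm] with ω hω
      have : sigH (‖z‖ • s • ω) = sigH (s • z) := by
        unfold sigH; simp [norm_smul, hω, mul_comm]
      rw [this, real_inner_smul_left, real_inner_comm]
    have e2 : ∫ ω, ee (inner ℝ (s • ω) z) * HS U x (s • ω) ∂(sphereMeasure d)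
        = ∫ ω, ee (inner ℝ (s • z) ω) * hS U x s ∂(sphereMeasure d) := by
      apply integral_congr_ae
      filter_upwards [sphere_ae_norm] with ω hω
      unfold HS
      rw [norm_smul, hω, Real.norm_of_nonneg hs.le, mul_one, real_inner_smul_left, real_inner_smul_left,
        real_inner_comm]
    rw [e1, e2, integral_mul_const, integral_mul_const, sigH_ee, mul_comm]
    rfl
  · refine hHi.mono ((continuous_ee.comp (by fun_prop)).mul hHc).aestronglyMeasurable ?_
    exact Filter.Eventually.of_forall fun η => by simp [norm_ee]
  · refine hUi.mono (((continuous_ee.comp (by fun_prop)).mul hU).mul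
      (Complex.continuous_ofReal.comp (cs.comp (by fun_prop)))).aestronglyMeasurable ?_
    refine Filter.Eventually.of_forall fun η => ?_
    rw [norm_mul, norm_mul, norm_ee, one_mul, Complex.norm_real]
    exact mul_le_of_le_one_right (norm_nonneg _) (abs_sigH_le_one _)

/-- lower bound for the radial measure on [1,2] -/
lemma radM_Icc {d : ℕ} [NeZero d] (f : ℝ → ℝ≥0∞) (hf : Measurable f) :
    ∫⁻ t in Icc (1:ℝ) 2, f t ≤ (cS d)⁻¹ * ∫⁻ t, f t ∂(radM d) := by
  rw [radM_lintegral hf]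
  simp only [mul_assoc]
  rw [lintegral_const_mul' _ _ cS_ne_top, ← mul_assoc, ENNReal.inv_mul_cancel cS_ne_zero cS_ne_top, one_mul]
  calc _ ≤ ∫⁻ t in Icc (1:ℝ) 2, ENNReal.ofReal (t ^ (d-1)) * f t := by
        apply setLIntegral_mono' measurableSet_Icc
        intro t ht
        have : 1 ≤ ENNReal.ofReal (t ^ (d-1)) := by
          rw [← ENNReal.ofReal_one]
          exact ENNReal.ofReal_le_ofReal (one_le_pow₀ ht.1)
        calc f t = 1 * f t := (one_mul _).symm
          _ ≤ _ := by gcongr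
    _ ≤ _ := lintegral_mono_set fun t ht => lt_of_lt_of_le one_pos ht.1

lemma radM_of_euc {d : ℕ} [NeZero d] (g : Euc d → ℝ≥0∞) (hg : Measurable g)
    (f : ℝ → ℝ≥0∞) (hf : Measurable f) (h : ∀ z, z ≠ 0 → f ‖z‖ ≤ g z) :
    ∫⁻ t in Icc (1:ℝ) 2, f t ≤ (cS d)⁻¹ * ∫⁻ z, g z := by
  refine (radM_Icc (d := d) f hf).trans ?_
  gcongr
  rw [lintegral_rad hg]
  apply lintegral_mono_ae
  filter_upwards [radM_pos] with s hs
  have : f s = ∫⁻ ω, f s ∂(sphereMeasure d) := by simp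
  rw [this]
  apply lintegral_mono_ae
  filter_upwards [sphere_ae_norm] with ω hω
  have := h (s • ω) (by
    rw [← norm_pos_iff, norm_smul, hω]; simpa using hs.ne')
  rwa [norm_smul, hω, Real.norm_of_nonneg hs.le, mul_one] at this

lemma euc_of_rad {d : ℕ} [NeZero d] (f : ℝ → ℝ≥0∞) (hf : Measurable f) :
    ∫⁻ z : Euc d, f ‖z‖ = ∫⁻ t, f t ∂(radM d) := by
  rw [lintegral_rad (g := fun z : Euc d => f ‖z‖) (hf.comp measurable_norm)]
  apply lintegral_congr_ae
  filter_upwards [radM_pos] with s hs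
  have : f s = ∫⁻ ω, f s ∂(sphereMeasure d) := by simp
  rw [this]
  apply lintegral_congr_ae
  filter_upwards [sphere_ae_norm] with ω hω
  simp only [norm_smul, hω, Real.norm_of_nonneg hs.le, mul_one]

lemma hasDeriv_ee (c t : ℝ) : HasDerivAt (fun t : ℝ => ee (t * c)) (2 * Real.pi * c * Complex.I * ee (t * c)) t := by
  unfold ee
  have h1 : HasDerivAt (fun t : ℝ => ((2 * Real.pi * (t * c) : ℝ) : ℂ) * Complex.I) (((2 * Real.pi * (1 * c) : ℝ):ℂ) * Complex.I) t :=
    ((((hasDerivAt_id t).mul_const c).const_mul (2 * Real.pi)).ofReal_comp).mul_const _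
  convert h1.cexp using 1
  push_cast; ring

lemma hasDeriv_inv {d : ℕ} [NeZero d] {H : Euc d → ℂ} (hH : Continuous H) (hHs : HasCompactSupport H)
    (e : Euc d) (t : ℝ) :
    HasDerivAt (fun t : ℝ => 𝓕⁻ H (t • e))
      (∑ i, (e i : ℂ) * 𝓕⁻ (fun η => 2 * Real.pi * Complex.I * (η i) * H η) (t • e)) t := by
  have hci : ∀ i, Continuous (fun η : Euc d => (2 * Real.pi * Complex.I * (η i) * H η : ℂ)) := by
    intro i; fun_prop
  have hsi : ∀ i, HasCompactSupport (fun η : Euc d => (2 * Real.pi * Complex.I * (η i) * H η : ℂ)) :=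
    fun i => hHs.mul_left
  have hIntg : ∀ i, Integrable (fun η : Euc d => ee (inner ℝ η (t • e)) * (2 * Real.pi * Complex.I * (η i) * H η : ℂ)) := by
    intro i
    apply Continuous.integrable_of_hasCompactSupport
    · exact (continuous_ee.comp (by fun_prop)).mul (hci i)
    · exact (hsi i).mul_left
  have e1 : ∑ i, (e i : ℂ) * 𝓕⁻ (fun η => 2 * Real.pi * Complex.I * (η i) * H η) (t • e) =
      ∫ η, 2 * Real.pi * (inner ℝ η e : ℝ) * Complex.I * ee (t * inner ℝ η e) * H η := by
    simp only [fInv_ee, ← integral_const_mul]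
    rw [← integral_finsetSum _ fun i _ => (hIntg i).const_mul _]
    congr 1; ext η
    rw [real_inner_smul_right]
    have : (inner ℝ η e : ℝ) = ∑ i, η i * e i := by
      rw [PiLp.inner_apply]; simp [mul_comm]
    have h2 : ((inner ℝ η e : ℝ) : ℂ) = ∑ i, (η i : ℂ) * e i := by rw [this]; push_cast; rfl
    rw [h2, Finset.mul_sum, Finset.sum_mul, Finset.sum_mul, Finset.sum_mul]
    apply Finset.sum_congr rfl
    intro i _; ring
  rw [e1]
  simp only [fInv_ee, real_inner_smul_right]
  have := hasDerivAt_integral_of_dominated_loc_of_deriv_le (μ := (volume : Measure (Euc d))) (𝕜 := ℝ) (E := ℂ)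
    (F := fun t η => ee (t * inner ℝ η e) * H η)
    (F' := fun t η => 2 * Real.pi * (inner ℝ η e : ℝ) * Complex.I * ee (t * inner ℝ η e) * H η)
    (x₀ := t) (s := univ) (bound := fun η => ‖(2 * Real.pi * (inner ℝ η e : ℝ) : ℂ) * H η‖) Filter.univ_mem ?_ ?_ ?_ ?_ ?_ ?_
  · exact this.2
  · refine Filter.Eventually.of_forall fun s => ?_
    exact ((continuous_ee.comp (by fun_prop)).mul hH).aestronglyMeasurable
  · apply Continuous.integrable_of_hasCompactSupport
    · exact ((continuous_ee.comp (by fun_prop)).mul hH)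
    · exact hHs.mul_left
  · have h5 : Continuous fun η : Euc d => ee (t * inner ℝ η e) := continuous_ee.comp (by fun_prop)
    apply Continuous.aestronglyMeasurable
    fun_prop
  · refine Filter.Eventually.of_forall fun η s _ => ?_
    simp only [norm_mul, norm_ee, Complex.norm_I, mul_one, le_refl]
  · apply Integrable.norm
    apply Continuous.integrable_of_hasCompactSupport
    · fun_prop
    · exact hHs.mul_left
  · refine Filter.Eventually.of_forall fun η s _ => ?_
    exact (hasDeriv_ee _ s).mul_const _

lemma enorm_sq (v : ℂ) : ‖v‖ₑ ^ (2:ℝ) = ENNReal.ofReal (‖v‖ ^ 2) := by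
  rw [← ofReal_norm, ENNReal.ofReal_rpow_of_nonneg (norm_nonneg _) (by norm_num)]
  norm_num

lemma measurable_sphAvg {d : ℕ} [NeZero d] {F : Euc d → ℂ} (hF : Measurable F) :
    Measurable (fun q : ℝ × Euc d => sphAvg F q.1 q.2) := by
  unfold sphAvg
  apply StronglyMeasurable.measurable
  apply StronglyMeasurable.integral_prod_right' (f := fun q : (ℝ × Euc d) × Euc d => F (q.1.2 - q.1.1 • q.2))
  exact (hF.comp (by fun_prop)).stronglyMeasurable

lemma continuous_fInv {d : ℕ} {U : Euc d → ℂ} (hU : Integrable U) : Continuous (𝓕⁻ U) := by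
  have : 𝓕⁻ U = fun x => 𝓕 U (-x) := by ext x; rw [Real.fourierInv_eq_fourier_neg]
  rw [this]; exact (continuous_fourier hU).comp continuous_neg

lemma lemS0 {d : ℕ} [NeZero d] {U : Euc d → ℂ} (hU : Continuous U) (hUs : HasCompactSupport U) (x : Euc d) :
    ∫⁻ t in Icc (1:ℝ) 2, ‖sphAvg (𝓕⁻ U) t x‖ₑ ^ (2:ℝ) ≤
      (cS d)⁻¹ * ∫⁻ s, ‖hS U x s‖ₑ ^ (2:ℝ) ∂(radM d) := by
  have hHc := HS_cont hU hUs x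
  have hHs := HS_supp hUs x
  have hHi := hHc.integrable_of_hasCompactSupport hHs (μ := volume)
  have hUi := hU.integrable_of_hasCompactSupport hUs (μ := volume)
  refine (radM_of_euc (fun z => ‖𝓕⁻ (HS U x) z‖ₑ ^ (2:ℝ)) ?_ _ ?_ ?_).trans ?_
  · exact (continuous_fInv hHi).measurable.enorm.pow_const _
  · exact ((measurable_sphAvg (continuous_fInv hUi).measurable).comp measurable_prodMk_right).enorm.pow_const _
  · intro z _
    rw [sphAvg_HS hU hUs]
  · rw [plancherel_inv hHi (hHc.memLp_of_hasCompactSupport hHs)]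
    refine le_of_eq ?_
    congr 1
    refine euc_of_rad (fun s => ‖hS U x s‖ₑ ^ (2:ℝ)) ?_
    exact ((hS_meas hU).comp measurable_prodMk_left).enorm.pow_const _

lemma lemS1 {d : ℕ} [NeZero d] {U : Euc d → ℂ} (hU : Continuous U) (hUs : HasCompactSupport U) (x : Euc d) :
    ∫⁻ t in Icc (1:ℝ) 2, ‖deriv (fun t => sphAvg (𝓕⁻ U) t x) t‖ₑ ^ (2:ℝ) ≤
      (cS d)⁻¹ * (d * d * ∫⁻ s, ENNReal.ofReal ((2 * Real.pi) ^ 2 * s ^ 2) * ‖hS U x s‖ₑ ^ (2:ℝ) ∂(radM d)) := by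
  have hHc := HS_cont hU hUs x
  have hHs := HS_supp hUs x
  have hUi := hU.integrable_of_hasCompactSupport hUs (μ := volume)
  set G : Fin d → Euc d → ℂ := fun i η => 2 * Real.pi * Complex.I * (η i) * HS U x η with hG
  have hci : ∀ i, Continuous (G i) := by
    intro i; rw [hG]; fun_prop
  have hsi : ∀ i, HasCompactSupport (G i) := fun i => hHs.mul_left
  have hii : ∀ i, Integrable (G i) := fun i => (hci i).integrable_of_hasCompactSupport (hsi i)
  refine (radM_of_euc (fun z => d * ∑ i, ‖𝓕⁻ (G i) z‖ₑ ^ (2:ℝ)) ?_ _ ?_ ?_).trans ?_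
  · refine Measurable.const_mul ?_ _
    refine Finset.measurable_sum _ fun i _ => ?_
    exact (continuous_fInv (hii i)).measurable.enorm.pow_const _
  · exact (measurable_deriv _).enorm.pow_const _
  · intro z hz
    have hz' : 0 < ‖z‖ := norm_pos_iff.2 hz
    set e : Euc d := ‖z‖⁻¹ • z with he
    have hen : ‖e‖ = 1 := by rw [he, norm_smul, norm_inv, norm_norm, inv_mul_cancel₀ hz'.ne']
    have hze : ‖z‖ • e = z := by rw [he, smul_smul, mul_inv_cancel₀ hz'.ne', one_smul]
    have hd := hasDeriv_inv hHc hHs e ‖z‖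
    have hd2 : HasDerivAt (fun t => sphAvg (𝓕⁻ U) t x) (∑ i, (e i : ℂ) * 𝓕⁻ (G i) z) ‖z‖ := by
      rw [hze] at hd
      refine hd.congr_of_eventuallyEq ?_
      filter_upwards [lt_mem_nhds hz'] with s hs
      rw [← sphAvg_HS hU hUs, norm_smul, hen, mul_one, Real.norm_of_nonneg hs.le]
    rw [hd2.deriv]
    simp only [enorm_sq]
    rw [← ENNReal.ofReal_sum_of_nonneg (fun i _ => by positivity),
      ← ENNReal.ofReal_natCast d, ← ENNReal.ofReal_mul (by positivity)]
    apply ENNReal.ofReal_le_ofReal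
    calc ‖∑ i, (e i : ℂ) * 𝓕⁻ (G i) z‖ ^ 2 ≤ (∑ i, ‖𝓕⁻ (G i) z‖) ^ 2 := by
          gcongr
          refine (norm_sum_le _ _).trans (Finset.sum_le_sum fun i _ => ?_)
          rw [norm_mul, Complex.norm_real]
          refine mul_le_of_le_one_left (norm_nonneg _) ?_
          exact (PiLp.norm_apply_le e i).trans hen.le
      _ ≤ _ := by
          have := sq_sum_le_card_mul_sum_sq (s := (Finset.univ : Finset (Fin d))) (f := fun i => ‖𝓕⁻ (G i) z‖)
          simpa using this
  · gcongr
    rw [lintegral_const_mul, lintegral_finsetSum, mul_assoc]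
    · gcongr
      have h1 : ∀ i, ∫⁻ z, ‖𝓕⁻ (G i) z‖ₑ ^ (2:ℝ) ≤
          ∫⁻ s, ENNReal.ofReal ((2 * Real.pi) ^ 2 * s ^ 2) * ‖hS U x s‖ₑ ^ (2:ℝ) ∂(radM d) := by
        intro i
        rw [plancherel_inv (hii i) ((hci i).memLp_of_hasCompactSupport (hsi i)), ← euc_of_rad]
        · apply lintegral_mono; intro η
          simp only [enorm_sq]
          rw [← ENNReal.ofReal_mul (by positivity)]
          apply ENNReal.ofReal_le_ofReal
          rw [hG]
          simp only [norm_mul, Complex.norm_I, Complex.norm_real, mul_pow]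
          have := PiLp.norm_apply_le η i
          simp only [Complex.norm_ofNat, one_pow, mul_one, Real.norm_eq_abs, sq_abs]
          have h2 : (η i)^2 ≤ ‖η‖^2 := by
            rw [← sq_abs]; gcongr; exact this
          unfold HS
          gcongr
        · exact Measurable.mul (by fun_prop) (((hS_meas hU).comp measurable_prodMk_left).enorm.pow_const _)
      refine (Finset.sum_le_sum fun i _ => h1 i).trans ?_
      simp
    · intro i _
      exact (continuous_fInv (hii i)).measurable.enorm.pow_const _
    · refine Finset.measurable_sum _ fun i _ => ?_
      exact (continuous_fInv (hii i)).measurable.enorm.pow_const _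

/-- Local smoothing type estimate (Lemma S). -/
lemma lemS (d : ℕ) (hd : 2 ≤ d) [NeZero d] (q : ℝ) (hq : 2 * ((d:ℝ)+1) / ((d:ℝ)-1) < q) :
    ∃ C : ℝ≥0, ∀ U : Euc d → ℂ, Continuous U → HasCompactSupport U →
      (∫⁻ x, (∫⁻ t in Icc (1:ℝ) 2, ‖sphAvg (𝓕⁻ U) t x‖ₑ ^ (2:ℝ)) ^ (q/2) ≤
        (C * ∫⁻ ξ, ENNReal.ofReal (‖ξ‖ ^ (-(2 * (d:ℝ) / q))) * ‖U ξ‖ₑ ^ (2:ℝ)) ^ (q/2)) ∧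
      (∫⁻ x, (∫⁻ t in Icc (1:ℝ) 2, ‖deriv (fun t => sphAvg (𝓕⁻ U) t x) t‖ₑ ^ (2:ℝ)) ^ (q/2) ≤
        (C * ∫⁻ ξ, ENNReal.ofReal (‖ξ‖ ^ 2) * ENNReal.ofReal (‖ξ‖ ^ (-(2 * (d:ℝ) / q))) * ‖U ξ‖ₑ ^ (2:ℝ)) ^ (q/2)) := by
  have hd1 : (0:ℝ) < (d:ℝ) - 1 := by
    have : (2:ℝ) ≤ d := by exact_mod_cast hd
    linarith
  have hq2 : 0 < q := by
    refine lt_trans ?_ hq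
    positivity
  obtain ⟨C, hC⟩ := S_core d hd q hq
  have hD : ∃ D : ℝ≥0, (cS d)⁻¹ = D := by
    lift (cS d)⁻¹ to ℝ≥0 using (ENNReal.inv_ne_top.2 cS_ne_zero) with D
    exact ⟨D, rfl⟩
  obtain ⟨D, hD⟩ := hD
  set P : ℝ≥0 := ((2 * Real.pi) ^ 2).toNNReal with hP
  refine ⟨D * C + D * d * d * C * P, fun U hU hUs => ⟨?_, ?_⟩⟩
  · have h1 := hC U hU hUs (fun _ => 1) continuous_const
    simp only [ENNReal.ofReal_one, one_mul] at h1
    calc _ ≤ ∫⁻ x, ((cS d)⁻¹ * ∫⁻ s, ‖hS U x s‖ₑ ^ (2:ℝ) ∂(radM d)) ^ (q/2) := by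
          gcongr with x; exact lemS0 hU hUs x
      _ = (cS d)⁻¹ ^ (q/2) * ∫⁻ x, (∫⁻ s, ‖hS U x s‖ₑ ^ (2:ℝ) ∂(radM d)) ^ (q/2) := by
          simp only [ENNReal.mul_rpow_of_nonneg _ _ (show 0 ≤ q/2 by linarith)]
          rw [lintegral_const_mul' _ _ (ENNReal.rpow_ne_top_of_nonneg (by linarith) (by rw [hD]; simp))]
      _ ≤ _ := by
          refine (mul_le_mul_right h1 _).trans ?_
          rw [← ENNReal.mul_rpow_of_nonneg _ _ (by linarith), hD, ← mul_assoc]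
          gcongr
          push_cast
          exact le_self_add
  · have h1 := hC U hU hUs (fun s => (2 * Real.pi) ^ 2 * s ^ 2) (by fun_prop)
    calc _ ≤ ∫⁻ x, ((cS d)⁻¹ * (d * d * ∫⁻ s, ENNReal.ofReal ((2 * Real.pi) ^ 2 * s ^ 2) * ‖hS U x s‖ₑ ^ (2:ℝ) ∂(radM d))) ^ (q/2) := by
          gcongr with x; exact lemS1 hU hUs x
      _ = ((cS d)⁻¹ * (d * d)) ^ (q/2) * ∫⁻ x, (∫⁻ s, ENNReal.ofReal ((2 * Real.pi) ^ 2 * s ^ 2) * ‖hS U x s‖ₑ ^ (2:ℝ) ∂(radM d)) ^ (q/2) := by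
          have e : ∀ I : ℝ≥0∞, ((cS d)⁻¹ * (d * d * I)) ^ (q/2) = ((cS d)⁻¹ * (d * d)) ^ (q/2) * I ^ (q/2) := by
            intro I
            rw [← ENNReal.mul_rpow_of_nonneg _ _ (by linarith)]; congr 1; ring
          simp only [e]
          rw [lintegral_const_mul' _ _ (ENNReal.rpow_ne_top_of_nonneg (by linarith) ?_)]
          rw [hD]
          exact ENNReal.mul_ne_top (by simp) (ENNReal.mul_ne_top (by simp) (by simp))
      _ ≤ _ := by
          refine (mul_le_mul_right h1 _).trans ?_
          rw [← ENNReal.mul_rpow_of_nonneg _ _ (by linarith), hD]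
          apply ENNReal.rpow_le_rpow _ (by linarith)
          simp only [ENNReal.ofReal_mul (show 0 ≤ (2 * Real.pi)^2 by positivity), mul_assoc]
          rw [lintegral_const_mul' _ _ (by simp)]
          simp only [← mul_assoc]
          gcongr
          have : ENNReal.ofReal ((2 * Real.pi) ^ 2) = P := rfl
          rw [this]; push_cast
          exact le_add_self

/-- spherical mean kernel at frequency scale `m` -/
def Kk {d : ℕ} (κ : Euc d → Euc d → ℂ) (m : ℝ) (x : Euc d) (t : ℝ) (y : Euc d) : ℂ :=
  ∫ ω, ((m ^ d : ℝ) : ℂ) * κ ω (m • (x - t • ω - y)) ∂(sphereMeasure d)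

/-- admissible profile -/
def Adm {d : ℕ} (κ : Euc d → Euc d → ℂ) (c : ℝ) : Prop :=
  Continuous (Function.uncurry κ) ∧ 0 ≤ c ∧ ∀ ω u, ‖ω‖ = 1 → ‖κ ω u‖ ≤ c * ((1 + ‖u‖) ^ (d+1))⁻¹

lemma Adm.le {d : ℕ} {κ : Euc d → Euc d → ℂ} {c : ℝ} (h : Adm κ c) (ω u : Euc d) (hω : ‖ω‖ = 1) :
    ‖κ ω u‖ ≤ c := by
  refine (h.2.2 ω u hω).trans (mul_le_of_le_one_right h.2.1 ?_)
  exact inv_le_one_of_one_le₀ (one_le_pow₀ (by linarith [norm_nonneg u]))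

lemma Kk_bound {d : ℕ} [NeZero d] {κ : Euc d → Euc d → ℂ} {c : ℝ} (h : Adm κ c) (m : ℝ) (hm : 0 < m)
    (x : Euc d) (t : ℝ) (y : Euc d) : ‖Kk κ m x t y‖ ≤ m ^ d * c := by
  have := norm_integral_le_of_norm_le_const (μ := sphereMeasure d) (C := m ^ d * c)
    (f := fun ω => ((m ^ d : ℝ) : ℂ) * κ ω (m • (x - t • ω - y))) (by
      filter_upwards [sphere_ae_norm] with ω hω
      rw [norm_mul, Complex.norm_real, Real.norm_of_nonneg (by positivity)]
      gcongr; exact h.le _ _ hω)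
  simpa [Kk] using this

/-- weight -/
def wt {d : ℕ} (m c : ℝ) (u : Euc d) : ℝ≥0∞ :=
  ENNReal.ofReal (m ^ d) * ENNReal.ofReal c * ENNReal.ofReal (((1 + m * ‖u‖) ^ (d+1))⁻¹)

lemma wt_meas {d : ℕ} (m c : ℝ) : Measurable (wt (d := d) m c) := by unfold wt; fun_prop

lemma wt_int {d : ℕ} (m c : ℝ) (hm : 0 < m) (v : Euc d) :
    ∫⁻ u, wt m c (v - u) = ENNReal.ofReal c * ∫⁻ u : Euc d, ENNReal.ofReal (((1 + ‖u‖) ^ (d+1))⁻¹) := by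
  unfold wt
  rw [lintegral_const_mul' _ _ (ENNReal.mul_ne_top ENNReal.ofReal_ne_top ENNReal.ofReal_ne_top),
    lintegral_weight_scale d m hm, ← mul_assoc, mul_right_comm (ENNReal.ofReal _),
    ← ENNReal.ofReal_mul (by positivity), mul_inv_cancel₀ (by positivity)]
  simp

lemma Kk_enorm {d : ℕ} [NeZero d] {κ : Euc d → Euc d → ℂ} {c : ℝ} (h : Adm κ c) (m : ℝ) (hm : 0 < m)
    (x : Euc d) (t : ℝ) (y : Euc d) :
    ‖Kk κ m x t y‖ₑ ≤ ∫⁻ ω, wt m c (x - t • ω - y) ∂(sphereMeasure d) := by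
  refine (enorm_integral_le_lintegral_enorm _).trans ?_
  apply lintegral_mono_ae
  filter_upwards [sphere_ae_norm] with ω hω
  unfold wt
  rw [← ENNReal.ofReal_mul (by positivity), ← ENNReal.ofReal_mul (mul_nonneg (by positivity) h.2.1),
    ← ofReal_norm]
  apply ENNReal.ofReal_le_ofReal
  rw [norm_mul, Complex.norm_real, Real.norm_of_nonneg (by positivity), mul_assoc]
  gcongr
  refine (h.2.2 ω _ hω).trans_eq ?_
  rw [norm_smul, Real.norm_of_nonneg hm.le]

/-- total kernel mass constant -/
def kC (d : ℕ) (c : ℝ) : ℝ≥0∞ :=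
  ENNReal.ofReal c * ∫⁻ u : Euc d, ENNReal.ofReal (((1 + ‖u‖) ^ (d+1))⁻¹)

lemma kC_ne_top (d : ℕ) (c : ℝ) : kC d c ≠ ⊤ :=
  ENNReal.mul_ne_top ENNReal.ofReal_ne_top (lintegral_weight_lt_top d).ne

lemma Kk_int_t {d : ℕ} [NeZero d] {κ : Euc d → Euc d → ℂ} {c : ℝ} (h : Adm κ c) (m : ℝ) (hm : 0 < m)
    (x y : Euc d) : ∫⁻ t in Icc (1:ℝ) 2, ‖Kk κ m x t y‖ₑ ≤ (cS d)⁻¹ * kC d c := by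
  refine (lintegral_mono fun t => Kk_enorm h m hm x t y).trans ?_
  have hw := wt_meas (d := d) m c
  refine (radM_Icc (d := d) _ ?_).trans ?_
  · exact Measurable.lintegral_prod_right' (f := fun q : ℝ × Euc d => wt m c (x - q.1 • q.2 - y))
      (hw.comp (by fun_prop))
  · gcongr
    rw [kC, ← wt_int m c hm (x - y), lintegral_rad (g := fun u => wt m c (x - y - u)) (hw.comp (by fun_prop))]
    simp only [sub_right_comm, le_refl]

lemma Kk_int_y {d : ℕ} [NeZero d] {κ : Euc d → Euc d → ℂ} {c : ℝ} (h : Adm κ c) (m : ℝ) (hm : 0 < m)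
    (x : Euc d) (t : ℝ) : ∫⁻ y, ‖Kk κ m x t y‖ₑ ≤ kC d c := by
  refine (lintegral_mono fun y => Kk_enorm h m hm x t y).trans ?_
  have hw := wt_meas (d := d) m c
  rw [lintegral_lintegral_swap]
  · simp only [wt_int m c hm]
    simp [kC]
  · exact (hw.comp (by fun_prop)).aemeasurable

lemma Kk_meas {d : ℕ} [NeZero d] {κ : Euc d → Euc d → ℂ} {c : ℝ} (h : Adm κ c) (m : ℝ) :
    Measurable (fun q : (Euc d × ℝ) × Euc d => Kk κ m q.1.1 q.1.2 q.2) := by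
  unfold Kk
  apply StronglyMeasurable.measurable
  apply StronglyMeasurable.integral_prod_right' (f := fun q : ((Euc d × ℝ) × Euc d) × Euc d =>
    ((m ^ d : ℝ) : ℂ) * κ q.2 (m • (q.1.1.1 - q.1.1.2 • q.2 - q.1.2)))
  apply Continuous.stronglyMeasurable
  refine continuous_const.mul ?_
  exact h.1.comp (f := fun q : ((Euc d × ℝ) × Euc d) × Euc d =>
    (q.2, m • (q.1.1.1 - q.1.1.2 • q.2 - q.1.2))) (by fun_prop)

lemma opT_enorm {W Y : Type*} [MeasurableSpace Y] (K : W → Y → ℂ) (l : Measure Y) (f : Y → ℂ) (w : W) :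
    ‖opT K l f w‖ₑ ≤ ∫⁻ y, ‖K w y‖ₑ * ‖f y‖ₑ ∂l := by
  unfold opT
  refine (enorm_integral_le_lintegral_enorm _).trans ?_
  simp only [enorm_mul, le_refl]

section multi
variable {ι : Type*} [MeasurableSpace ι] [Finite ι] [DiscreteMeasurableSpace ι]

/-- multi-scale kernel -/
def KK {d : ℕ} {ι : Type*} (κ : Euc d → Euc d → ℂ) (m : ι → ℝ) (w : (ι × Euc d) × ℝ) (y : Euc d) : ℂ :=
  Kk κ (m w.1.1) w.1.2 w.2 y

lemma KK_meas {d : ℕ} [NeZero d] {κ : Euc d → Euc d → ℂ} {c : ℝ} (h : Adm κ c) (m : ι → ℝ) :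
    Measurable (Function.uncurry (KK κ m)) := by
  have h1 : Measurable (fun q : ι × ((Euc d × ℝ) × Euc d) => Kk κ (m q.1) q.2.1.1 q.2.1.2 q.2.2) := by
    apply measurable_from_prod_countable_right
    intro i
    exact Kk_meas h (m i)
  exact h1.comp (f := fun q : (((ι × Euc d) × ℝ) × Euc d) => (q.1.1.1, ((q.1.1.2, q.1.2), q.2))) (by fun_prop)

lemma KK_H0_zero {d : ℕ} [NeZero d] {κ : Euc d → Euc d → ℂ} {c : ℝ} (h : Adm κ c) (m : ι → ℝ)
    (hm : ∀ i, 0 < m i) (R : ℝ) (C1 : ℝ≥0) (hC : kC d c ≤ C1) (x : ι × Euc d) (f : Euc d → ℂ) (hf : BdM f)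
    (A : Euc d → ℝ≥0∞) (V : ℝ → ℝ≥0∞) (hV : Measurable V) (hfA : ∀ y, ‖f y‖ₑ ≤ A y ^ (0:ℝ)) :
    ∫⁻ z in Icc (1:ℝ) 2, V z ^ (1 - 0 : ℝ) * ‖opT (KK κ m) (volume.restrict (ball 0 R)) f (x, z)‖ₑ ≤
      C1 * (∫⁻ y in ball 0 R, A y) ^ (0:ℝ) * (∫⁻ z in Icc (1:ℝ) 2, V z) ^ (1 - 0 : ℝ) := by
  simp only [sub_zero, ENNReal.rpow_one, ENNReal.rpow_zero, mul_one] at hfA ⊢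
  rw [← lintegral_const_mul _ hV]
  apply lintegral_mono; intro z
  beta_reduce
  rw [mul_comm]
  apply mul_le_mul_left
  refine (opT_enorm _ _ _ _).trans (le_trans ?_ hC)
  calc _ ≤ ∫⁻ y in ball 0 R, ‖KK κ m (x, z) y‖ₑ := by
        apply lintegral_mono; intro y
        exact mul_le_of_le_one_right' (hfA y)
    _ ≤ ∫⁻ y, ‖KK κ m (x, z) y‖ₑ := setLIntegral_le_lintegral _ _
    _ ≤ _ := Kk_int_y h _ (hm _) _ _

lemma KK_H0_one {d : ℕ} [NeZero d] {κ : Euc d → Euc d → ℂ} {c : ℝ} (h : Adm κ c) (m : ι → ℝ)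
    (hm : ∀ i, 0 < m i) (R : ℝ) (C1 : ℝ≥0) (hC : (cS d)⁻¹ * kC d c ≤ C1) (x : ι × Euc d) (f : Euc d → ℂ) (hf : BdM f)
    (A : Euc d → ℝ≥0∞) (hA : Measurable A) (V : ℝ → ℝ≥0∞) (hfA : ∀ y, ‖f y‖ₑ ≤ A y ^ (1:ℝ)) :
    ∫⁻ z in Icc (1:ℝ) 2, V z ^ (1 - 1 : ℝ) * ‖opT (KK κ m) (volume.restrict (ball 0 R)) f (x, z)‖ₑ ≤
      C1 * (∫⁻ y in ball 0 R, A y) ^ (1:ℝ) * (∫⁻ z in Icc (1:ℝ) 2, V z) ^ (1 - 1 : ℝ) := by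
  simp only [sub_self, ENNReal.rpow_one, ENNReal.rpow_zero, mul_one, one_mul] at hfA ⊢
  have hK := KK_meas h m
  have hK2 : Measurable (fun q : ℝ × Euc d => ‖KK κ m (x, q.1) q.2‖ₑ * ‖f q.2‖ₑ) :=
    (hK.comp (f := fun q : ℝ × Euc d => ((x, q.1), q.2)) (by fun_prop)).enorm.mul
          (hf.1.comp measurable_snd).enorm
  have s1 : ∫⁻ z in Icc (1:ℝ) 2, ‖opT (KK κ m) (volume.restrict (ball 0 R)) f (x, z)‖ₑ ≤
      ∫⁻ z in Icc (1:ℝ) 2, ∫⁻ y in ball 0 R, ‖KK κ m (x, z) y‖ₑ * ‖f y‖ₑ :=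
    lintegral_mono fun z => opT_enorm _ _ _ _
  have s2 : ∫⁻ z in Icc (1:ℝ) 2, ∫⁻ y in ball 0 R, ‖KK κ m (x, z) y‖ₑ * ‖f y‖ₑ =
      ∫⁻ y in ball 0 R, ∫⁻ z in Icc (1:ℝ) 2, ‖KK κ m (x, z) y‖ₑ * ‖f y‖ₑ :=
    lintegral_lintegral_swap hK2.aemeasurable
  have s3 : ∀ y, ∫⁻ z in Icc (1:ℝ) 2, ‖KK κ m (x, z) y‖ₑ * ‖f y‖ₑ ≤ C1 * A y := by
    intro y
    rw [lintegral_mul_const' _ _ (by simp)]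
    have := (Kk_int_t h (m x.1) (hm x.1) x.2 y).trans hC
    exact mul_le_mul' this (hfA y)
  rw [← lintegral_const_mul _ hA]
  exact (s1.trans_eq s2).trans (lintegral_mono s3)
end multi

instance finBall {d : ℕ} (R : ℝ) : IsFiniteMeasure (volume.restrict (ball (0 : Euc d) R)) :=
  ⟨by rw [Measure.restrict_apply_univ]; exact measure_ball_lt_top⟩

/-- Littlewood-Paley kernel -/
def psi (d : ℕ) : SchwartzMap (Euc d) ℂ := 𝓕⁻ (bAS d)

lemma psi_apply {d : ℕ} (u : Euc d) : psi d u = 𝓕⁻ (fun x => bAS d x) u := by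
  unfold psi
  rw [SchwartzMap.fourierInv_coe]

def kap0 {d : ℕ} (_ u : Euc d) : ℂ := psi d u
def kap1 {d : ℕ} (ω u : Euc d) : ℂ := - fderiv ℝ (psi d) u ω

lemma psi_diff {d : ℕ} : Differentiable ℝ (psi d) := (psi d).differentiable

lemma psi_fderiv_cont {d : ℕ} : Continuous (fderiv ℝ (psi d)) :=
  ((psi d).smooth 1).continuous_fderiv (by norm_num)

lemma adm0 (d : ℕ) : ∃ c, Adm (kap0 (d := d)) c := by
  obtain ⟨c, hc, h⟩ := schwartz_bound (psi d) (d+1)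
  refine ⟨c, ?_, hc, fun _ u _ => h u⟩
  exact (psi d).continuous.comp continuous_snd

lemma adm1 (d : ℕ) : ∃ c, Adm (kap1 (d := d)) c := by
  have h := fun u => SchwartzMap.one_add_le_sup_seminorm_apply (𝕜 := ℝ) (m := (d+1, 1))
    (k := d+1) (n := 1) le_rfl le_rfl (psi d) u
  simp only [norm_iteratedFDeriv_one] at h
  generalize (2:ℝ) ^ (d+1, 1).1 * ((Finset.Iic (d+1, 1)).sup fun m => SchwartzMap.seminorm ℝ m.1 m.2) (psi d) = C
    at h
  refine ⟨C, ?_, le_trans (by positivity) (h 0), fun ω u hω => ?_⟩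
  · have := psi_fderiv_cont (d := d)
    unfold kap1
    exact ((this.comp continuous_snd).clm_apply continuous_fst).neg
  · rw [← div_eq_mul_inv, le_div_iff₀ (by positivity), mul_comm]
    refine le_trans ?_ (h u)
    gcongr
    unfold kap1
    rw [norm_neg]
    refine (ContinuousLinearMap.le_opNorm _ _).trans ?_
    rw [hω, mul_one]

/-- frequency piece -/
def Um {d : ℕ} (R m : ℝ) (f : Euc d → ℂ) (ξ : Euc d) : ℂ :=
  bAS d (m⁻¹ • ξ) * 𝓕 ((ball (0 : Euc d) R).indicator f) ξ

lemma bAS_supp {d : ℕ} : HasCompactSupport (fun x => bAS d x) :=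
  (HasCompactSupport.comp_left (g := fun x : ℝ => (x : ℂ))
      (bB_supp.sub (bB_supp.comp_smul (by norm_num))) (by simp))

lemma ind_int {d : ℕ} (R : ℝ) {f : Euc d → ℂ} (hf : BdM f) : Integrable ((ball (0 : Euc d) R).indicator f) := by
  obtain ⟨hm, M, hM⟩ := hf
  rw [integrable_indicator_iff measurableSet_ball]
  exact Measure.integrableOn_of_bounded (M := M) measure_ball_lt_top.ne hm.aestronglyMeasurable
    (Filter.Eventually.of_forall hM)

lemma Um_cont {d : ℕ} (R m : ℝ) {f : Euc d → ℂ} (hf : BdM f) : Continuous (Um R m f) := by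
  unfold Um
  exact ((bAS d).continuous.comp (by fun_prop)).mul (continuous_fourier (ind_int R hf))

lemma Um_supp {d : ℕ} (R m : ℝ) (hm : 0 < m) (f : Euc d → ℂ) : HasCompactSupport (Um R m f) := by
  unfold Um
  exact HasCompactSupport.mul_right (bAS_supp.comp_smul (inv_ne_zero hm.ne'))

lemma fInv_scale {d : ℕ} (χ : Euc d → ℂ) (m : ℝ) (hm : 0 < m) (v : Euc d) :
    𝓕⁻ (fun ξ => χ (m⁻¹ • ξ)) v = (m ^ d : ℝ) * 𝓕⁻ χ (m • v) := by
  rw [Real.fourierInv_eq_fourier_neg, Real.fourierInv_eq_fourier_neg, fourier_scale χ m hm, smul_neg]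

lemma fInv_Um {d : ℕ} (R m : ℝ) (hm : 0 < m) {f : Euc d → ℂ} (hf : BdM f) (u : Euc d) :
    𝓕⁻ (Um R m f) u = ∫ y in ball 0 R, ((m ^ d : ℝ) : ℂ) * psi d (m • (u - y)) * f y := by
  rw [fInv_ee]
  obtain ⟨hfm, M, hM⟩ := id hf
  have e1 : ∀ ξ, ee (inner ℝ ξ u) * Um R m f ξ =
      ∫ y in ball 0 R, ee (inner ℝ ξ u) * (bAS d (m⁻¹ • ξ) * (ee (-(inner ℝ y ξ)) * f y)) := by
    intro ξ
    unfold Um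
    rw [Real.fourier_eq, integral_const_mul, integral_const_mul, ← integral_indicator measurableSet_ball]
    congr 3; ext y
    rw [ee_smul]
    by_cases hy : y ∈ ball (0 : Euc d) R
    · rw [indicator_of_mem hy, indicator_of_mem hy]
    · rw [indicator_of_notMem hy, indicator_of_notMem hy, mul_zero]
  simp only [e1]
  rw [integral_integral_swap]
  · congr 1; ext y
    rw [psi_apply, ← fInv_scale _ m hm, fInv_ee, ← integral_mul_const]
    congr 1; ext ξ
    rw [inner_sub_right, sub_eq_add_neg, ee_add, real_inner_comm y ξ]
    ring
  · have hb : Integrable (fun ξ : Euc d => bAS d (m⁻¹ • ξ)) := by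
      apply Continuous.integrable_of_hasCompactSupport
      · exact (bAS d).continuous.comp (by fun_prop)
      · exact bAS_supp.comp_smul (inv_ne_zero hm.ne')
    have := (hb.mul_const (M : ℂ)).comp_fst (volume.restrict (ball (0 : Euc d) R))
    refine this.mono ?_ ?_
    · apply Measurable.aestronglyMeasurable
      have c1 := continuous_ee.measurable
      have c2 := (bAS d).continuous.measurable
      have c3 : Measurable fun q : Euc d × Euc d => ee (inner ℝ q.1 u) := c1.comp (by fun_prop)
      have c4 : Measurable fun q : Euc d × Euc d => ee (-inner ℝ q.2 q.1) := c1.comp (by fun_prop)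
      have c5 : Measurable fun q : Euc d × Euc d => bAS d (m⁻¹ • q.1) := c2.comp (by fun_prop)
      exact c3.mul (c5.mul (c4.mul (hfm.comp measurable_snd)))
    · refine Filter.Eventually.of_forall fun q => ?_
      simp only [Function.uncurry, norm_mul, norm_ee, one_mul, Complex.norm_real]
      gcongr
      exact (hM _).trans (le_abs_self _)

lemma ident0 {d : ℕ} [NeZero d] (R m : ℝ) (hm : 0 < m) {f : Euc d → ℂ} (hf : BdM f) (x : Euc d) (t : ℝ) :
    ∫ y in ball 0 R, Kk kap0 m x t y * f y = sphAvg (𝓕⁻ (Um R m f)) t x := by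
  unfold sphAvg Kk
  obtain ⟨hfm, M, hM⟩ := id hf
  obtain ⟨c, hc⟩ := adm0 d
  have hc2 : ∀ u, ‖psi d u‖ ≤ c := fun u => by
    obtain ⟨ω, hω⟩ := exists_norm_eq (E := Euc d) (c := 1) (by norm_num)
    exact hc.le ω u hω
  simp only [fInv_Um R m hm hf, ← integral_mul_const]
  rw [swap_bdd (M := m ^ d * c * M)]
  · rfl
  · apply Measurable.mul
    · apply Measurable.const_mul
      exact (psi d).continuous.measurable.comp (by fun_prop)
    · exact hfm.comp measurable_fst
  · intro y ω
    rw [norm_mul, norm_mul, Complex.norm_real, Real.norm_of_nonneg (by positivity)]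
    have := hc.2.1
    gcongr
    · exact hc2 _
    · exact hM y

lemma Kk_deriv {d : ℕ} [NeZero d] (m : ℝ) (hm : 0 < m) (x y : Euc d) (t : ℝ) :
    HasDerivAt (fun t => Kk kap0 m x t y) (m * Kk kap1 m x t y) t := by
  obtain ⟨c, hc⟩ := adm0 d
  obtain ⟨c1, hc1⟩ := adm1 d
  have hk1 : ∀ t : ℝ, Continuous fun ω : Euc d => kap1 ω (m • (x - t • ω - y)) := fun t =>
    hc1.1.comp (f := fun ω : Euc d => (ω, m • (x - t • ω - y))) (by fun_prop)
  have hk0 : ∀ t : ℝ, Continuous fun ω : Euc d => kap0 ω (m • (x - t • ω - y)) := fun t =>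
    hc.1.comp (f := fun ω : Euc d => (ω, m • (x - t • ω - y))) (by fun_prop)
  unfold Kk
  rw [← integral_const_mul]
  have := hasDerivAt_integral_of_dominated_loc_of_deriv_le (μ := sphereMeasure d) (𝕜 := ℝ) (E := ℂ)
    (F := fun t ω => ((m ^ d : ℝ) : ℂ) * kap0 ω (m • (x - t • ω - y)))
    (F' := fun t ω => (m:ℂ) * (((m ^ d : ℝ) : ℂ) * kap1 ω (m • (x - t • ω - y))))
    (x₀ := t) (s := univ) (bound := fun ω => m * (m ^ d * c1)) Filter.univ_mem ?_ ?_ ?_ ?_ ?_ ?_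
  · exact this.2
  · exact Filter.Eventually.of_forall fun s => (continuous_const.mul (hk0 s)).aestronglyMeasurable
  · exact integrable_sphere (continuous_const.mul (hk0 t))
  · exact (continuous_const.mul (continuous_const.mul (hk1 t))).aestronglyMeasurable
  · filter_upwards [sphere_ae_norm] with ω hω s _
    rw [norm_mul, norm_mul, Complex.norm_real, Complex.norm_real, Real.norm_of_nonneg (by positivity),
      Real.norm_of_nonneg (by positivity)]
    gcongr
    exact hc1.le _ _ hω
  · exact integrable_const _
  · refine Filter.Eventually.of_forall fun ω s _ => ?_
    have h1 : HasDerivAt (fun s : ℝ => m • (x - s • ω - y)) (m • (0 - (1:ℝ) • ω - 0)) s :=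
      ((((hasDerivAt_const s x).sub ((hasDerivAt_id s).smul_const ω)).sub (hasDerivAt_const s y)).const_smul m)
    have h2 := ((psi_diff (d := d) (m • (x - s • ω - y))).hasFDerivAt.comp_hasDerivAt s h1).const_mul ((m ^ d : ℝ) : ℂ)
    refine h2.congr_deriv ?_
    unfold kap1
    simp
    ring

lemma opT_deriv {d : ℕ} [NeZero d] (R m : ℝ) (hm : 0 < m) {f : Euc d → ℂ} (hf : BdM f) (x : Euc d) (t : ℝ) :
    HasDerivAt (fun t => sphAvg (𝓕⁻ (Um R m f)) t x) (m * ∫ y in ball 0 R, Kk kap1 m x t y * f y) t := by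
  simp only [← ident0 R m hm hf]
  obtain ⟨hfm, M, hM⟩ := id hf
  obtain ⟨c, hc⟩ := adm0 d
  obtain ⟨c1, hc1⟩ := adm1 d
  rw [← integral_const_mul]
  have k0 : ∀ t, Measurable fun y => Kk kap0 m x t y * f y := fun t =>
    ((Kk_meas hc m).comp (f := fun y => ((x,t),y)) (by fun_prop)).mul hfm
  have k1 : ∀ t, Measurable fun y => (m:ℂ) * (Kk kap1 m x t y * f y) := fun t =>
    (((Kk_meas hc1 m).comp (f := fun y => ((x,t),y)) (by fun_prop)).mul hfm).const_mul _
  have := hasDerivAt_integral_of_dominated_loc_of_deriv_le (μ := volume.restrict (ball (0 : Euc d) R)) (𝕜 := ℝ) (E := ℂ)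
    (F := fun t y => Kk kap0 m x t y * f y)
    (F' := fun t y => (m:ℂ) * (Kk kap1 m x t y * f y))
    (x₀ := t) (s := univ) (bound := fun ω => m * (m ^ d * c1 * M)) Filter.univ_mem ?_ ?_ ?_ ?_ ?_ ?_
  · exact this.2
  · exact Filter.Eventually.of_forall fun s => (k0 s).aestronglyMeasurable
  · refine Integrable.of_bound (k0 t).aestronglyMeasurable (m ^ d * c * M) ?_
    refine Filter.Eventually.of_forall fun y => ?_
    rw [norm_mul]
    have := hc.2.1
    gcongr
    · exact Kk_bound hc m hm _ _ _
    · exact hM y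
  · exact (k1 t).aestronglyMeasurable
  · refine Filter.Eventually.of_forall fun y s _ => ?_
    rw [norm_mul, norm_mul, Complex.norm_real, Real.norm_of_nonneg (by positivity)]
    have := hc1.2.1
    gcongr
    · exact Kk_bound hc1 m hm _ _ _
    · exact hM y
  · exact integrable_const _
  · refine Filter.Eventually.of_forall fun y s _ => ?_
    refine ((Kk_deriv m hm x y s).mul_const (f y)).congr_deriv ?_
    ring

lemma bAS_norm_le {d : ℕ} (x : Euc d) : ‖bAS d x‖ ≤ 1 := by
  rw [bAS_apply, Complex.norm_real, Real.norm_eq_abs, abs_le]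
  have := bB_nonneg x; have := bB_le_one x
  have := bB_nonneg ((2:ℝ) • x); have := bB_le_one ((2:ℝ) • x)
  constructor <;> linarith

lemma bAS_zero {d : ℕ} (x : Euc d) (h : ‖x‖ < 1/2 ∨ 2 < ‖x‖) : bAS d x = 0 := by
  rw [bAS_apply]
  rcases h with h | h
  · rw [bB_one (by linarith), bB_one (by rw [norm_smul]; norm_num; linarith)]; simp
  · rw [bB_zero (by nlinarith), bB_zero (by rw [norm_smul]; norm_num; nlinarith)]; simp

lemma bAS_scale_zero {d : ℕ} (m : ℝ) (hm : 0 < m) (ξ : Euc d) (h : ‖ξ‖ < m/2 ∨ 2 * m < ‖ξ‖) :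
    bAS d (m⁻¹ • ξ) = 0 := by
  apply bAS_zero
  rw [norm_smul, norm_inv, Real.norm_of_nonneg hm.le]
  rcases h with h | h
  · left; rw [inv_mul_lt_iff₀ hm]; linarith
  · right; rw [lt_inv_mul_iff₀ hm]; linarith

lemma Um_zero {d : ℕ} (R m : ℝ) (hm : 0 < m) (f : Euc d → ℂ) (ξ : Euc d) (h : ‖ξ‖ < m/2 ∨ 2 * m < ‖ξ‖) :
    Um R m f ξ = 0 := by
  unfold Um; rw [bAS_scale_zero m hm ξ h, zero_mul]

lemma Um_weight {d : ℕ} (R m : ℝ) (hm : 0 < m) (f : Euc d → ℂ) (ξ : Euc d) (a : ℝ) (ha : 0 ≤ a) :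
    ENNReal.ofReal (‖ξ‖ ^ (-a)) * ‖Um R m f ξ‖ₑ ^ (2:ℝ) ≤
      ENNReal.ofReal ((m/2) ^ (-a)) * ‖Um R m f ξ‖ₑ ^ (2:ℝ) := by
  by_cases h : ‖ξ‖ < m / 2
  · rw [Um_zero R m hm f ξ (Or.inl h)]; simp
  · refine mul_le_mul' (ENNReal.ofReal_le_ofReal ?_) le_rfl
    exact Real.rpow_le_rpow_of_nonpos (by positivity) (not_lt.1 h) (by linarith)

lemma Um_weight2 {d : ℕ} (R m : ℝ) (hm : 0 < m) (f : Euc d → ℂ) (ξ : Euc d) (a : ℝ) (ha : 0 ≤ a) :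
    ENNReal.ofReal (m⁻¹ ^ 2) * (ENNReal.ofReal (‖ξ‖ ^ 2) * ENNReal.ofReal (‖ξ‖ ^ (-a)) * ‖Um R m f ξ‖ₑ ^ (2:ℝ)) ≤
      4 * (ENNReal.ofReal ((m/2) ^ (-a)) * ‖Um R m f ξ‖ₑ ^ (2:ℝ)) := by
  by_cases h : 2 * m < ‖ξ‖
  · rw [Um_zero R m hm f ξ (Or.inr h)]; simp
  · rw [mul_assoc, ← mul_assoc]
    refine mul_le_mul' ?_ (Um_weight R m hm f ξ a ha)
    rw [← ENNReal.ofReal_mul (by positivity), show (4:ℝ≥0∞) = ENNReal.ofReal 4 by simp]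
    apply ENNReal.ofReal_le_ofReal
    rw [inv_pow, inv_mul_le_iff₀ (by positivity)]
    have := norm_nonneg ξ
    nlinarith

lemma rpow_scale_pull {X : Type*} [MeasurableSpace X] (μ : Measure X) (c : ℝ≥0∞) (hc : c ≠ ⊤) (r : ℝ) (hr : 0 ≤ r)
    (I : X → ℝ≥0∞) (B : ℝ≥0∞) (h : ∫⁻ x, I x ^ r ∂μ ≤ B ^ r) : ∫⁻ x, (c * I x) ^ r ∂μ ≤ (c * B) ^ r := by
  simp only [ENNReal.mul_rpow_of_nonneg _ _ hr]
  rw [lintegral_const_mul' _ _ (ENNReal.rpow_ne_top_of_nonneg hr hc)]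
  gcongr

/-- single scale L2 estimate -/
lemma H1_single (d : ℕ) (hd : 2 ≤ d) [NeZero d] (q : ℝ) (hq : 2 * ((d:ℝ)+1) / ((d:ℝ)-1) < q) :
    ∃ C : ℝ≥0, ∀ κ : Euc d → Euc d → ℂ, (κ = kap0 ∨ κ = kap1) → ∀ (m : ℝ), 0 < m → ∀ R : ℝ, ∀ f : Euc d → ℂ, BdM f →
      ENNReal.ofReal (m ^ d) * ∫⁻ x, (∫⁻ t in Icc (1:ℝ) 2, ‖∫ y in ball 0 R, Kk κ m x t y * f y‖ₑ ^ (2:ℝ)) ^ (q/2) ≤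
        (C * ∫⁻ ξ, ‖Um R m f ξ‖ₑ ^ (2:ℝ)) ^ (q/2) := by
  have hd1 : (0:ℝ) < (d:ℝ) - 1 := by
    have : (2:ℝ) ≤ d := by exact_mod_cast hd
    linarith
  have hq0 : 0 < q := by
    refine lt_trans ?_ hq
    positivity
  obtain ⟨C, hC⟩ := lemS d hd q hq
  set b : ℝ≥0 := ((1/2:ℝ) ^ (-(2*(d:ℝ)/q))).toNNReal
  refine ⟨4 * C * b, fun κ hκ m hm R f hf => ?_⟩
  have hU := Um_cont R m hf
  have hUs := Um_supp R m hm f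
  obtain ⟨h0, h1⟩ := hC _ hU hUs
  have ha : 0 ≤ 2 * (d:ℝ) / q := by positivity
  set a := 2 * (d:ℝ) / q with haa
  have main : ∫⁻ x, (∫⁻ t in Icc (1:ℝ) 2, ‖∫ y in ball 0 R, Kk κ m x t y * f y‖ₑ ^ (2:ℝ)) ^ (q/2) ≤
      (4 * C * (ENNReal.ofReal ((m/2) ^ (-a)) * ∫⁻ ξ, ‖Um R m f ξ‖ₑ ^ (2:ℝ))) ^ (q/2) := by
    rcases hκ with rfl | rfl
    · simp only [ident0 R m hm hf]
      refine h0.trans (ENNReal.rpow_le_rpow ?_ (by positivity))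
      rw [← lintegral_const_mul' _ _ ENNReal.ofReal_ne_top, mul_assoc 4]
      refine le_trans ?_ (le_mul_of_one_le_left (zero_le) (by norm_num))
      exact mul_le_mul_right (lintegral_mono fun ξ => Um_weight R m hm f ξ a ha) _
    · have e : ∀ x t, ∫ y in ball 0 R, Kk kap1 m x t y * f y =
          (m:ℂ)⁻¹ * deriv (fun t => sphAvg (𝓕⁻ (Um R m f)) t x) t := by
        intro x t
        rw [(opT_deriv R m hm hf x t).deriv, inv_mul_cancel_left₀]
        exact_mod_cast hm.ne'
      have e2 : ∀ x, ∫⁻ t in Icc (1:ℝ) 2, ‖∫ y in ball 0 R, Kk kap1 m x t y * f y‖ₑ ^ (2:ℝ) =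
          ENNReal.ofReal (m⁻¹ ^ 2) * ∫⁻ t in Icc (1:ℝ) 2, ‖deriv (fun t => sphAvg (𝓕⁻ (Um R m f)) t x) t‖ₑ ^ (2:ℝ) := by
        intro x
        rw [← lintegral_const_mul' _ _ ENNReal.ofReal_ne_top]
        congr 1; ext t
        rw [e]
        simp only [enorm_sq]
        rw [← ENNReal.ofReal_mul (by positivity), norm_mul, mul_pow, norm_inv, Complex.norm_real,
          Real.norm_of_nonneg hm.le]
      simp only [e2]
      refine (rpow_scale_pull _ _ ENNReal.ofReal_ne_top _ (by positivity) _ _ h1).trans ?_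
      refine ENNReal.rpow_le_rpow ?_ (by positivity)
      rw [mul_left_comm, mul_comm 4, mul_assoc (C:ℝ≥0∞), ← lintegral_const_mul' _ _ ENNReal.ofReal_ne_top,
        ← lintegral_const_mul' (ENNReal.ofReal _) _ ENNReal.ofReal_ne_top, ← lintegral_const_mul' 4 _ (by norm_num)]
      exact mul_le_mul_right (lintegral_mono fun ξ => Um_weight2 R m hm f ξ a ha) _
  calc _ ≤ ENNReal.ofReal (m ^ d) * (4 * C * (ENNReal.ofReal ((m/2) ^ (-a)) * ∫⁻ ξ, ‖Um R m f ξ‖ₑ ^ (2:ℝ))) ^ (q/2) := by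
        gcongr
    _ = (ENNReal.ofReal (m ^ d) ^ (2/q) * (4 * C * (ENNReal.ofReal ((m/2) ^ (-a)) * ∫⁻ ξ, ‖Um R m f ξ‖ₑ ^ (2:ℝ)))) ^ (q/2) := by
        rw [ENNReal.mul_rpow_of_nonneg (ENNReal.ofReal (m ^ d) ^ (2/q)) _ (by positivity), ← ENNReal.rpow_mul,
          div_mul_div_cancel₀ (by positivity)]
        norm_num
    _ ≤ _ := by
        refine ENNReal.rpow_le_rpow ?_ (by positivity)
        have e3 : ENNReal.ofReal (m ^ d) ^ (2/q) * ENNReal.ofReal ((m/2) ^ (-a)) = b := by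
          rw [ENNReal.ofReal_rpow_of_nonneg (by positivity) (by positivity), ← ENNReal.ofReal_mul (by positivity)]
          change _ = ENNReal.ofReal _
          congr 1
          rw [div_eq_mul_one_div m, Real.mul_rpow hm.le (by norm_num), ← Real.rpow_natCast, ← Real.rpow_mul hm.le,
            ← mul_assoc, ← Real.rpow_add hm]
          rw [show (d:ℝ) * (2/q) + -a = 0 by rw [haa]; ring, Real.rpow_zero, one_mul]
        refine le_of_eq ?_
        rw [← mul_assoc, ← mul_assoc, mul_right_comm, mul_comm (ENNReal.ofReal _ ^ _), mul_assoc (4 * (C:ℝ≥0∞)), mul_assoc (4 * (C:ℝ≥0∞))]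
        push_cast
        rw [← e3]; ring

lemma sum_rpow_le {ι : Type*} (s : Finset ι) (a : ι → ℝ≥0∞) (r : ℝ) (hr : 1 ≤ r) :
    ∑ i ∈ s, a i ^ r ≤ (∑ i ∈ s, a i) ^ r := by
  classical
  induction s using Finset.induction_on with
  | empty => simp
  | insert i s hi ih =>
    rw [Finset.sum_insert hi, Finset.sum_insert hi]
    refine le_trans ?_ (ENNReal.add_rpow_le_rpow_add _ _ hr)
    gcongr

lemma overlap {d : ℕ} (S : Finset ℤ) (ξ : Euc d) :
    ∑ j ∈ S, ‖bAS d (((2:ℝ) ^ j)⁻¹ • ξ)‖ₑ ^ (2:ℝ) ≤ 5 := by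
  classical
  set T := S.filter (fun j => (2:ℝ)^j/2 ≤ ‖ξ‖ ∧ ‖ξ‖ ≤ 2 * (2:ℝ)^j) with hT
  have h1 : ∑ j ∈ S, ‖bAS d (((2:ℝ) ^ j)⁻¹ • ξ)‖ₑ ^ (2:ℝ) = ∑ j ∈ T, ‖bAS d (((2:ℝ) ^ j)⁻¹ • ξ)‖ₑ ^ (2:ℝ) := by
    symm
    apply Finset.sum_subset (Finset.filter_subset _ _)
    intro j hj hjT
    rw [bAS_scale_zero _ (by positivity)]; · simp
    by_contra hh
    push Not at hh
    exact hjT (Finset.mem_filter.2 ⟨hj, hh⟩)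
  have h2 : T.card ≤ 5 := by
    rcases T.eq_empty_or_nonempty with h | ⟨j0, hj0⟩
    · simp [h]
    · have : T ⊆ Finset.Icc (j0 - 2) (j0 + 2) := by
        intro j hj
        have a1 := (Finset.mem_filter.1 hj).2
        have a2 := (Finset.mem_filter.1 hj0).2
        have b1 : (2:ℝ)^j ≤ (2:ℝ)^(j0+2) := by
          rw [zpow_add₀ (by norm_num)]; norm_num; linarith
        have b2 : (2:ℝ)^j0 ≤ (2:ℝ)^(j+2) := by
          rw [zpow_add₀ (by norm_num)]; norm_num; linarith
        rw [zpow_le_zpow_iff_right₀ (by norm_num)] at b1 b2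
        rw [Finset.mem_Icc]; omega
      refine (Finset.card_le_card this).trans ?_
      rw [Int.card_Icc]; omega
  rw [h1]
  calc _ ≤ ∑ j ∈ T, (1:ℝ≥0∞) := by
        apply Finset.sum_le_sum; intro j _
        rw [enorm_sq]
        rw [← ENNReal.ofReal_one]
        apply ENNReal.ofReal_le_ofReal
        exact pow_le_one₀ (norm_nonneg _) (bAS_norm_le _)
    _ ≤ 5 := by simp; exact_mod_cast h2

lemma Um_sum {d : ℕ} (S : Finset ℤ) (R : ℝ) {f : Euc d → ℂ} (hf : BdM f) :
    ∑ j ∈ S, ∫⁻ ξ, ‖Um R ((2:ℝ)^j) f ξ‖ₑ ^ (2:ℝ) ≤ 5 * ∫⁻ y in ball 0 R, ‖f y‖ₑ ^ (2:ℝ) := by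
  obtain ⟨hfm, M, hM⟩ := id hf
  have hi := ind_int R hf
  have h2 := memLp2_of_bdd hi M (fun y => (norm_indicator_le_norm_self _ _).trans (hM y))
  have e : ∫⁻ y in ball 0 R, ‖f y‖ₑ ^ (2:ℝ) = ∫⁻ ξ, ‖𝓕 ((ball (0 : Euc d) R).indicator f) ξ‖ₑ ^ (2:ℝ) := by
    rw [plancherel hi h2, ← lintegral_indicator measurableSet_ball]
    congr 1; ext y
    by_cases hy : y ∈ ball (0 : Euc d) R
    · rw [indicator_of_mem hy, indicator_of_mem hy]
    · rw [indicator_of_notMem hy, indicator_of_notMem hy]; simp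
  rw [e, ← lintegral_const_mul' _ _ (by norm_num), ← lintegral_finsetSum]
  · apply lintegral_mono; intro ξ
    beta_reduce
    unfold Um
    simp only [enorm_mul, ENNReal.mul_rpow_of_nonneg _ _ (show (0:ℝ) ≤ 2 by norm_num)]
    rw [← Finset.sum_mul]
    gcongr
    exact overlap S ξ
  · intro j _
    exact (Um_cont R _ hf).measurable.enorm.pow_const _

/-- multi scale L2 estimate -/
lemma H1_multi (d : ℕ) (hd : 2 ≤ d) [NeZero d] (q : ℝ) (hq : 2 * ((d:ℝ)+1) / ((d:ℝ)-1) < q) :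
    ∃ C : ℝ≥0, ∀ κ : Euc d → Euc d → ℂ, (κ = kap0 ∨ κ = kap1) → ∀ (S : Finset ℤ), ∀ R : ℝ, ∀ f : Euc d → ℂ, BdM f →
      ∑ j ∈ S, ENNReal.ofReal (((2:ℝ)^j) ^ d) * ∫⁻ x, (∫⁻ t in Icc (1:ℝ) 2, ‖∫ y in ball 0 R, Kk κ ((2:ℝ)^j) x t y * f y‖ₑ ^ (2:ℝ)) ^ (q/2) ≤
        (C * (∫⁻ y in ball 0 R, ‖f y‖ₑ ^ (2:ℝ)) ^ (1/2:ℝ)) ^ q := by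
  have hd1 : (0:ℝ) < (d:ℝ) - 1 := by
    have : (2:ℝ) ≤ d := by exact_mod_cast hd
    linarith
  have hq2 : 2 < q := by
    refine lt_trans ?_ hq
    rw [lt_div_iff₀ hd1]; linarith
  obtain ⟨C, hC⟩ := H1_single d hd q hq
  refine ⟨(C * 5) ^ (1/2:ℝ), fun κ hκ S R f hf => ?_⟩
  calc _ ≤ ∑ j ∈ S, (C * ∫⁻ ξ, ‖Um R ((2:ℝ)^j) f ξ‖ₑ ^ (2:ℝ)) ^ (q/2) :=
        Finset.sum_le_sum fun j _ => hC κ hκ _ (by positivity) R f hf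
    _ ≤ (∑ j ∈ S, C * ∫⁻ ξ, ‖Um R ((2:ℝ)^j) f ξ‖ₑ ^ (2:ℝ)) ^ (q/2) := sum_rpow_le _ _ _ (by linarith)
    _ ≤ (C * (5 * ∫⁻ y in ball 0 R, ‖f y‖ₑ ^ (2:ℝ))) ^ (q/2) := by
        refine ENNReal.rpow_le_rpow ?_ (by linarith)
        rw [← Finset.mul_sum]
        gcongr
        exact Um_sum S R hf
    _ = _ := by
        rw [ENNReal.coe_rpow_of_nonneg _ (by norm_num), ← ENNReal.mul_rpow_of_nonneg _ _ (by norm_num), ← ENNReal.rpow_mul,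
          ← mul_assoc]
        push_cast
        congr 1; ring

def Tk {d : ℕ} (κ : Euc d → Euc d → ℂ) (m R : ℝ) (f : Euc d → ℂ) (x : Euc d) (t : ℝ) : ℂ :=
  ∫ y in ball 0 R, Kk κ m x t y * f y

lemma adm_kap (d : ℕ) : ∃ c, ∀ κ : Euc d → Euc d → ℂ, (κ = kap0 ∨ κ = kap1) → Adm κ c := by
  obtain ⟨c0, h0⟩ := adm0 d
  obtain ⟨c1, h1⟩ := adm1 d
  refine ⟨max c0 c1, ?_⟩
  rintro κ (rfl | rfl)
  · refine ⟨h0.1, le_max_of_le_left h0.2.1, fun ω u hω => (h0.2.2 ω u hω).trans ?_⟩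
    gcongr; exact le_max_left _ _
  · refine ⟨h1.1, le_max_of_le_left h0.2.1, fun ω u hω => (h1.2.2 ω u hω).trans ?_⟩
    gcongr; exact le_max_right _ _

lemma Tk_meas {d : ℕ} [NeZero d] {κ : Euc d → Euc d → ℂ} {c : ℝ} (h : Adm κ c) (m R : ℝ) {f : Euc d → ℂ}
    (hf : BdM f) : Measurable (fun w : Euc d × ℝ => Tk κ m R f w.1 w.2) := by
  have := measurable_opT (l := volume.restrict (ball (0 : Euc d) R)) (K := fun w : Euc d × ℝ => Kk κ m w.1 w.2) (f := f)
    (Kk_meas h m) hf.1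
  exact this

lemma wt_lintegral {d : ℕ} {ι : Type*} [MeasurableSpace ι] [Fintype ι] [DiscreteMeasurableSpace ι]
    (c : ι → ℝ≥0∞) (ρ : Measure (Euc d)) [IsFiniteMeasure ρ] (F : ι × Euc d → ℝ≥0∞) (hF : Measurable F) :
    ∫⁻ w, F w ∂((∑ i, c i • Measure.dirac i).prod ρ) = ∑ i, c i * ∫⁻ x, F (i, x) ∂ρ := by
  rw [lintegral_prod _ hF.aemeasurable, lintegral_finsetSum_measure]
  simp [lintegral_smul_measure]

lemma K_core (d : ℕ) (hd : 2 ≤ d) [NeZero d] (α θ p q q1 : ℝ) (hα : α = 0 ∨ α = 1) (h0 : 0 ≤ θ) (h1 : θ ≤ 1)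
    (hp0 : 0 < p) (hq0 : 0 < q) (hq1 : 2 * ((d:ℝ)+1) / ((d:ℝ)-1) < q1)
    (hp : 1 / p = α + θ * (1 / 2 - α)) (hq : 1 / q = θ / q1) :
    ∃ C : ℝ≥0, ∀ κ : Euc d → Euc d → ℂ, (κ = kap0 ∨ κ = kap1) → ∀ (S : Finset ℤ), ∀ R : ℝ, ∀ f : Euc d → ℂ, BdM f →
      ∑ j ∈ S, ENNReal.ofReal (((2:ℝ)^j) ^ d) * ∫⁻ x, (∫⁻ t in Icc (1:ℝ) 2, ‖Tk κ ((2:ℝ)^j) R f x t‖ₑ ^ p) ^ (q/p) ≤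
        (C * (∫⁻ y in ball 0 R, ‖f y‖ₑ ^ p) ^ (1/p)) ^ q := by
  have hd1 : (0:ℝ) < (d:ℝ) - 1 := by
    have : (2:ℝ) ≤ d := by exact_mod_cast hd
    linarith
  have hq2 : 2 < q1 := by
    refine lt_trans ?_ hq1
    rw [lt_div_iff₀ hd1]; linarith
  obtain ⟨c, hc⟩ := adm_kap d
  obtain ⟨C2, hC2⟩ := H1_multi d hd q1 hq1
  set C1 : ℝ≥0 := (kC d c + (cS d)⁻¹ * kC d c).toNNReal
  have hC1 : (C1 : ℝ≥0∞) = kC d c + (cS d)⁻¹ * kC d c := by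
    apply ENNReal.coe_toNNReal
    exact ENNReal.add_ne_top.2 ⟨kC_ne_top _ _, ENNReal.mul_ne_top (ENNReal.inv_ne_top.2 cS_ne_zero) (kC_ne_top _ _)⟩
  refine ⟨C1 ^ (1 - θ) * C2 ^ θ, fun κ hκ S R f hf => ?_⟩
  have hA := hc κ hκ
  let m : ↥S → ℝ := fun i => (2:ℝ) ^ (i : ℤ)
  have hm : ∀ i, 0 < m i := fun i => by positivity
  letI : MeasurableSpace ↥S := ⊤
  haveI : DiscreteMeasurableSpace ↥S := ⟨fun _ => trivial⟩
  have hF : ∀ (f : Euc d → ℂ), BdM f → ∀ r s : ℝ, ∀ i : ↥S, Measurable fun x => (∫⁻ t in Icc (1:ℝ) 2, ‖Tk κ (m i) R f x t‖ₑ ^ r) ^ s := by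
    intro f hf r s i
    apply Measurable.pow_const
    apply Measurable.lintegral_prod_right' (f := fun w : Euc d × ℝ => ‖Tk κ (m i) R f w.1 w.2‖ₑ ^ r)
    exact (Tk_meas hA _ R hf).enorm.pow_const _
  have hF2 : ∀ (f : Euc d → ℂ), BdM f → ∀ r s : ℝ, Measurable fun x : ↥S × Euc d => (∫⁻ t in Icc (1:ℝ) 2, ‖Tk κ (m x.1) R f x.2 t‖ₑ ^ r) ^ s := by
    intro f hf r s
    apply measurable_from_prod_countable_right
    exact fun i => hF f hf r s i
  have eS : ∀ g : ℤ → ℝ≥0∞, ∑ i : ↥S, g i = ∑ j ∈ S, g j := fun g => Finset.sum_coe_sort S g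
  have key : ∀ R' : ℝ, ∑ j ∈ S, ENNReal.ofReal (((2:ℝ)^j) ^ d) * ∫⁻ x in ball 0 R', (∫⁻ t in Icc (1:ℝ) 2, ‖Tk κ ((2:ℝ)^j) R f x t‖ₑ ^ p) ^ (q/p) ≤
        ((C1 ^ (1 - θ) * C2 ^ θ : ℝ≥0) * (∫⁻ y in ball 0 R, ‖f y‖ₑ ^ p) ^ (1/p)) ^ q := by
    intro R'
    let ρ := volume.restrict (ball (0 : Euc d) R')
    let μ : Measure (↥S × Euc d) := (∑ i : ↥S, ENNReal.ofReal (m i ^ d) • Measure.dirac i).prod ρ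
    haveI : ∀ i : ↥S, IsFiniteMeasure (ENNReal.ofReal (m i ^ d) • Measure.dirac i : Measure ↥S) := fun i =>
      Measure.smul_finite _ ENNReal.ofReal_ne_top
    have bound : ∃ M, 0 ≤ M ∧ ∀ w y, ‖KK κ m w y‖ ≤ M := by
      refine ⟨∑ i, m i ^ d * c, Finset.sum_nonneg fun i _ => mul_nonneg (by have := hm i; positivity) hA.2.1, fun w y => ?_⟩
      refine (Kk_bound hA _ (hm w.1.1) w.1.2 w.2 y).trans ?_
      exact Finset.single_le_sum (f := fun i => m i ^ d * c) (fun i _ => mul_nonneg (by have := hm i; positivity) hA.2.1) (Finset.mem_univ _)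
    obtain ⟨M, hM0, hM⟩ := bound
    have := rt_main μ (volume.restrict (Icc (1:ℝ) 2)) (volume.restrict (ball (0 : Euc d) R)) (KK κ m) (KK_meas hA m) M hM0 hM
      α θ p q q1 (by rcases hα with rfl | rfl <;> norm_num) (by rcases hα with rfl | rfl <;> norm_num) h0 h1 hp0 hq0 (by linarith) hp hq C1 C2
      (by
        intro x f hf A V hA' hV hfA
        rcases hα with rfl | rfl
        · exact KK_H0_zero hA m hm R C1 (by rw [hC1]; exact le_self_add) x f hf A V hV hfA
        · exact KK_H0_one hA m hm R C1 (by rw [hC1]; exact le_add_self) x f hf A hA' V hfA)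
      (by
        intro f hf
        have e := wt_lintegral (fun i : ↥S => ENNReal.ofReal (m i ^ d)) ρ _ (hF2 f hf 2 (q1/2))
        refine le_trans (le_of_eq e) ?_
        refine le_trans ?_ (hC2 κ hκ S R f hf)
        rw [← eS]
        apply Finset.sum_le_sum; intro i _
        exact mul_le_mul_right (setLIntegral_le_lintegral _ _) _) f hf
    have e := wt_lintegral (fun i : ↥S => ENNReal.ofReal (m i ^ d)) ρ _ (hF2 f hf p (q/p))
    have h3 := le_trans (le_of_eq e.symm) this
    rw [← eS]
    refine h3.trans (le_of_eq ?_)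
    rw [ENNReal.coe_mul, ENNReal.coe_rpow_of_nonneg _ (by linarith), ENNReal.coe_rpow_of_nonneg _ h0]
  have e2 : ∀ ρ : Measure (Euc d), ∑ j ∈ S, ENNReal.ofReal (((2:ℝ)^j) ^ d) * ∫⁻ x, (∫⁻ t in Icc (1:ℝ) 2, ‖Tk κ ((2:ℝ)^j) R f x t‖ₑ ^ p) ^ (q/p) ∂ρ =
      ∫⁻ x, ∑ j ∈ S, ENNReal.ofReal (((2:ℝ)^j) ^ d) * (∫⁻ t in Icc (1:ℝ) 2, ‖Tk κ ((2:ℝ)^j) R f x t‖ₑ ^ p) ^ (q/p) ∂ρ := by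
    intro ρ
    rw [lintegral_finsetSum]
    · apply Finset.sum_congr rfl; intro j hj
      rw [lintegral_const_mul' _ _ ENNReal.ofReal_ne_top]
    · intro j hj
      exact (hF f hf p (q/p) ⟨j, hj⟩).const_mul _
  rw [e2]
  apply lintegral_of_balls
  intro R'
  rw [← e2]
  exact key R'

/-- the mixed norm estimate for `q` near `p d` -/
lemma K_main (d : ℕ) (hd : 3 ≤ d) [NeZero d] (p q : ℝ) (hp1 : 1 < p) (hq0 : 0 < q)
    (hq1 : p < 2 → 2 * ((d:ℝ)+1) / ((d:ℝ)-1) < 2 * (1 - 1/p) * q) 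
    (hq2 : 2 ≤ p → 2 * ((d:ℝ)+1) / ((d:ℝ)-1) < 2 / p * q) :
    ∃ C : ℝ≥0, ∀ κ : Euc d → Euc d → ℂ, (κ = kap0 ∨ κ = kap1) → ∀ (S : Finset ℤ), ∀ R : ℝ, ∀ f : Euc d → ℂ, BdM f →
      ∑ j ∈ S, ENNReal.ofReal (((2:ℝ)^j) ^ d) * ∫⁻ x, (∫⁻ t in Icc (1:ℝ) 2, ‖Tk κ ((2:ℝ)^j) R f x t‖ₑ ^ p) ^ (q/p) ≤
        (C * (∫⁻ y in ball 0 R, ‖f y‖ₑ ^ p) ^ (1/p)) ^ q := by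
  have hp0 : 0 < p := by linarith
  have hi : 1 / p < 1 := by rw [div_lt_one hp0]; exact hp1
  rcases lt_or_ge p 2 with h | h
  · have hi2 : 1/2 < 1 / p := one_div_lt_one_div_of_lt hp0 h
    refine K_core d (by omega) 1 (2 * (1 - 1/p)) p q _ (Or.inr rfl) (by linarith) (by linarith) hp0 hq0 (hq1 h) (by ring) ?_
    have : 2 * (1 - 1/p) ≠ 0 := by linarith
    rw [div_mul_cancel_left₀ this, one_div]
  · refine K_core d (by omega) 0 (2 / p) p q _ (Or.inl rfl) (by positivity) (by rw [div_le_one hp0]; exact h) hp0 hq0 (hq2 h) (by ring) ?_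
    have : 2 / p ≠ 0 := by positivity
    rw [div_mul_cancel_left₀ this, one_div]


lemma hold_Ioc (b : ℝ → ℂ) (hb : Measurable b) (p : ℝ) (hp : 1 < p) (s t : ℝ) (hst : s ≤ t) :
    (∫⁻ u in Ioc s t, ‖b u‖ₑ) ^ p ≤ ENNReal.ofReal (t - s) ^ (p - 1) * ∫⁻ u in Ioc s t, ‖b u‖ₑ ^ p := by
  have hpq : p.HolderConjugate (Real.conjExponent p) := Real.HolderConjugate.conjExponent hp
  have h := ENNReal.lintegral_mul_le_Lp_mul_Lq (volume.restrict (Ioc s t)) hpq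
    (f := fun u => ‖b u‖ₑ) (g := fun _ => 1) hb.enorm.aemeasurable aemeasurable_const
  simp only [Pi.mul_apply, mul_one, ENNReal.one_rpow, lintegral_const, Measure.restrict_apply_univ, Real.volume_Ioc, one_mul] at h
  have hp0 : 0 < p := by linarith
  refine (ENNReal.rpow_le_rpow h hp0.le).trans (le_of_eq ?_)
  rw [ENNReal.mul_rpow_of_nonneg _ _ hp0.le, ← ENNReal.rpow_mul, ← ENNReal.rpow_mul, one_div_mul_cancel hp0.ne',
    ENNReal.rpow_one, mul_comm]
  congr 2
  have := hpq.inv_add_inv_eq_one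
  have e : 1 / Real.conjExponent p = 1 - p⁻¹ := by rw [one_div]; linarith
  rw [e, sub_mul, inv_mul_cancel₀ hp0.ne', one_mul]

lemma var_short (a b : ℝ → ℂ) (hb : Measurable b) (m : ℝ) (hm : 0 < m)
    (h : ∀ t, HasDerivAt a (m * b t) t) (p : ℝ) (hp : 1 < p) (s t : ℝ) (hst : s ≤ t) (hmt : m * (t - s) ≤ 1) :
    ‖a t - a s‖ₑ ^ p ≤ ENNReal.ofReal m * ∫⁻ u in Ioc s t, ‖b u‖ₑ ^ p := by
  have hp0 : 0 < p := by linarith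
  have h1 : ‖a t - a s‖ₑ ≤ ENNReal.ofReal m * ∫⁻ u in Ioc s t, ‖b u‖ₑ := by
    by_cases hI : ∫⁻ u in Ioc s t, ‖b u‖ₑ = ⊤
    · rw [hI, ENNReal.mul_top (by simpa using hm)]; exact le_top
    · have hIntg : IntervalIntegrable (fun u => (m:ℂ) * b u) volume s t := by
        rw [intervalIntegrable_iff_integrableOn_Ioc_of_le hst]
        refine Integrable.const_mul ?_ _
        exact ⟨hb.aestronglyMeasurable, lt_of_le_of_ne le_top hI⟩
      rw [← intervalIntegral.integral_eq_sub_of_hasDerivAt (fun u _ => h u) hIntg, intervalIntegral.integral_of_le hst,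
        ← lintegral_const_mul' _ _ ENNReal.ofReal_ne_top]
      refine (enorm_integral_le_lintegral_enorm _).trans (le_of_eq ?_)
      congr 1; ext u
      rw [enorm_mul, ← ofReal_norm (m:ℂ), Complex.norm_real, Real.norm_of_nonneg hm.le]
  calc _ ≤ (ENNReal.ofReal m * ∫⁻ u in Ioc s t, ‖b u‖ₑ) ^ p := ENNReal.rpow_le_rpow h1 hp0.le
    _ ≤ ENNReal.ofReal m ^ p * (ENNReal.ofReal (t - s) ^ (p - 1) * ∫⁻ u in Ioc s t, ‖b u‖ₑ ^ p) := by
        rw [ENNReal.mul_rpow_of_nonneg _ _ hp0.le]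
        exact mul_le_mul_right (hold_Ioc b hb p hp s t hst) _
    _ = ENNReal.ofReal m * (ENNReal.ofReal (m * (t - s)) ^ (p - 1) * ∫⁻ u in Ioc s t, ‖b u‖ₑ ^ p) := by
        rw [ENNReal.ofReal_mul hm.le, ENNReal.mul_rpow_of_nonneg _ _ (by linarith)]
        have : ENNReal.ofReal m ^ p = ENNReal.ofReal m * ENNReal.ofReal m ^ (p - 1) := by
          conv_rhs => rw [← ENNReal.rpow_one (ENNReal.ofReal m), ← ENNReal.rpow_mul, one_mul]
          rw [← ENNReal.rpow_add _ _ (by simpa using hm) ENNReal.ofReal_ne_top]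
          congr 1; ring
        rw [this]; ring
    _ ≤ ENNReal.ofReal m * (1 * ∫⁻ u in Ioc s t, ‖b u‖ₑ ^ p) := by
        refine mul_le_mul_right (mul_le_mul_left ?_ _) _
        apply ENNReal.rpow_le_one _ (by linarith)
        rw [← ENNReal.ofReal_one]; exact ENNReal.ofReal_le_ofReal hmt
    _ = _ := by rw [one_mul]

lemma enorm_sub_comm' (x y : ℂ) : ‖x - y‖ₑ = ‖y - x‖ₑ := by
  rw [← neg_sub, enorm_neg]

/-- endpoint bound -/
lemma var_end (a b : ℝ → ℂ) (ha : Measurable a) (hb : Measurable b) (m : ℝ) (hm : 0 < m)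
    (h : ∀ t, HasDerivAt a (m * b t) t) (p : ℝ) (hp : 1 < p) (s t : ℝ) (hmt : 1 < m * (t - s)) (v : ℝ)
    (hv : v = s ∨ v = t) :
    ‖a v‖ₑ ^ p ≤ 2 ^ (p - 1) * (ENNReal.ofReal m * ∫⁻ u in Ioc s t, (‖a u‖ₑ ^ p + ‖b u‖ₑ ^ p)) := by
  have hp0 : 0 < p := by linarith
  have hmi : m⁻¹ < t - s := by rwa [inv_lt_iff_one_lt_mul₀ hm, mul_comm] 
  set lo := if v = s then s else t - m⁻¹ with hlo
  have hlo1 : s ≤ lo ∧ lo + m⁻¹ ≤ t := by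
    rw [hlo]; split_ifs <;> constructor <;> linarith
  set I := Ioc lo (lo + m⁻¹) with hI
  have hIs : I ⊆ Ioc s t := Ioc_subset_Ioc hlo1.1 hlo1.2
  set Q := ENNReal.ofReal m * ∫⁻ u in Ioc s t, ‖b u‖ₑ ^ p with hQ
  have hpt : ∀ u ∈ I, ‖a v‖ₑ ^ p ≤ 2 ^ (p - 1) * (‖a u‖ₑ ^ p + Q) := by
    intro u hu
    have h1 : ‖a v - a u‖ₑ ^ p ≤ Q := by
      by_cases hvs : v = s
      · rw [hlo, if_pos hvs] at hI
        rw [hI] at hu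
        rw [enorm_sub_comm', hvs]
        refine (var_short a b hb m hm h p hp s u hu.1.le ?_).trans ?_
        · rw [← mul_inv_cancel₀ hm.ne']; exact mul_le_mul_of_nonneg_left (by linarith [hu.2]) hm.le
        · refine mul_le_mul_right (lintegral_mono_set (Ioc_subset_Ioc_right (by linarith [hu.2]))) _
      · have hvt : v = t := hv.resolve_left hvs
        rw [hlo, if_neg hvs] at hI
        rw [hI] at hu
        rw [hvt]
        refine (var_short a b hb m hm h p hp u t (by linarith [hu.2]) ?_).trans ?_
        · rw [← mul_inv_cancel₀ hm.ne']; exact mul_le_mul_of_nonneg_left (by linarith [hu.1]) hm.le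
        · refine mul_le_mul_right (lintegral_mono_set (Ioc_subset_Ioc_left (by linarith [hu.1]))) _
    calc ‖a v‖ₑ ^ p ≤ (‖a u‖ₑ + ‖a v - a u‖ₑ) ^ p := by
          refine ENNReal.rpow_le_rpow ?_ hp0.le
          have := enorm_add_le (a u) (a v - a u)
          rwa [add_sub_cancel] at this
      _ ≤ 2 ^ (p - 1) * (‖a u‖ₑ ^ p + ‖a v - a u‖ₑ ^ p) := ENNReal.rpow_add_le_mul_rpow_add_rpow _ _ hp.le
      _ ≤ _ := mul_le_mul_right (add_le_add le_rfl h1) _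
  have hvol : volume I = ENNReal.ofReal m⁻¹ := by rw [hI, Real.volume_Ioc]; congr 1; ring
  have hmm : ENNReal.ofReal m * ENNReal.ofReal m⁻¹ = 1 := by
    rw [← ENNReal.ofReal_mul hm.le, mul_inv_cancel₀ hm.ne', ENNReal.ofReal_one]
  have h2 : ENNReal.ofReal m⁻¹ * ‖a v‖ₑ ^ p ≤ 2 ^ (p - 1) * ((∫⁻ u in Ioc s t, ‖a u‖ₑ ^ p) + ENNReal.ofReal m⁻¹ * Q) := by
    calc _ = ∫⁻ u in I, ‖a v‖ₑ ^ p := by rw [setLIntegral_const, hvol, mul_comm]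
      _ ≤ ∫⁻ u in I, 2 ^ (p - 1) * (‖a u‖ₑ ^ p + Q) := setLIntegral_mono' measurableSet_Ioc hpt
      _ = 2 ^ (p - 1) * ((∫⁻ u in I, ‖a u‖ₑ ^ p) + ENNReal.ofReal m⁻¹ * Q) := by
          rw [lintegral_const_mul' _ _ (ENNReal.rpow_ne_top_of_nonneg (by linarith) (by norm_num)),
            lintegral_add_right _ measurable_const, setLIntegral_const, hvol, mul_comm Q]
      _ ≤ _ := mul_le_mul_right (add_le_add (lintegral_mono_set hIs) le_rfl) _
  calc ‖a v‖ₑ ^ p = ENNReal.ofReal m * (ENNReal.ofReal m⁻¹ * ‖a v‖ₑ ^ p) := by rw [← mul_assoc, hmm, one_mul]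
    _ ≤ ENNReal.ofReal m * (2 ^ (p - 1) * ((∫⁻ u in Ioc s t, ‖a u‖ₑ ^ p) + ENNReal.ofReal m⁻¹ * Q)) := mul_le_mul_right h2 _
    _ = _ := by
        rw [lintegral_add_left (ha.enorm.pow_const _), hQ, ← mul_assoc (ENNReal.ofReal m⁻¹), mul_comm (ENNReal.ofReal m⁻¹), hmm, one_mul]
        ring

lemma var_gap (a b : ℝ → ℂ) (ha : Measurable a) (hb : Measurable b) (m : ℝ) (hm : 0 < m)
    (h : ∀ t, HasDerivAt a (m * b t) t) (p : ℝ) (hp : 1 < p) (s t : ℝ) (hst : s ≤ t) :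
    ‖a t - a s‖ₑ ^ p ≤ 2 ^ (p + p) * (ENNReal.ofReal m * ∫⁻ u in Ioc s t, (‖a u‖ₑ ^ p + ‖b u‖ₑ ^ p)) := by
  rcases le_or_gt (m * (t - s)) 1 with h1 | h1
  · refine (var_short a b hb m hm h p hp s t hst h1).trans ?_
    refine le_trans ?_ (le_mul_of_one_le_left zero_le ?_)
    · exact mul_le_mul_right (lintegral_mono fun u => le_add_self) _
    · exact ENNReal.one_le_rpow (by norm_num) (by linarith)
  · have e1 := var_end a b ha hb m hm h p hp s t h1 s (Or.inl rfl)
    have e2 := var_end a b ha hb m hm h p hp s t h1 t (Or.inr rfl)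
    set Z := ENNReal.ofReal m * ∫⁻ u in Ioc s t, (‖a u‖ₑ ^ p + ‖b u‖ₑ ^ p)
    calc _ ≤ (‖a t‖ₑ + ‖a s‖ₑ) ^ p := ENNReal.rpow_le_rpow enorm_sub_le (by linarith)
      _ ≤ 2 ^ (p - 1) * (‖a t‖ₑ ^ p + ‖a s‖ₑ ^ p) := ENNReal.rpow_add_le_mul_rpow_add_rpow _ _ hp.le
      _ ≤ 2 ^ (p - 1) * (2 ^ (p - 1) * Z + 2 ^ (p - 1) * Z) := mul_le_mul_right (add_le_add e2 e1) _
      _ = 2 ^ (p - 1) * 2 ^ (p - 1) * 2 * Z := by ring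
      _ ≤ 2 ^ (p + p) * Z := by
        refine mul_le_mul_left ?_ _
        conv_lhs => rw [← ENNReal.rpow_add _ _ (by norm_num) (by norm_num)]
        nth_rewrite 2 [← ENNReal.rpow_one 2]
        rw [← ENNReal.rpow_add _ _ (by norm_num) (by norm_num)]
        exact ENNReal.rpow_le_rpow_of_exponent_le (by norm_num) (by linarith)

lemma sum_Ioc (F : ℝ → ℝ≥0∞) : ∀ (N : ℕ) (t : Fin (N + 1) → ℝ), Monotone t →
    ∑ i : Fin N, ∫⁻ u in Ioc (t i.castSucc) (t i.succ), F u ≤ ∫⁻ u in Ioc (t 0) (t (Fin.last N)), F u := by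
  intro N
  induction N with
  | zero => intro t _; simp
  | succ n ih =>
    intro t ht
    rw [Fin.sum_univ_castSucc]
    have h := ih (fun i => t i.castSucc) (fun i j hij => ht (by simpa using hij))
    simp only [Fin.succ_castSucc] at h ⊢
    refine (add_le_add h le_rfl).trans (le_of_eq ?_)
    rw [Fin.castSucc_zero, Fin.succ_last, ← lintegral_union measurableSet_Ioc, Ioc_union_Ioc_eq_Ioc]
    · exact ht (Fin.zero_le _)
    · exact ht (Fin.le_last _)
    · rw [Set.disjoint_left]; intro u hu hu'
      exact absurd hu.2 (not_le.2 hu'.1)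

lemma rVar_le {r : ℝ} {E : Set ℝ} {a : ℝ → ℂ} {B : ℝ≥0∞}
    (h : ∀ (N : ℕ) (t : Fin (N + 1) → ℝ), StrictMono t → (∀ i, t i ∈ E) →
      (∑ i : Fin N, (‖a (t i.succ) - a (t i.castSucc)‖ₑ) ^ r) ^ (1 / r) ≤ B) : rVar r E a ≤ B := by
  unfold rVar
  exact iSup_le fun N => iSup_le fun t => iSup_le fun h1 => iSup_le fun h2 => h N t h1 h2

lemma le_rVar {r : ℝ} {E : Set ℝ} {a : ℝ → ℂ} (N : ℕ) (t : Fin (N + 1) → ℝ) (h1 : StrictMono t) (h2 : ∀ i, t i ∈ E) :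
      (∑ i : Fin N, (‖a (t i.succ) - a (t i.castSucc)‖ₑ) ^ r) ^ (1 / r) ≤ rVar r E a := by
  unfold rVar
  exact le_iSup_of_le N (le_iSup_of_le t (le_iSup_of_le h1 (le_iSup_of_le h2 le_rfl)))

lemma rVar_deriv (a b : ℝ → ℂ) (ha : Measurable a) (hb : Measurable b) (m : ℝ) (hm : 0 < m)
    (h : ∀ t, HasDerivAt a (m * b t) t) (p : ℝ) (hp : 1 < p) :
    rVar p (Icc 1 2) a ≤ (2 ^ (p + p) * (ENNReal.ofReal m * ∫⁻ u in Icc (1:ℝ) 2, (‖a u‖ₑ ^ p + ‖b u‖ₑ ^ p))) ^ (1/p) := by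
  apply rVar_le
  intro N t ht hE
  refine ENNReal.rpow_le_rpow ?_ (by positivity)
  calc _ ≤ ∑ i : Fin N, 2 ^ (p + p) * (ENNReal.ofReal m * ∫⁻ u in Ioc (t i.castSucc) (t i.succ), (‖a u‖ₑ ^ p + ‖b u‖ₑ ^ p)) :=
        Finset.sum_le_sum fun i _ => var_gap a b ha hb m hm h p hp _ _ (ht.monotone i.castSucc_le_succ)
    _ = 2 ^ (p + p) * (ENNReal.ofReal m * ∑ i : Fin N, ∫⁻ u in Ioc (t i.castSucc) (t i.succ), (‖a u‖ₑ ^ p + ‖b u‖ₑ ^ p)) := by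
        rw [Finset.mul_sum, Finset.mul_sum]
    _ ≤ _ := by
        refine mul_le_mul_right (mul_le_mul_right ((sum_Ioc _ N t ht.monotone).trans (lintegral_mono_set ?_)) _) _
        intro u hu
        exact ⟨(hE 0).1.trans hu.1.le, hu.2.trans (hE _).2⟩

lemma rVar_sum {ι : Type*} (S : Finset ι) (a : ι → ℝ → ℂ) (r : ℝ) (hr : 1 ≤ r) (E : Set ℝ) :
    rVar r E (fun t => ∑ j ∈ S, a j t) ≤ ∑ j ∈ S, rVar r E (a j) := by
  apply rVar_le
  intro N t ht hE
  refine le_trans ?_ (Finset.sum_le_sum fun j _ => le_rVar (a := a j) (r := r) N t ht hE)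
  classical
  have hr0 : 0 < r := by linarith
  induction S using Finset.induction_on with
  | empty => simp [hr0]
  | insert j s hj ih =>
    simp only [Finset.sum_insert hj]
    refine le_trans ?_ (add_le_add le_rfl ih)
    refine le_trans ?_ (ENNReal.Lp_add_le Finset.univ _ _ hr)
    refine ENNReal.rpow_le_rpow (Finset.sum_le_sum fun i _ => ENNReal.rpow_le_rpow ?_ hr0.le) (by positivity)
    rw [add_sub_add_comm]
    exact enorm_add_le _ _

/-- lower semicontinuity under pointwise convergence -/
lemma rVar_liminf (a : ℕ → ℝ → ℂ) (a' : ℝ → ℂ) (r : ℝ) (hr : 1 ≤ r) (E : Set ℝ) (B : ℝ≥0∞)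
    (hlim : ∀ t ∈ E, Filter.Tendsto (fun n => a n t) Filter.atTop (nhds (a' t)))
    (hB : ∀ n, rVar r E (a n) ≤ B) : rVar r E a' ≤ B := by
  apply rVar_le
  intro N t ht hE
  have hr0 : 0 < r := by linarith
  refine le_of_tendsto (x := Filter.atTop) (f := fun n => (∑ i : Fin N, (‖a n (t i.succ) - a n (t i.castSucc)‖ₑ) ^ r) ^ (1 / r)) ?_ 
    (Filter.Eventually.of_forall fun n => (le_rVar (a := a n) N t ht hE).trans (hB n))
  apply Filter.Tendsto.ennrpow_const
  apply tendsto_finsetSum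
  intro i _
  apply Filter.Tendsto.ennrpow_const
  exact ((hlim _ (hE _)).sub (hlim _ (hE _))).enorm

lemma geo_term (x : ℝ≥0∞) (c Q l : ℝ) (hQ : 0 < Q) (h : (2:ℝ≥0∞) ^ c * x ^ Q ≤ 2 ^ l) : x ≤ 2 ^ ((l - c) / Q) := by
  have h2 : (2:ℝ≥0∞) ≠ 0 := by norm_num
  have h3 : (2:ℝ≥0∞) ≠ ⊤ := by norm_num
  have h1 : x ^ Q ≤ 2 ^ (l - c) := by
    calc x ^ Q = 2 ^ (-c) * (2 ^ c * x ^ Q) := by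
          rw [← mul_assoc, ← ENNReal.rpow_add _ _ h2 h3]; simp
      _ ≤ 2 ^ (-c) * 2 ^ l := mul_le_mul_right h _
      _ = _ := by rw [← ENNReal.rpow_add _ _ h2 h3]; congr 1; ring
  have := ENNReal.rpow_le_rpow h1 (show 0 ≤ 1 / Q by positivity)
  rw [← ENNReal.rpow_mul, ← ENNReal.rpow_mul, mul_one_div_cancel hQ.ne', ENNReal.rpow_one] at this
  rwa [div_eq_mul_one_div]

lemma geo_Z (a : ℝ) (ha : 0 < a) : ∃ K : ℝ≥0, ∀ (S : Finset ℤ) (j0 : ℝ),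
    ∑ j ∈ S, (2:ℝ≥0∞) ^ (-(a * |(j:ℝ) - j0|)) ≤ K := by
  have hs : Summable (fun j : ℤ => ((2:ℝ) ^ (-a)) ^ j.natAbs) := by
    have h1 : Summable (fun n : ℕ => ((2:ℝ) ^ (-a)) ^ n) :=
      summable_geometric_of_lt_one (by positivity) (Real.rpow_lt_one_of_one_lt_of_neg (by norm_num) (by linarith))
    apply Summable.of_nat_of_neg <;> simpa using h1
  have ht := hs.tsum_ofReal_ne_top
  refine ⟨(2 ^ a * ∑' j : ℤ, ENNReal.ofReal (((2:ℝ) ^ (-a)) ^ j.natAbs)).toNNReal, fun S j0 => ?_⟩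
  rw [ENNReal.coe_toNNReal (ENNReal.mul_ne_top (by simp) ht)]
  set n0 := ⌊j0⌋
  have h2 : ∀ j : ℤ, (2:ℝ≥0∞) ^ (-(a * |(j:ℝ) - j0|)) ≤ 2 ^ a * ENNReal.ofReal (((2:ℝ) ^ (-a)) ^ (j - n0).natAbs) := by
    intro j
    have e : ENNReal.ofReal (((2:ℝ) ^ (-a)) ^ (j - n0).natAbs) = (2:ℝ≥0∞) ^ (-a * ((j - n0).natAbs : ℝ)) := by
      rw [← Real.rpow_natCast, ← Real.rpow_mul (by norm_num), ← ENNReal.ofReal_rpow_of_pos (by norm_num)]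
      simp
    rw [e, ← ENNReal.rpow_add _ _ (by norm_num) (by norm_num)]
    apply ENNReal.rpow_le_rpow_of_exponent_le (by norm_num)
    have e2 : (((j - n0).natAbs : ℕ) : ℝ) = |(j:ℝ) - n0| := by
      rw [Nat.cast_natAbs]; push_cast; rfl
    rw [e2]
    have h3 : |(j:ℝ) - n0| ≤ |(j:ℝ) - j0| + 1 := by
      have := abs_add_le ((j:ℝ) - j0) (j0 - n0)
      have h4 : |j0 - n0| ≤ 1 := by
        rw [abs_le]; constructor
        · have := Int.floor_le j0; linarith
        · have := Int.lt_floor_add_one j0; linarith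
      rw [show (j:ℝ) - n0 = (j - j0) + (j0 - n0) by ring]; linarith
    nlinarith
  calc _ ≤ ∑ j ∈ S, 2 ^ a * ENNReal.ofReal (((2:ℝ) ^ (-a)) ^ (j - n0).natAbs) := Finset.sum_le_sum fun j _ => h2 j
    _ = 2 ^ a * ∑ j ∈ S, ENNReal.ofReal (((2:ℝ) ^ (-a)) ^ (j - n0).natAbs) := by rw [Finset.mul_sum]
    _ ≤ 2 ^ a * ∑' j : ℤ, ENNReal.ofReal (((2:ℝ) ^ (-a)) ^ (j - n0).natAbs) := mul_le_mul_right (ENNReal.sum_le_tsum _) _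
    _ = _ := by
        congr 1
        exact (Equiv.subRight n0).tsum_eq (fun j : ℤ => ENNReal.ofReal (((2:ℝ) ^ (-a)) ^ j.natAbs))

lemma geo_sum (p d δ : ℝ) (hp : 0 < p) (hδ : 0 < δ) (hd : δ < d) : ∃ K : ℝ≥0, ∀ (S : Finset ℤ) (H : ℤ → ℝ≥0∞),
    (∑ j ∈ S, H j) ^ (p * d) ≤ K * ∑ j ∈ S, ((2:ℝ≥0∞) ^ (-((j:ℝ) * δ)) * H j ^ (p * (d + δ)) +
      (2:ℝ≥0∞) ^ ((j:ℝ) * δ) * H j ^ (p * (d - δ))) := by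
  have hd0 : 0 < d := by linarith
  obtain ⟨K, hK⟩ := geo_Z (δ / (p * (d + δ))) (by positivity)
  refine ⟨K ^ (p * d) + 1, fun S H => ?_⟩
  have hq : 0 < p * d := by positivity
  have hqp : 0 < p * (d + δ) := by positivity
  have hqm : 0 < p * (d - δ) := mul_pos hp (by linarith)
  set R := ∑ j ∈ S, ((2:ℝ≥0∞) ^ (-((j:ℝ) * δ)) * H j ^ (p * (d + δ)) +
      (2:ℝ≥0∞) ^ ((j:ℝ) * δ) * H j ^ (p * (d - δ))) with hR
  have hle : ∀ j ∈ S, (2:ℝ≥0∞) ^ (-((j:ℝ) * δ)) * H j ^ (p * (d + δ)) +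
      (2:ℝ≥0∞) ^ ((j:ℝ) * δ) * H j ^ (p * (d - δ)) ≤ R := fun j hj =>
    Finset.single_le_sum (f := fun j : ℤ => (2:ℝ≥0∞) ^ (-((j:ℝ) * δ)) * H j ^ (p * (d + δ)) +
      (2:ℝ≥0∞) ^ ((j:ℝ) * δ) * H j ^ (p * (d - δ))) (fun _ _ => zero_le) hj
  by_cases hR0 : R = 0
  · have : ∀ j ∈ S, H j = 0 := by
      intro j hj
      have := hle j hj
      rw [hR0, nonpos_iff_eq_zero, add_eq_zero, mul_eq_zero] at this
      rcases this.1 with h | h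
      · simp [ENNReal.rpow_eq_zero_iff] at h
      · rw [ENNReal.rpow_eq_zero_iff] at h
        rcases h with h | h
        · exact h.1
        · exact absurd h.2 (by linarith)
    rw [Finset.sum_eq_zero this, ENNReal.zero_rpow_of_pos hq]; exact zero_le
  by_cases hRt : R = ⊤
  · rw [hRt, ENNReal.mul_top]
    · exact le_top
    · simp
  have hRr : 0 < R.toReal := ENNReal.toReal_pos hR0 hRt
  set l := Real.logb 2 R.toReal
  have hl : R = 2 ^ l := by
    have : R.toReal = 2 ^ l := (Real.rpow_logb (by norm_num) (by norm_num) hRr).symm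
    rw [← ENNReal.ofReal_toReal hRt, this, ← ENNReal.ofReal_rpow_of_pos (by norm_num)]; simp
  have hterm : ∀ j ∈ S, H j ≤ 2 ^ (l / (p * d)) * 2 ^ (-(δ / (p * (d + δ)) * |(j:ℝ) - l / d|)) := by
    intro j hj
    have h0 := hle j hj
    rw [hl] at h0
    have h1 := geo_term _ _ _ _ hqp (le_self_add.trans h0)
    have h2 := geo_term _ _ _ _ hqm (le_add_self.trans h0)
    rw [← ENNReal.rpow_add _ _ (by norm_num) (by norm_num)]
    rcases le_total (l / d) (j:ℝ) with h | h
    · refine h2.trans (ENNReal.rpow_le_rpow_of_exponent_le (by norm_num) ?_)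
      rw [abs_of_nonneg (by linarith)]
      have e : (l - j * δ) / (p * (d - δ)) = l / (p * d) + -(δ / (p * (d - δ)) * (j - l / d)) := by
        have : d - δ ≠ 0 := by linarith
        field_simp; ring
      rw [e]
      have : δ / (p * (d + δ)) ≤ δ / (p * (d - δ)) := by
        apply div_le_div_of_nonneg_left hδ.le hqm
        apply mul_le_mul_of_nonneg_left (by linarith) hp.le
      have := mul_le_mul_of_nonneg_right this (sub_nonneg.2 h)
      linarith
    · refine h1.trans (ENNReal.rpow_le_rpow_of_exponent_le (by norm_num) ?_)
      rw [abs_of_nonpos (by linarith)]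
      apply le_of_eq
      field_simp; ring
  calc _ ≤ (∑ j ∈ S, (2:ℝ≥0∞) ^ (l / (p * d)) * 2 ^ (-(δ / (p * (d + δ)) * |(j:ℝ) - l / d|))) ^ (p * d) :=
        ENNReal.rpow_le_rpow (Finset.sum_le_sum hterm) hq.le
    _ ≤ ((2:ℝ≥0∞) ^ (l / (p * d)) * K) ^ (p * d) := by
        refine ENNReal.rpow_le_rpow ?_ hq.le
        rw [← Finset.mul_sum]
        exact mul_le_mul_right (hK S _) _
    _ = R * K ^ (p * d) := by
        rw [ENNReal.mul_rpow_of_nonneg _ _ hq.le, ← ENNReal.rpow_mul, div_mul_cancel₀ _ hq.ne', ← hl]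
    _ ≤ _ := by
        rw [mul_comm]
        refine mul_le_mul_left ?_ _
        rw [ENNReal.coe_add, ENNReal.coe_rpow_of_nonneg _ hq.le]
        exact le_self_add

/-- majorant of the variation of one frequency piece -/
def Hj {d : ℕ} (p R : ℝ) (f : Euc d → ℂ) (j : ℤ) (x : Euc d) : ℝ≥0∞ :=
  (2 ^ (p + p) * (ENNReal.ofReal ((2:ℝ)^j) * ∫⁻ u in Icc (1:ℝ) 2,
    (‖Tk kap0 ((2:ℝ)^j) R f x u‖ₑ ^ p + ‖Tk kap1 ((2:ℝ)^j) R f x u‖ₑ ^ p))) ^ (1/p)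

lemma IT_meas {d : ℕ} [NeZero d] (p R : ℝ) {f : Euc d → ℂ} (hf : BdM f) (j : ℤ) (κ : Euc d → Euc d → ℂ)
    (hκ : κ = kap0 ∨ κ = kap1) : Measurable fun x => ∫⁻ u in Icc (1:ℝ) 2, ‖Tk κ ((2:ℝ)^j) R f x u‖ₑ ^ p := by
  obtain ⟨c, hc⟩ := adm_kap d
  apply Measurable.lintegral_prod_right' (f := fun w : Euc d × ℝ => ‖Tk κ ((2:ℝ)^j) R f w.1 w.2‖ₑ ^ p)
  exact (Tk_meas (hc κ hκ) _ R hf).enorm.pow_const _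

lemma Hj_eq {d : ℕ} [NeZero d] (p R : ℝ) {f : Euc d → ℂ} (hf : BdM f) (j : ℤ) (x : Euc d) :
    Hj p R f j x = (2 ^ (p + p) * (ENNReal.ofReal ((2:ℝ)^j) * ((∫⁻ u in Icc (1:ℝ) 2, ‖Tk kap0 ((2:ℝ)^j) R f x u‖ₑ ^ p) +
      ∫⁻ u in Icc (1:ℝ) 2, ‖Tk kap1 ((2:ℝ)^j) R f x u‖ₑ ^ p))) ^ (1/p) := by
  obtain ⟨c, hc⟩ := adm_kap d
  unfold Hj
  rw [lintegral_add_left]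
  exact ((Tk_meas (hc _ (Or.inl rfl)) ((2:ℝ)^j) R hf).comp (f := fun u => (x, u)) (by fun_prop)).enorm.pow_const _

lemma Hj_meas {d : ℕ} [NeZero d] (p R : ℝ) {f : Euc d → ℂ} (hf : BdM f) (j : ℤ) : Measurable (Hj p R f j) := by
  have : Hj p R f j = _ := funext (Hj_eq p R hf j)
  rw [this]
  exact (((IT_meas p R hf j _ (Or.inl rfl)).add (IT_meas p R hf j _ (Or.inr rfl))).const_mul _ |>.const_mul _).pow_const _

lemma rVar_Hj {d : ℕ} [NeZero d] (p R : ℝ) (hp : 1 < p) {f : Euc d → ℂ} (hf : BdM f) (j : ℤ) (x : Euc d) :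
    rVar p (Icc 1 2) (fun t => sphAvg (𝓕⁻ (Um R ((2:ℝ)^j) f)) t x) ≤ Hj p R f j x := by
  obtain ⟨c, hc⟩ := adm_kap d
  have e : (fun t => sphAvg (𝓕⁻ (Um R ((2:ℝ)^j) f)) t x) = Tk kap0 ((2:ℝ)^j) R f x :=
    funext fun t => (ident0 R ((2:ℝ)^j) (by positivity) hf x t).symm
  have hd := fun t => opT_deriv R ((2:ℝ)^j) (by positivity) hf x t
  rw [e] at hd ⊢
  refine rVar_deriv _ (Tk kap1 ((2:ℝ)^j) R f x) ?_ ?_ ((2:ℝ)^j) (by positivity) ?_ p hp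
  · exact (Tk_meas (hc _ (Or.inl rfl)) ((2:ℝ)^j) R hf).comp (f := fun u => (x, u)) (by fun_prop)
  · exact (Tk_meas (hc _ (Or.inr rfl)) ((2:ℝ)^j) R hf).comp (f := fun u => (x, u)) (by fun_prop)
  · exact hd

lemma ofReal_zpow_two (j : ℤ) : ENNReal.ofReal ((2:ℝ)^j) = (2:ℝ≥0∞) ^ (j:ℝ) := by
  rw [← Real.rpow_intCast, ← ENNReal.ofReal_rpow_of_pos (by norm_num)]; simp

lemma Hj_int (d : ℕ) [NeZero d] (p ε : ℝ) (hp : 1 < p) (hε : 0 < 1 * ((d:ℝ) + ε)) (h1 : 1 ≤ (d:ℝ) + ε)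
    (hK : ∃ C : ℝ≥0, ∀ κ : Euc d → Euc d → ℂ, (κ = kap0 ∨ κ = kap1) → ∀ (S : Finset ℤ), ∀ R : ℝ, ∀ f : Euc d → ℂ, BdM f →
      ∑ j ∈ S, ENNReal.ofReal (((2:ℝ)^j) ^ d) * ∫⁻ x, (∫⁻ t in Icc (1:ℝ) 2, ‖Tk κ ((2:ℝ)^j) R f x t‖ₑ ^ p) ^ ((p * (d + ε))/p) ≤
        (C * (∫⁻ y in ball 0 R, ‖f y‖ₑ ^ p) ^ (1/p)) ^ (p * (d + ε))) :
    ∃ C : ℝ≥0, ∀ (S : Finset ℤ), ∀ R : ℝ, ∀ f : Euc d → ℂ, BdM f →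
      ∑ j ∈ S, ∫⁻ x, (2:ℝ≥0∞) ^ (-((j:ℝ) * ε)) * Hj p R f j x ^ (p * (d + ε)) ≤
        C * ((∫⁻ y in ball 0 R, ‖f y‖ₑ ^ p) ^ (1/p)) ^ (p * (d + ε)) := by
  obtain ⟨C, hC⟩ := hK
  have hp0 : 0 < p := by linarith
  set s := (d:ℝ) + ε with hs
  have hs0 : 0 < s := by linarith
  have hps : p * s / p = s := by field_simp
  rw [hps] at hC
  obtain ⟨B, hB⟩ : ∃ B : ℝ≥0, B = (2 ^ (p + p)) ^ s * 2 ^ (s - 1) := ⟨_, rfl⟩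
  have h2 : (2:ℝ≥0∞) ≠ 0 := by norm_num
  have h3 : (2:ℝ≥0∞) ≠ ⊤ := by norm_num
  have hBe : (B : ℝ≥0∞) = (2 ^ (p + p)) ^ s * 2 ^ (s - 1) := by
    rw [hB, ENNReal.coe_mul, ENNReal.coe_rpow_of_nonneg _ hs0.le, ENNReal.coe_rpow_of_nonneg _ (by linarith),
      ENNReal.coe_rpow_of_nonneg _ (by linarith)]
    simp
  refine ⟨2 * B * C ^ (p * s), fun S R f hf => ?_⟩
  have hpt : ∀ j : ℤ, ∀ x, (2:ℝ≥0∞) ^ (-((j:ℝ) * ε)) * Hj p R f j x ^ (p * s) ≤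
      B * (ENNReal.ofReal (((2:ℝ)^j) ^ d) * (∫⁻ t in Icc (1:ℝ) 2, ‖Tk kap0 ((2:ℝ)^j) R f x t‖ₑ ^ p) ^ s +
        ENNReal.ofReal (((2:ℝ)^j) ^ d) * (∫⁻ t in Icc (1:ℝ) 2, ‖Tk kap1 ((2:ℝ)^j) R f x t‖ₑ ^ p) ^ s) := by
    intro j x
    rw [Hj_eq p R hf, ← ENNReal.rpow_mul, show 1 / p * (p * s) = s by field_simp, ENNReal.mul_rpow_of_nonneg _ _ hs0.le,
      ENNReal.mul_rpow_of_nonneg _ _ hs0.le, ofReal_zpow_two]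
    have e1 : ENNReal.ofReal (((2:ℝ)^j) ^ d) = 2 ^ ((j:ℝ) * d) := by
      rw [ENNReal.ofReal_pow (by positivity), ofReal_zpow_two, ← ENNReal.rpow_natCast, ← ENNReal.rpow_mul]
    have e2 : ((2:ℝ≥0∞) ^ (j:ℝ)) ^ s = 2 ^ ((j:ℝ) * ε) * 2 ^ ((j:ℝ) * d) := by
      rw [← ENNReal.rpow_mul, ← ENNReal.rpow_add _ _ h2 h3]; congr 1; rw [hs]; ring
    rw [e1, e2]
    have e3 : (2:ℝ≥0∞) ^ (-((j:ℝ) * ε)) * 2 ^ ((j:ℝ) * ε) = 1 := by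
      rw [← ENNReal.rpow_add _ _ h2 h3]; simp
    set I0 := ∫⁻ t in Icc (1:ℝ) 2, ‖Tk kap0 ((2:ℝ)^j) R f x t‖ₑ ^ p
    set I1 := ∫⁻ t in Icc (1:ℝ) 2, ‖Tk kap1 ((2:ℝ)^j) R f x t‖ₑ ^ p
    calc _ = (2 ^ (-((j:ℝ) * ε)) * 2 ^ ((j:ℝ) * ε)) * ((2 ^ (p + p)) ^ s * 2 ^ ((j:ℝ) * d) * (I0 + I1) ^ s) := by ring
      _ ≤ (2 ^ (-((j:ℝ) * ε)) * 2 ^ ((j:ℝ) * ε)) * ((2 ^ (p + p)) ^ s * 2 ^ ((j:ℝ) * d) * (2 ^ (s - 1) * (I0 ^ s + I1 ^ s))) :=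
          mul_le_mul_right (mul_le_mul_right (ENNReal.rpow_add_le_mul_rpow_add_rpow _ _ h1) _) _
      _ = _ := by rw [e3, hBe]; ring
  have hm : ∀ j : ℤ, ∀ κ : Euc d → Euc d → ℂ, (κ = kap0 ∨ κ = kap1) → Measurable fun x => (∫⁻ t in Icc (1:ℝ) 2, ‖Tk κ ((2:ℝ)^j) R f x t‖ₑ ^ p) ^ s :=
    fun j κ hκ => (IT_meas p R hf j κ hκ).pow_const _
  calc _ ≤ ∑ j ∈ S, ∫⁻ x, B * (ENNReal.ofReal (((2:ℝ)^j) ^ d) * (∫⁻ t in Icc (1:ℝ) 2, ‖Tk kap0 ((2:ℝ)^j) R f x t‖ₑ ^ p) ^ s +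
        ENNReal.ofReal (((2:ℝ)^j) ^ d) * (∫⁻ t in Icc (1:ℝ) 2, ‖Tk kap1 ((2:ℝ)^j) R f x t‖ₑ ^ p) ^ s) :=
        Finset.sum_le_sum fun j _ => lintegral_mono fun x => hpt j x
    _ = B * ((∑ j ∈ S, ENNReal.ofReal (((2:ℝ)^j) ^ d) * ∫⁻ x, (∫⁻ t in Icc (1:ℝ) 2, ‖Tk kap0 ((2:ℝ)^j) R f x t‖ₑ ^ p) ^ s) +
          ∑ j ∈ S, ENNReal.ofReal (((2:ℝ)^j) ^ d) * ∫⁻ x, (∫⁻ t in Icc (1:ℝ) 2, ‖Tk kap1 ((2:ℝ)^j) R f x t‖ₑ ^ p) ^ s) := by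
        rw [← Finset.sum_add_distrib, Finset.mul_sum]
        apply Finset.sum_congr rfl; intro j _
        rw [lintegral_const_mul' _ _ ENNReal.coe_ne_top, lintegral_add_left ((hm j _ (Or.inl rfl)).const_mul _),
          lintegral_const_mul' _ _ ENNReal.ofReal_ne_top, lintegral_const_mul' _ _ ENNReal.ofReal_ne_top]
    _ ≤ B * ((C * (∫⁻ y in ball 0 R, ‖f y‖ₑ ^ p) ^ (1/p)) ^ (p * s) + (C * (∫⁻ y in ball 0 R, ‖f y‖ₑ ^ p) ^ (1/p)) ^ (p * s)) :=
        mul_le_mul_right (add_le_add (hC _ (Or.inl rfl) S R f hf) (hC _ (Or.inr rfl) S R f hf)) _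
    _ = _ := by
        rw [ENNReal.mul_rpow_of_nonneg _ _ (by positivity), ENNReal.coe_mul, ENNReal.coe_mul, ENNReal.coe_rpow_of_nonneg _ (by positivity)]
        push_cast; ring

lemma pick_delta (d : ℕ) (hd : 3 ≤ d) (p : ℝ) (hp : ((d : ℝ) ^ 2 + 1) / ((d : ℝ) * ((d : ℝ) - 1)) < p) :
    1 < p ∧ ∃ δ : ℝ, 0 < δ ∧ δ < 1 ∧ 2 * ((d:ℝ)+1) / ((d:ℝ)-1) < 2 * (p - 1) * (d - δ) ∧
      2 * ((d:ℝ)+1) / ((d:ℝ)-1) < 2 * (d - δ) := by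
  have h3 : (3:ℝ) ≤ d := by exact_mod_cast hd
  have hd1 : (0:ℝ) < (d:ℝ) - 1 := by linarith
  have hd0 : (0:ℝ) < d := by linarith
  rw [div_lt_iff₀ (by positivity)] at hp
  have hp1 : 1 < p := by
    by_contra h
    push Not at h
    have : p * (d * ((d:ℝ) - 1)) ≤ 1 * (d * (d - 1)) := mul_le_mul_of_nonneg_right h (by positivity)
    nlinarith
  set s := ((d:ℝ)+1) / ((d:ℝ)-1) with hs
  have hs2 : 2 * ((d:ℝ)+1) / ((d:ℝ)-1) = 2 * s := by rw [hs]; ring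
  have e1 : s < d := by rw [hs, div_lt_iff₀ hd1]; nlinarith
  have e2 : s / (p - 1) < d := by
    rw [div_lt_iff₀ (by linarith), hs, div_lt_iff₀ hd1]; nlinarith
  have h0 : 0 < min (min ((d - s) / 2) ((d - s / (p-1)) / 2)) (1/2) := by
    apply lt_min (lt_min _ _) <;> linarith
  refine ⟨hp1, min (min ((d - s) / 2) ((d - s / (p-1)) / 2)) (1/2), h0, ?_, ?_, ?_⟩
  · exact (min_le_right _ _).trans_lt (by norm_num)
  · rw [hs2]
    have h1 : min (min (((d:ℝ) - s) / 2) ((d - s / (p-1)) / 2)) (1/2) ≤ (d - s / (p-1)) / 2 := (min_le_left _ _).trans (min_le_right _ _)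
    have h2 : s / (p - 1) < d - min (min (((d:ℝ) - s) / 2) ((d - s / (p-1)) / 2)) (1/2) := by linarith
    rw [div_lt_iff₀ (by linarith)] at h2
    linarith
  · rw [hs2]
    have h1 : min (min (((d:ℝ) - s) / 2) ((d - s / (p-1)) / 2)) (1/2) ≤ (d - s) / 2 := (min_le_left _ _).trans (min_le_left _ _)
    linarith

lemma Hj_sum_D (d : ℕ) (hd : 3 ≤ d) [NeZero d] (p : ℝ) (hp : ((d : ℝ) ^ 2 + 1) / ((d : ℝ) * ((d : ℝ) - 1)) < p) :
    ∃ C : ℝ≥0, ∀ R : ℝ, ∀ f : Euc d → ℂ, BdM f → ∀ D : ℝ≥0∞, D ≠ 0 → D ≠ ⊤ →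
      (∫⁻ y in ball 0 R, ‖f y‖ₑ ^ p) ^ (1/p) ≤ D → ∀ S : Finset ℤ, ∫⁻ x, (∑ j ∈ S, Hj p R f j x) ^ (p * d) ≤ C * D ^ (p * d) := by
  obtain ⟨hp1, δ, hδ0, hδ1, hc1, hc2⟩ := pick_delta d hd p hp
  have hp0 : 0 < p := by linarith
  have h3 : (3:ℝ) ≤ d := by exact_mod_cast hd
  have cond : ∀ ε : ℝ, (ε = δ ∨ ε = -δ) → ∃ C : ℝ≥0, ∀ (S : Finset ℤ), ∀ R : ℝ, ∀ f : Euc d → ℂ, BdM f →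
      ∑ j ∈ S, ∫⁻ x, (2:ℝ≥0∞) ^ (-((j:ℝ) * ε)) * Hj p R f j x ^ (p * (d + ε)) ≤
        C * ((∫⁻ y in ball 0 R, ‖f y‖ₑ ^ p) ^ (1/p)) ^ (p * (d + ε)) := by
    intro ε hε
    have hl : -δ ≤ ε := by rcases hε with rfl | rfl <;> linarith
    apply Hj_int d p ε hp1 (by linarith) (by linarith)
    apply K_main d hd p _ hp1 (mul_pos hp0 (by linarith))
    · intro _
      refine hc1.trans_le ?_
      have e : 2 * (1 - 1 / p) * (p * ((d:ℝ) + ε)) = 2 * (p - 1) * (d + ε) := by field_simp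
      rw [e]
      exact mul_le_mul_of_nonneg_left (by linarith) (by linarith)
    · intro _
      refine hc2.trans_le ?_
      have e : 2 / p * (p * ((d:ℝ) + ε)) = 2 * (d + ε) := by field_simp
      rw [e]; linarith
  obtain ⟨Cp, hCp⟩ := cond δ (Or.inl rfl)
  obtain ⟨Cm, hCm⟩ := cond (-δ) (Or.inr rfl)
  obtain ⟨K, hK⟩ := geo_sum p d δ hp0 hδ0 (by linarith)
  refine ⟨K * (Cp + Cm), fun R f hf D hD0 hDt hA S => ?_⟩
  set A := (∫⁻ y in ball 0 R, ‖f y‖ₑ ^ p) ^ (1/p) with hAdef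
  have hq : 0 ≤ p * (d:ℝ) := by positivity
  have hDD : D * D⁻¹ = 1 := ENNReal.mul_inv_cancel hD0 hDt
  have hm := fun j => Hj_meas p R hf j
  have gen : ∀ ε : ℝ, (ε = δ ∨ ε = -δ) → ∀ C : ℝ≥0, (∑ j ∈ S, ∫⁻ x, (2:ℝ≥0∞) ^ (-((j:ℝ) * ε)) * Hj p R f j x ^ (p * (d + ε)) ≤
        C * A ^ (p * (d + ε))) → ∑ j ∈ S, ∫⁻ x, (2:ℝ≥0∞) ^ (-((j:ℝ) * ε)) * (D⁻¹ * Hj p R f j x) ^ (p * (d + ε)) ≤ C := by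
    intro ε hε C hC
    have hl : -δ ≤ ε := by rcases hε with rfl | rfl <;> linarith
    have hs : 0 ≤ p * ((d:ℝ) + ε) := mul_nonneg hp0.le (by linarith)
    have e : ∀ j : ℤ, ∀ x, (2:ℝ≥0∞) ^ (-((j:ℝ) * ε)) * (D⁻¹ * Hj p R f j x) ^ (p * (d + ε)) =
      D⁻¹ ^ (p * (d + ε)) * ((2:ℝ≥0∞) ^ (-((j:ℝ) * ε)) * Hj p R f j x ^ (p * (d + ε))) := by
      intro j x
      rw [ENNReal.mul_rpow_of_nonneg _ _ hs]; ring
    simp only [e]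
    have hDi : D⁻¹ ^ (p * ((d:ℝ) + ε)) ≠ ⊤ := ENNReal.rpow_ne_top_of_nonneg hs (ENNReal.inv_ne_top.2 hD0)
    simp only [lintegral_const_mul' _ _ hDi]
    rw [← Finset.mul_sum]
    calc _ ≤ D⁻¹ ^ (p * ((d:ℝ) + ε)) * (C * D ^ (p * ((d:ℝ) + ε))) :=
          mul_le_mul_right (hC.trans (mul_le_mul_right (ENNReal.rpow_le_rpow hA hs) _)) _
      _ = C * (D * D⁻¹) ^ (p * ((d:ℝ) + ε)) := by rw [ENNReal.mul_rpow_of_nonneg _ _ hs]; ring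
      _ = C := by rw [hDD, ENNReal.one_rpow, mul_one]
  have g1 := gen δ (Or.inl rfl) Cp (hCp S R f hf)
  have g2 := gen (-δ) (Or.inr rfl) Cm (hCm S R f hf)
  simp only [mul_neg, neg_neg, ← sub_eq_add_neg] at g2
  calc ∫⁻ x, (∑ j ∈ S, Hj p R f j x) ^ (p * d) = ∫⁻ x, D ^ (p * d) * (∑ j ∈ S, D⁻¹ * Hj p R f j x) ^ (p * d) := by
        congr 1; ext x
        rw [← ENNReal.mul_rpow_of_nonneg _ _ hq, ← Finset.mul_sum, ← mul_assoc, hDD, one_mul]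
    _ = D ^ (p * d) * ∫⁻ x, (∑ j ∈ S, D⁻¹ * Hj p R f j x) ^ (p * d) := by
        rw [lintegral_const_mul' _ _ (ENNReal.rpow_ne_top_of_nonneg hq hDt)]
    _ ≤ D ^ (p * d) * ∫⁻ x, K * ∑ j ∈ S, ((2:ℝ≥0∞) ^ (-((j:ℝ) * δ)) * (D⁻¹ * Hj p R f j x) ^ (p * (d + δ)) +
      (2:ℝ≥0∞) ^ ((j:ℝ) * δ) * (D⁻¹ * Hj p R f j x) ^ (p * (d - δ))) :=
        mul_le_mul_right (lintegral_mono fun x => hK S _) _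
    _ = D ^ (p * d) * (K * ((∑ j ∈ S, ∫⁻ x, (2:ℝ≥0∞) ^ (-((j:ℝ) * δ)) * (D⁻¹ * Hj p R f j x) ^ (p * (d + δ))) +
          ∑ j ∈ S, ∫⁻ x, (2:ℝ≥0∞) ^ ((j:ℝ) * δ) * (D⁻¹ * Hj p R f j x) ^ (p * (d - δ)))) := by
        rw [lintegral_const_mul' _ _ ENNReal.coe_ne_top, lintegral_finsetSum, ← Finset.sum_add_distrib]
        · congr 2
          apply Finset.sum_congr rfl; intro j _
          rw [lintegral_add_left]
          exact (((hm j).const_mul _).pow_const _).const_mul _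
        · intro j _
          exact ((((hm j).const_mul _).pow_const _).const_mul _).add ((((hm j).const_mul _).pow_const _).const_mul _)
    _ ≤ D ^ (p * d) * (K * (Cp + Cm)) := mul_le_mul_right (mul_le_mul_right (add_le_add g1 g2) _) _
    _ = _ := by push_cast; ring

lemma Hj_sum (d : ℕ) (hd : 3 ≤ d) [NeZero d] (p : ℝ) (hp : ((d : ℝ) ^ 2 + 1) / ((d : ℝ) * ((d : ℝ) - 1)) < p) :
    ∃ C : ℝ≥0, ∀ R : ℝ, ∀ f : Euc d → ℂ, BdM f → ∀ S : Finset ℤ,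
      ∫⁻ x, (∑ j ∈ S, Hj p R f j x) ^ (p * d) ≤ C * ((∫⁻ y in ball 0 R, ‖f y‖ₑ ^ p) ^ (1/p)) ^ (p * d) := by
  obtain ⟨C, hC⟩ := Hj_sum_D d hd p hp
  obtain ⟨hp1, -⟩ := pick_delta d hd p hp
  have hp0 : 0 < p := by linarith
  have hdd : (0:ℝ) < d := by exact_mod_cast (by omega : 0 < d)
  refine ⟨C, fun R f hf S => ?_⟩
  have hlt : ∫⁻ y in ball (0 : Euc d) R, ‖f y‖ₑ ^ p ≠ ⊤ := by
    obtain ⟨_, M, hM⟩ := hf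
    refine ne_top_of_le_ne_top ?_ (lintegral_mono fun y => ENNReal.rpow_le_rpow (show ‖f y‖ₑ ≤ ENNReal.ofReal M by
      rw [← ofReal_norm]; exact ENNReal.ofReal_le_ofReal (hM y)) hp0.le)
    rw [setLIntegral_const]
    exact ENNReal.mul_ne_top (ENNReal.rpow_ne_top_of_nonneg hp0.le ENNReal.ofReal_ne_top) measure_ball_lt_top.ne
  set A := (∫⁻ y in ball 0 R, ‖f y‖ₑ ^ p) ^ (1/p) with hA
  have hAt : A ≠ ⊤ := ENNReal.rpow_ne_top_of_nonneg (by positivity) hlt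
  have ht : Filter.Tendsto (fun n : ℕ => C * (A + ((n:ℝ≥0∞) + 1)⁻¹) ^ (p * (d:ℝ))) Filter.atTop (nhds (C * (A + 0) ^ (p * (d:ℝ)))) := by
    apply ENNReal.Tendsto.const_mul _ (Or.inr ENNReal.coe_ne_top)
    apply Filter.Tendsto.ennrpow_const
    apply Filter.Tendsto.const_add
    have := (Filter.tendsto_add_atTop_iff_nat 1).2 ENNReal.tendsto_inv_nat_nhds_zero
    simpa using this
  rw [add_zero] at ht
  refine ge_of_tendsto' ht fun n => hC R f hf _ ?_ ?_ le_self_add S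
  · simp
  · rw [ENNReal.add_ne_top]; exact ⟨hAt, by simp⟩

lemma rVar_liminf2 (a : ℕ → ℝ → ℂ) (a' : ℝ → ℂ) (r : ℝ) (hr : 1 ≤ r) (E : Set ℝ) (B : ℕ → ℝ≥0∞)
    (hlim : ∀ t ∈ E, Filter.Tendsto (fun n => a n t) Filter.atTop (nhds (a' t)))
    (hB : ∀ n, rVar r E (a n) ≤ B n) : rVar r E a' ≤ Filter.liminf B Filter.atTop := by
  apply rVar_le
  intro N t ht hE
  have hr0 : 0 < r := by linarith
  have h : Filter.Tendsto (fun n => (∑ i : Fin N, (‖a n (t i.succ) - a n (t i.castSucc)‖ₑ) ^ r) ^ (1 / r)) Filter.atTop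
      (nhds ((∑ i : Fin N, (‖a' (t i.succ) - a' (t i.castSucc)‖ₑ) ^ r) ^ (1 / r))) := by
    apply Filter.Tendsto.ennrpow_const
    apply tendsto_finsetSum
    intro i _
    apply Filter.Tendsto.ennrpow_const
    exact ((hlim _ (hE _)).sub (hlim _ (hE _))).enorm
  rw [← h.liminf_eq]
  exact Filter.liminf_le_liminf (Filter.Eventually.of_forall fun n => (le_rVar (a := a n) N t ht hE).trans (hB n))

/-- the variation of the spherical means has a measurable majorant with controlled norm -/
def Good {d : ℕ} (p q : ℝ) (f : Euc d → ℂ) (B : ℝ≥0∞) : Prop :=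
  ∃ W : Euc d → ℝ≥0∞, Measurable W ∧ (∀ᵐ x, VrIA p f x ≤ W x) ∧ ∫⁻ x, W x ^ q ≤ B

lemma good_lim {d : ℕ} (p q : ℝ) (hp : 1 ≤ p) (hq : 0 < q) (fn : ℕ → Euc d → ℂ) (f : Euc d → ℂ) (B : ℕ → ℝ≥0∞)
    (hg : ∀ n, Good p q (fn n) (B n))
    (hlim : ∀ᵐ x, ∀ t ∈ Icc (1:ℝ) 2, Filter.Tendsto (fun n => sphAvg (fn n) t x) Filter.atTop (nhds (sphAvg f t x))) :
    Good p q f (Filter.liminf B Filter.atTop) := by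
  choose W hW1 hW2 hW3 using hg
  refine ⟨fun x => Filter.liminf (fun n => W n x) Filter.atTop, Measurable.liminf hW1, ?_, ?_⟩
  · filter_upwards [hlim, ae_all_iff.2 hW2] with x h1 h2
    exact rVar_liminf2 (fun n t => sphAvg (fn n) t x) (fun t => sphAvg f t x) p hp _ _ h1 h2
  · calc _ = ∫⁻ x, Filter.liminf (fun n => W n x ^ q) Filter.atTop := by
          congr 1; ext x
          exact (ENNReal.orderIsoRpow q hq).liminf_apply
      _ ≤ Filter.liminf (fun n => ∫⁻ x, W n x ^ q) Filter.atTop := lintegral_liminf_le fun n => (hW1 n).pow_const _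
      _ ≤ _ := Filter.liminf_le_liminf (Filter.Eventually.of_forall hW3)

def phi (d : ℕ) : SchwartzMap (Euc d) ℂ := 𝓕⁻ (bBS d)

lemma phi_apply {d : ℕ} (u : Euc d) : phi d u = 𝓕⁻ (fun x => bBS d x) u := by
  unfold phi
  rw [SchwartzMap.fourierInv_coe]

lemma phi_integral (d : ℕ) : ∫ u, phi d u = 1 := by
  have h : 𝓕 (phi d) = bBS d := by
    unfold phi; exact FourierTransform.fourier_fourierInv_eq _
  have h2 : (𝓕 (phi d) : SchwartzMap (Euc d) ℂ) 0 = 1 := by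
    rw [h, bBS_apply, bB_one (by simp)]; simp
  rw [SchwartzMap.fourier_coe, Real.fourier_eq] at h2
  simpa using h2

lemma psi_phi {d : ℕ} (m : ℝ) (hm : 0 < m) (v : Euc d) :
    ((m ^ d : ℝ) : ℂ) * psi d (m • v) = ((m ^ d : ℝ) : ℂ) * phi d (m • v) - (((m/2) ^ d : ℝ) : ℂ) * phi d ((m/2) • v) := by
  rw [psi_apply, phi_apply, phi_apply, ← fInv_scale _ m hm, ← fInv_scale _ m hm, ← fInv_scale _ (m/2) (by positivity),
    fInv_ee, fInv_ee, fInv_ee, ← integral_sub]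
  · congr 1; ext ξ
    rw [bAS_apply, bBS_apply, bBS_apply, smul_smul, inv_div, div_eq_mul_inv]
    push_cast; ring
  all_goals
    apply Continuous.integrable_of_hasCompactSupport
    · exact (continuous_ee.comp (by fun_prop)).mul ((bBS d).continuous.comp (by fun_prop))
    · apply HasCompactSupport.mul_left
      apply HasCompactSupport.comp_smul (f := fun x => bBS d x) _ (by positivity)
      exact (bB_supp.comp_left (g := fun x : ℝ => (x : ℂ)) (by simp))

def PhiF {d : ℕ} (R : ℝ) (f : Euc d → ℂ) (m : ℝ) (u : Euc d) : ℂ :=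
  ∫ y in ball 0 R, ((m ^ d : ℝ) : ℂ) * phi d (m • (u - y)) * f y

lemma phi_int {d : ℕ} (R m : ℝ) {f : Euc d → ℂ} (hf : BdM f) (u : Euc d) :
    IntegrableOn (fun y => ((m ^ d : ℝ) : ℂ) * phi d (m • (u - y)) * f y) (ball 0 R) := by
  obtain ⟨hfm, M, hM⟩ := hf
  obtain ⟨c, hc, h⟩ := schwartz_bound (phi d) 0
  refine Measure.integrableOn_of_bounded (M := |m ^ d| * c * M) measure_ball_lt_top.ne ?_ ?_
  · refine AEStronglyMeasurable.mul ?_ hfm.aestronglyMeasurable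
    exact (continuous_const.mul ((phi d).continuous.comp (by fun_prop))).aestronglyMeasurable
  · refine Filter.Eventually.of_forall fun y => ?_
    rw [norm_mul, norm_mul, Complex.norm_real, Real.norm_eq_abs]
    have := h (m • (u - y))
    simp only [pow_zero, inv_one, mul_one] at this
    gcongr
    exact hM y

lemma fInv_Um_phi {d : ℕ} (R m : ℝ) (hm : 0 < m) {f : Euc d → ℂ} (hf : BdM f) (u : Euc d) :
    𝓕⁻ (Um R m f) u = PhiF R f m u - PhiF R f (m/2) u := by
  rw [fInv_Um R m hm hf]
  unfold PhiF
  rw [← integral_sub (phi_int R m hf u) (phi_int R (m/2) hf u)]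
  congr 1; ext y
  rw [psi_phi m hm]; ring

def SJ (J : ℕ) : Finset ℤ := (Finset.range (2 * J)).map ⟨fun i : ℕ => (i:ℤ) + 1 - J, by intro a b h; simpa using h⟩

lemma FJ_eq {d : ℕ} (R : ℝ) {f : Euc d → ℂ} (hf : BdM f) (J : ℕ) (u : Euc d) :
    ∑ j ∈ SJ J, 𝓕⁻ (Um R ((2:ℝ)^j) f) u = PhiF R f ((2:ℝ)^J) u - PhiF R f (((2:ℝ)^J)⁻¹) u := by
  unfold SJ
  rw [Finset.sum_map]
  have := Finset.sum_range_sub (fun i : ℕ => PhiF R f ((2:ℝ)^((i:ℤ) - J)) u) (2 * J)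
  rw [show ((2 * J : ℕ) : ℤ) - J = (J : ℕ) by push_cast; ring, show ((0:ℕ):ℤ) - J = -(J:ℤ) by simp, zpow_natCast, zpow_neg, zpow_natCast] at this
  rw [← this]
  apply Finset.sum_congr rfl
  intro i _
  show 𝓕⁻ (Um R ((2:ℝ)^((i:ℤ) + 1 - J)) f) u = _
  rw [fInv_Um_phi R _ (by positivity) hf]
  have e : (2:ℝ) ^ ((i:ℤ) + 1 - J) / 2 = 2 ^ ((i:ℤ) - J) := by
    rw [show (i:ℤ) + 1 - J = ((i:ℤ) - J) + 1 by ring, zpow_add_one₀ (by norm_num)]; simp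
  rw [e]; push_cast; rfl

lemma PhiF_conv {d : ℕ} (R : ℝ) {f : Euc d → ℂ} (hsupp : ∀ y ∉ ball (0 : Euc d) R, f y = 0) (m : ℝ) (hm : 0 < m)
    (u : Euc d) : PhiF R f m u = ∫ v, phi d v * f (u - m⁻¹ • v) := by
  unfold PhiF
  rw [setIntegral_eq_integral_of_forall_compl_eq_zero (fun y hy => by rw [hsupp y hy, mul_zero])]
  rw [← integral_sub_left_eq_self _ volume u]
  have := Measure.integral_comp_smul (volume : Measure (Euc d)) (fun v => phi d v * f (u - m⁻¹ • v)) m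
  have e : ∀ y : Euc d, ((m ^ d : ℝ) : ℂ) * phi d (m • (u - (u - y))) * f (u - y) =
      ((m ^ d : ℝ) : ℂ) * (phi d (m • y) * f (u - m⁻¹ • m • y)) := by
    intro y
    rw [sub_sub_cancel, smul_smul, inv_mul_cancel₀ hm.ne', one_smul, mul_assoc]
  simp only [e]
  rw [integral_const_mul, this, finrank_euclideanSpace, Fintype.card_fin, abs_of_pos (by positivity), Complex.real_smul,
    ← mul_assoc, ← Complex.ofReal_mul, mul_inv_cancel₀ (by positivity)]
  simp

lemma PhiF_bound {d : ℕ} (R : ℝ) {f : Euc d → ℂ} (hsupp : ∀ y ∉ ball (0 : Euc d) R, f y = 0) (M : ℝ)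
    (hM : ∀ y, ‖f y‖ ≤ M) (m : ℝ) (hm : 0 < m) (u : Euc d) : ‖PhiF R f m u‖ ≤ (∫ v, ‖phi d v‖) * M := by
  rw [PhiF_conv R hsupp m hm, ← integral_mul_const]
  refine norm_integral_le_of_norm_le ((phi d).integrable.norm.mul_const _) (Filter.Eventually.of_forall fun v => ?_)
  rw [norm_mul]
  exact mul_le_mul_of_nonneg_left (hM _) (norm_nonneg _)

lemma PhiF_small {d : ℕ} [NeZero d] (R : ℝ) {f : Euc d → ℂ} (hf : BdM f) (u : Euc d) :
    Filter.Tendsto (fun J : ℕ => PhiF R f (((2:ℝ)^J)⁻¹) u) Filter.atTop (nhds 0) := by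
  obtain ⟨hfm, M, hM⟩ := id hf
  obtain ⟨c, hc, h⟩ := schwartz_bound (phi d) 0
  have hM0 : 0 ≤ M := (norm_nonneg _).trans (hM 0)
  have hb : ∀ J : ℕ, ‖PhiF R f (((2:ℝ)^J)⁻¹) u‖ ≤ (1/2:ℝ)^J * (c * M * volume.real (ball (0 : Euc d) R)) := by
    intro J
    unfold PhiF
    have := norm_setIntegral_le_of_norm_le_const (μ := volume) (s := ball (0 : Euc d) R) (C := (1/2:ℝ)^J * (c * M))
      (f := fun y => (((((2:ℝ)^J)⁻¹) ^ d : ℝ) : ℂ) * phi d ((((2:ℝ)^J)⁻¹) • (u - y)) * f y) measure_ball_lt_top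
      (fun y _ => by
        rw [norm_mul, norm_mul, Complex.norm_real, Real.norm_of_nonneg (by positivity), mul_assoc]
        have h1 := h ((((2:ℝ)^J)⁻¹) • (u - y))
        simp only [pow_zero, inv_one, mul_one] at h1
        have h2 : (((2:ℝ)^J)⁻¹) ^ d ≤ (1/2:ℝ)^J := by
          rw [show (1/2:ℝ)^J = ((2:ℝ)^J)⁻¹ by rw [one_div, inv_pow]]
          have h0 : (0:ℝ) ≤ ((2:ℝ)^J)⁻¹ := by positivity
          have h1le : ((2:ℝ)^J)⁻¹ ≤ 1 := inv_le_one_of_one_le₀ (one_le_pow₀ (by norm_num))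
          exact pow_le_of_le_one h0 h1le (NeZero.ne d)
        have h3 := hM y
        gcongr)
    linarith
  refine squeeze_zero_norm hb ?_
  have := (tendsto_pow_atTop_nhds_zero_of_lt_one (show (0:ℝ) ≤ 1/2 by norm_num) (by norm_num)).mul_const
    (c * M * volume.real (ball (0 : Euc d) R))
  simpa using this

lemma PhiF_tendsto {d : ℕ} (R : ℝ) {f : Euc d → ℂ} (hsupp : ∀ y ∉ ball (0 : Euc d) R, f y = 0) (hfc : Continuous f) (M : ℝ)
    (hM : ∀ y, ‖f y‖ ≤ M) (u : Euc d) :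
    Filter.Tendsto (fun J : ℕ => PhiF R f ((2:ℝ)^J) u) Filter.atTop (nhds (f u)) := by
  have e : ∀ J : ℕ, PhiF R f ((2:ℝ)^J) u = ∫ v, phi d v * f (u - ((2:ℝ)^J)⁻¹ • v) := fun J =>
    PhiF_conv R hsupp _ (by positivity) u
  simp only [e]
  have e2 : f u = ∫ v, phi d v * f u := by rw [integral_mul_const, phi_integral, one_mul]
  rw [e2]
  refine tendsto_integral_of_dominated_convergence (fun v => ‖phi d v‖ * M) ?_ ((phi d).integrable.norm.mul_const _) ?_ ?_
  · intro J
    exact ((phi d).continuous.mul (hfc.comp (by fun_prop))).aestronglyMeasurable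
  · intro J
    refine Filter.Eventually.of_forall fun v => ?_
    rw [norm_mul]
    exact mul_le_mul_of_nonneg_left (hM _) (norm_nonneg _)
  · refine Filter.Eventually.of_forall fun v => ?_
    apply Filter.Tendsto.const_mul
    have h1 : Filter.Tendsto (fun J : ℕ => ((2:ℝ)^J)⁻¹) Filter.atTop (nhds 0) := by
      have := tendsto_pow_atTop_nhds_zero_of_lt_one (show (0:ℝ) ≤ 1/2 by norm_num) (by norm_num)
      simpa using this
    have h2 : Filter.Tendsto (fun J : ℕ => u - ((2:ℝ)^J)⁻¹ • v) Filter.atTop (nhds u) := by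
      have := (h1.smul_const v).const_sub u
      simpa using this
    exact (hfc.tendsto u).comp h2

/-- the sufficiency for continuous compactly supported functions -/
lemma good_Cc (d : ℕ) (hd : 3 ≤ d) [NeZero d] (p : ℝ) (hp : ((d : ℝ) ^ 2 + 1) / ((d : ℝ) * ((d : ℝ) - 1)) < p) :
    ∃ C : ℝ≥0, ∀ f : Euc d → ℂ, Continuous f → HasCompactSupport f →
      Good p (p * d) f (C * ((∫⁻ y, ‖f y‖ₑ ^ p) ^ (1/p)) ^ (p * d)) := by
  obtain ⟨C, hC⟩ := Hj_sum d hd p hp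
  obtain ⟨hp1, -⟩ := pick_delta d hd p hp
  have hp0 : 0 < p := by linarith
  have hdd : (0:ℝ) < d := by exact_mod_cast (by omega : 0 < d)
  refine ⟨C, fun f hfc hfs => ?_⟩
  obtain ⟨M, hM⟩ := hfs.exists_bound_of_continuous hfc
  have hf : BdM f := ⟨hfc.measurable, M, hM⟩
  obtain ⟨R, hR⟩ := hfs.isCompact.isBounded.subset_ball (0 : Euc d)
  have hsupp : ∀ y ∉ ball (0 : Euc d) R, f y = 0 := fun y hy => image_eq_zero_of_notMem_tsupport fun h => hy (hR h)
  have hcont : ∀ j : ℤ, Continuous (𝓕⁻ (Um R ((2:ℝ)^j) f)) := fun j =>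
    continuous_fInv ((Um_cont R _ hf).integrable_of_hasCompactSupport (Um_supp R _ (by positivity) f))
  have hg : ∀ J : ℕ, Good p (p * d) (fun u => ∑ j ∈ SJ J, 𝓕⁻ (Um R ((2:ℝ)^j) f) u) (C * ((∫⁻ y, ‖f y‖ₑ ^ p) ^ (1/p)) ^ (p * d)) := by
    intro J
    refine ⟨fun x => ∑ j ∈ SJ J, Hj p R f j x, Finset.measurable_sum _ fun j _ => Hj_meas p R hf j, ?_, ?_⟩
    · refine Filter.Eventually.of_forall fun x => ?_
      unfold VrIA
      have e : (fun t => sphAvg (fun u => ∑ j ∈ SJ J, 𝓕⁻ (Um R ((2:ℝ)^j) f) u) t x) =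
          fun t => ∑ j ∈ SJ J, sphAvg (𝓕⁻ (Um R ((2:ℝ)^j) f)) t x := by
        ext t
        unfold sphAvg
        rw [integral_finsetSum]
        intro j _
        exact integrable_sphere ((hcont j).comp (by fun_prop))
      rw [e]
      exact (rVar_sum _ (fun j t => sphAvg (𝓕⁻ (Um R ((2:ℝ)^j) f)) t x) p hp1.le _).trans
        (Finset.sum_le_sum fun j _ => rVar_Hj p R hp1 hf j x)
    · refine (hC R f hf (SJ J)).trans (mul_le_mul_right ?_ _)
      exact ENNReal.rpow_le_rpow (ENNReal.rpow_le_rpow (setLIntegral_le_lintegral _ _) (by positivity)) (by positivity)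
  have := good_lim p (p * d) hp1.le (by positivity) _ f _ hg ?_
  · simpa using this
  · refine Filter.Eventually.of_forall fun x t _ => ?_
    unfold sphAvg
    refine tendsto_integral_of_dominated_convergence (fun _ => 2 * ((∫ v, ‖phi d v‖) * M)) ?_ (integrable_const _) ?_ ?_
    · intro J
      exact (continuous_finsetSum _ fun j _ => (hcont j).comp (by fun_prop)).aestronglyMeasurable
    · intro J
      refine Filter.Eventually.of_forall fun y => ?_
      beta_reduce
      rw [FJ_eq R hf]
      have h1 := PhiF_bound R hsupp M hM ((2:ℝ)^J) (by positivity) (x - t • y)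
      have h2 := PhiF_bound R hsupp M hM (((2:ℝ)^J)⁻¹) (by positivity) (x - t • y)
      refine (norm_sub_le _ _).trans ?_
      linarith
    · refine Filter.Eventually.of_forall fun y => ?_
      simp only [FJ_eq R hf]
      have := (PhiF_tendsto R hsupp hfc M hM (x - t • y)).sub (PhiF_small R hf (x - t • y))
      simpa using this

lemma jensen_prob {α : Type*} [MeasurableSpace α] (μ : Measure α) [IsProbabilityMeasure μ] (F : α → ℝ≥0∞)
    (hF : AEMeasurable F μ) (p : ℝ) (hp : 1 < p) : ∫⁻ a, F a ∂μ ≤ (∫⁻ a, F a ^ p ∂μ) ^ (1/p) := by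
  have hpq : p.HolderConjugate (Real.conjExponent p) := Real.HolderConjugate.conjExponent hp
  have h := ENNReal.lintegral_mul_le_Lp_mul_Lq μ hpq (f := F) (g := fun _ => 1) hF aemeasurable_const
  simpa using h

lemma avg_polar {d : ℕ} [NeZero d] (h : Euc d → ℝ≥0∞) (hh : Measurable h) (x : Euc d) :
    ∫⁻ s in Icc (1:ℝ) 2, ∫⁻ y, h (x - s • y) ∂(sphereMeasure d) ≤ (cS d)⁻¹ * ∫⁻ y, h y := by
  have e : ∫⁻ y, h y = ∫⁻ y, h (x - y) := (lintegral_sub_left_eq_self h x).symm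
  rw [e, lintegral_polar (g := fun y => h (x - y)) (by fun_prop), ← mul_assoc,
    ENNReal.inv_mul_cancel cS_ne_zero cS_ne_top, one_mul]
  calc _ ≤ ∫⁻ s in Icc (1:ℝ) 2, ENNReal.ofReal (s ^ (d-1)) * ∫⁻ y, h (x - s • y) ∂(sphereMeasure d) := by
        refine setLIntegral_mono' measurableSet_Icc fun s hs => ?_
        refine le_mul_of_one_le_left' ?_
        rw [ENNReal.one_le_ofReal]
        exact one_le_pow₀ hs.1
    _ ≤ _ := lintegral_mono_set fun s hs => lt_of_lt_of_le one_pos hs.1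

lemma avg_Lp {d : ℕ} [NeZero d] (h : Euc d → ℝ≥0∞) (hh : Measurable h) (x : Euc d) (p : ℝ) (hp : 1 < p) :
    ∫⁻ s in Icc (1:ℝ) 2, ∫⁻ y, h (x - s • y) ∂(sphereMeasure d) ≤ ((cS d)⁻¹ * ∫⁻ y, h y ^ p) ^ (1/p) := by
  haveI : IsProbabilityMeasure (volume.restrict (Icc (1:ℝ) 2)) := ⟨by simp; norm_num⟩
  have hm : Measurable fun z : ℝ × Euc d => h (x - z.1 • z.2) := by fun_prop
  have h1 := lintegral_prod (μ := volume.restrict (Icc (1:ℝ) 2)) (ν := sphereMeasure d) _ hm.aemeasurable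
  rw [← h1]
  refine (jensen_prob _ _ hm.aemeasurable p hp).trans ?_
  refine ENNReal.rpow_le_rpow ?_ (by positivity)
  rw [lintegral_prod _ (hm.pow_const p).aemeasurable]
  exact avg_polar (fun y => h y ^ p) (hh.pow_const p) x

lemma diff_le_rVar {r : ℝ} (hr : 1 ≤ r) {E : Set ℝ} {a : ℝ → ℂ} {s t : ℝ} (hs : s ∈ E) (ht : t ∈ E) :
    ‖a t - a s‖ₑ ≤ rVar r E a := by
  have key : ∀ s t : ℝ, s ∈ E → t ∈ E → s < t → ‖a t - a s‖ₑ ≤ rVar r E a := by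
    intro s t hs ht hst
    have := le_rVar (r := r) (E := E) (a := a) 1 ![s, t] (by
      intro i j hij
      fin_cases i <;> fin_cases j <;> simp_all) (by intro i; fin_cases i <;> simp_all)
    simp only [Finset.univ_unique, Fin.default_eq_zero, Finset.sum_singleton] at this
    rw [← ENNReal.rpow_mul, mul_one_div_cancel (by linarith), ENNReal.rpow_one] at this
    simpa using this
  rcases lt_trichotomy s t with h | h | h
  · exact key s t hs ht h
  · subst h; simp
  · rw [enorm_sub_comm']; exact key t s ht hs h

/-- control of the maximal function, uniformly in the radius -/
def MG {d : ℕ} (C : ℝ≥0) (q : ℝ) (h : Euc d → ℝ≥0∞) (b : ℝ≥0∞) : Prop :=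
  ∃ W : Euc d → ℝ≥0∞, Measurable W ∧
    (∀ᵐ x, ∀ t ∈ Icc (1:ℝ) 2, ∫⁻ y, h (x - t • y) ∂(sphereMeasure d) ≤ W x + C * b) ∧ ∫⁻ x, W x ^ q ≤ C * b ^ q

lemma MG_mono {d : ℕ} {C : ℝ≥0} {q : ℝ} (hq : 0 ≤ q) {h : Euc d → ℝ≥0∞} {b b' : ℝ≥0∞} (hb : b ≤ b') (H : MG C q h b) :
    MG C q h b' := by
  obtain ⟨W, h1, h2, h3⟩ := H
  refine ⟨W, h1, ?_, h3.trans (mul_le_mul_right (ENNReal.rpow_le_rpow hb hq) _)⟩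
  filter_upwards [h2] with x hx t ht
  exact (hx t ht).trans (add_le_add le_rfl (mul_le_mul_right hb _))

lemma MG_fatou {d : ℕ} {C : ℝ≥0} {q : ℝ} (hq : 0 < q) (hn : ℕ → Euc d → ℝ≥0∞) (hm : ∀ n, Measurable (hn n)) (h : Euc d → ℝ≥0∞)
    {b : ℝ≥0∞} (H : ∀ n, MG C q (hn n) b) (hl : ∀ x, h x ≤ Filter.liminf (fun n => hn n x) Filter.atTop) :
    MG C q h b := by
  choose W h1 h2 h3 using H
  refine ⟨fun x => Filter.liminf (fun n => W n x) Filter.atTop, Measurable.liminf h1, ?_, ?_⟩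
  · filter_upwards [ae_all_iff.2 h2] with x hx t ht
    calc _ ≤ ∫⁻ y, Filter.liminf (fun n => hn n (x - t • y)) Filter.atTop ∂(sphereMeasure d) := lintegral_mono fun y => hl _
      _ ≤ Filter.liminf (fun n => ∫⁻ y, hn n (x - t • y) ∂(sphereMeasure d)) Filter.atTop :=
          lintegral_liminf_le fun n => (hm n).comp (by fun_prop)
      _ ≤ Filter.liminf (fun n => W n x + C * b) Filter.atTop :=
          Filter.liminf_le_liminf (Filter.Eventually.of_forall fun n => hx n t ht)
      _ = _ := liminf_add_const _ _ _ (by isBoundedDefault) (by isBoundedDefault)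
  · calc _ = ∫⁻ x, Filter.liminf (fun n => W n x ^ q) Filter.atTop := by
          congr 1; ext x
          exact (ENNReal.orderIsoRpow q hq).liminf_apply
      _ ≤ Filter.liminf (fun n => ∫⁻ x, W n x ^ q) Filter.atTop := lintegral_liminf_le fun n => (h1 n).pow_const _
      _ ≤ Filter.liminf (fun _ : ℕ => C * b ^ q) Filter.atTop := Filter.liminf_le_liminf (Filter.Eventually.of_forall h3)
      _ = _ := Filter.liminf_const _

lemma MG_Cc (d : ℕ) (hd : 3 ≤ d) [NeZero d] (p : ℝ) (hp : ((d : ℝ) ^ 2 + 1) / ((d : ℝ) * ((d : ℝ) - 1)) < p) :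
    ∃ C : ℝ≥0, ∀ g : Euc d → ℂ, Continuous g → HasCompactSupport g →
      MG C (p * d) (fun y => ‖g y‖ₑ) ((∫⁻ y, ‖g y‖ₑ ^ p) ^ (1/p)) := by
  obtain ⟨C, hC⟩ := good_Cc d hd p hp
  obtain ⟨hp1, -⟩ := pick_delta d hd p hp
  have hp0 : 0 < p := by linarith
  have hdd : (0:ℝ) < d := by exact_mod_cast (by omega : 0 < d)
  obtain ⟨c, hc⟩ : ∃ c : ℝ≥0, (c : ℝ≥0∞) = ((cS d)⁻¹) ^ (1/p) :=
    ⟨(((cS d)⁻¹) ^ (1/p)).toNNReal, ENNReal.coe_toNNReal (ENNReal.rpow_ne_top_of_nonneg (by positivity) (ENNReal.inv_ne_top.2 cS_ne_zero))⟩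
  refine ⟨max C c, fun g hg hgs => ?_⟩
  have hg' : Continuous fun y => ((‖g y‖ : ℝ) : ℂ) := by fun_prop
  obtain ⟨W, h1, h2, h3⟩ := hC (fun y => ((‖g y‖ : ℝ) : ℂ)) hg' (hgs.comp_left (g := fun z : ℂ => ((‖z‖ : ℝ) : ℂ)) (by simp))
  have en : ∀ y, ‖((‖g y‖ : ℝ) : ℂ)‖ₑ = ‖g y‖ₑ := fun y => by
    rw [← ofReal_norm, Complex.norm_real, norm_norm, ofReal_norm]
  simp only [en] at h3
  refine ⟨W, h1, ?_, h3.trans (mul_le_mul_left (by exact_mod_cast le_max_left _ _) _)⟩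
  filter_upwards [h2] with x hx t ht
  have ea : ∀ s : ℝ, ‖sphAvg (fun y => ((‖g y‖ : ℝ) : ℂ)) s x‖ₑ = ∫⁻ y, ‖g (x - s • y)‖ₑ ∂(sphereMeasure d) := by
    intro s
    unfold sphAvg
    rw [integral_complex_ofReal, ← ofReal_norm, Complex.norm_real, Real.norm_of_nonneg (integral_nonneg fun _ => norm_nonneg _),
      ofReal_integral_norm_eq_lintegral_enorm]
    exact integrable_sphere (hg.comp (by fun_prop))
  have hk : ∀ s ∈ Icc (1:ℝ) 2, ∫⁻ y, ‖g (x - t • y)‖ₑ ∂(sphereMeasure d) ≤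
      W x + ∫⁻ y, ‖g (x - s • y)‖ₑ ∂(sphereMeasure d) := by
    intro s hs
    rw [← ea, ← ea]
    have := (diff_le_rVar hp1.le (a := fun t => sphAvg (fun y => ((‖g y‖ : ℝ) : ℂ)) t x) hs ht).trans hx
    refine le_trans ?_ (add_le_add_left this _)
    refine le_trans (le_of_eq ?_) (enorm_add_le _ _)
    simp
  calc ∫⁻ y, ‖g (x - t • y)‖ₑ ∂(sphereMeasure d) = ∫⁻ s in Icc (1:ℝ) 2, ∫⁻ y, ‖g (x - t • y)‖ₑ ∂(sphereMeasure d) := by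
        rw [lintegral_const]; simp; norm_num
    _ ≤ ∫⁻ s in Icc (1:ℝ) 2, (W x + ∫⁻ y, ‖g (x - s • y)‖ₑ ∂(sphereMeasure d)) :=
        setLIntegral_mono' measurableSet_Icc hk
    _ = W x + ∫⁻ s in Icc (1:ℝ) 2, ∫⁻ y, ‖g (x - s • y)‖ₑ ∂(sphereMeasure d) := by
        rw [lintegral_add_left measurable_const, lintegral_const]; simp; norm_num
    _ ≤ _ := by
        refine add_le_add le_rfl ((avg_Lp (fun y => ‖g y‖ₑ) hg.measurable.enorm x p hp1).trans ?_)
        rw [ENNReal.mul_rpow_of_nonneg _ _ (by positivity), ← hc]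
        exact mul_le_mul_left (by exact_mod_cast le_max_right _ _) _

lemma ae_summable {α : Type*} [MeasurableSpace α] (μ : Measure α) (g : ℕ → α → ℝ≥0∞) (hg : ∀ n, AEMeasurable (g n) μ)
    (Q : ℝ) (hQ : 1 ≤ Q) (C : ℝ≥0∞) (hC : C ≠ ∞) (h : ∀ n, ∫⁻ x, g n x ^ Q ∂μ ≤ C * (((4:ℝ≥0∞)⁻¹)^n)^Q) :
    ∀ᵐ x ∂μ, ∑' n, g n x ≠ ∞ := by
  have hQ0 : 0 < Q := by linarith
  have hle : ∀ n : ℕ, ((2:ℝ≥0∞)^n)^Q * (((4:ℝ≥0∞)⁻¹)^n)^Q ≤ ((2:ℝ≥0∞)⁻¹)^n := by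
    intro n
    rw [← ENNReal.mul_rpow_of_nonneg _ _ hQ0.le, ← mul_pow]
    have e : (2:ℝ≥0∞) * 4⁻¹ = 2⁻¹ := by
      rw [show (4:ℝ≥0∞) = 2 * 2 by norm_num, ENNReal.mul_inv (by simp) (by simp), ← mul_assoc,
        ENNReal.mul_inv_cancel (by simp) (by simp), one_mul]
    rw [e]
    calc (((2:ℝ≥0∞)⁻¹)^n)^Q ≤ (((2:ℝ≥0∞)⁻¹)^n)^(1:ℝ) :=
          ENNReal.rpow_le_rpow_of_exponent_ge (pow_le_one₀ zero_le (by simp)) hQ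
      _ = _ := ENNReal.rpow_one _
  have hI : ∫⁻ x, ∑' n, ((2:ℝ≥0∞)^n * g n x)^Q ∂μ ≠ ∞ := by
    rw [lintegral_tsum fun n => ((hg n).const_mul _).pow_const _]
    refine ne_top_of_le_ne_top (b := ∑' n : ℕ, C * ((2:ℝ≥0∞)⁻¹)^n) ?_ (ENNReal.tsum_le_tsum fun n => ?_)
    · rw [ENNReal.tsum_mul_left, ENNReal.tsum_geometric]
      refine ENNReal.mul_ne_top hC ?_
      simp
    · simp_rw [ENNReal.mul_rpow_of_nonneg _ _ hQ0.le]
      rw [lintegral_const_mul' _ _ (ENNReal.rpow_ne_top_of_nonneg hQ0.le (by simp))]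
      calc _ ≤ ((2:ℝ≥0∞)^n)^Q * (C * (((4:ℝ≥0∞)⁻¹)^n)^Q) := mul_le_mul_right (h n) _
        _ = C * (((2:ℝ≥0∞)^n)^Q * (((4:ℝ≥0∞)⁻¹)^n)^Q) := by ring
        _ ≤ _ := mul_le_mul_right (hle n) _
  filter_upwards [ae_lt_top' (AEMeasurable.tsum fun n => ((hg n).const_mul _).pow_const _) hI] with x hx
  obtain ⟨T, hT⟩ : ∃ T, T = ∑' n, ((2:ℝ≥0∞)^n * g n x)^Q := ⟨_, rfl⟩
  rw [← hT] at hx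
  refine ne_top_of_le_ne_top (b := ∑' n : ℕ, T ^ (1/Q) * ((2:ℝ≥0∞)⁻¹)^n) ?_ (ENNReal.tsum_le_tsum fun n => ?_)
  · rw [ENNReal.tsum_mul_left, ENNReal.tsum_geometric]
    refine ENNReal.mul_ne_top (ENNReal.rpow_ne_top_of_nonneg (by positivity) hx.ne) ?_
    simp
  · have h1 : ((2:ℝ≥0∞)^n * g n x)^Q ≤ T := hT ▸ ENNReal.le_tsum n
    have h2 : (2:ℝ≥0∞)^n * g n x ≤ T ^ (1/Q) := by
      have := ENNReal.rpow_le_rpow h1 (show 0 ≤ 1/Q by positivity)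
      rwa [← ENNReal.rpow_mul, mul_one_div_cancel hQ0.ne', ENNReal.rpow_one] at this
    calc g n x = ((2:ℝ≥0∞)^n * g n x) * ((2:ℝ≥0∞)⁻¹)^n := by
          rw [mul_right_comm, ← mul_pow, ENNReal.mul_inv_cancel (by simp) (by simp), one_pow, one_mul]
      _ ≤ _ := mul_le_mul_left h2 _

lemma MG_open {d : ℕ} [NeZero d] (p q : ℝ) (hp : 1 < p) (hq : 0 < q) (C : ℝ≥0)
    (hC : ∀ g : Euc d → ℂ, Continuous g → HasCompactSupport g → MG C q (fun y => ‖g y‖ₑ) ((∫⁻ y, ‖g y‖ₑ ^ p) ^ (1/p)))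
    (U : Set (Euc d)) (hU : IsOpen U) : MG C q (U.indicator fun _ => 1) (volume U ^ (1/p)) := by
  have hp0 : 0 < p := by linarith
  obtain ⟨F, hF1, hF2, hF3, hF4⟩ := hU.exists_iUnion_isClosed
  have hex : ∀ n : ℕ, ∃ f : C(Euc d, ℝ), EqOn f 1 (F n ∩ closedBall 0 n) ∧ IsCompact (tsupport f) ∧
      tsupport f ⊆ U ∧ ∀ x, f x ∈ Icc 0 1 := fun n =>
    exists_continuousMap_one_of_isCompact_subset_isOpen ((isCompact_closedBall 0 (n:ℝ)).inter_left (hF1 n)) hU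
      (inter_subset_left.trans (hF2 n))
  choose f h1 h2 h3 h4 using hex
  have hle : ∀ n y, ‖((f n y : ℝ) : ℂ)‖ₑ ≤ U.indicator (fun _ => 1) y := by
    intro n y
    by_cases hy : y ∈ U
    · rw [indicator_of_mem hy, ← ofReal_norm, Complex.norm_real, Real.norm_of_nonneg (h4 n y).1]
      exact ENNReal.ofReal_le_one.2 (h4 n y).2
    · rw [image_eq_zero_of_notMem_tsupport fun h => hy (h3 n h)]; simp
  refine MG_fatou hq (fun n y => ‖((f n y : ℝ) : ℂ)‖ₑ) (fun n => ?_) _ (fun n => ?_) (fun x => ?_)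
  · exact (Complex.continuous_ofReal.comp (f n).continuous).measurable.enorm
  · refine MG_mono hq.le ?_ (hC (fun y => ((f n y : ℝ) : ℂ)) (Complex.continuous_ofReal.comp (f n).continuous)
      (HasCompactSupport.comp_left (g := fun z : ℝ => (z : ℂ)) (h2 n) (by simp)))
    refine ENNReal.rpow_le_rpow ?_ (by positivity)
    rw [← lintegral_indicator_one hU.measurableSet]
    refine lintegral_mono fun y => ?_
    refine (ENNReal.rpow_le_rpow (hle n y) hp0.le).trans ?_
    by_cases hy : y ∈ U
    · simp [hy]
    · simp [hy, hp0]
  · by_cases hx : x ∈ U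
    · rw [indicator_of_mem hx]
      obtain ⟨n0, hn0⟩ : ∃ n, x ∈ F n := by rw [← hF3] at hx; simpa using hx
      obtain ⟨n1, hn1⟩ := exists_nat_ge ‖x‖
      refine Filter.le_liminf_of_le (by isBoundedDefault) ?_
      filter_upwards [Filter.eventually_ge_atTop (max n0 n1)] with n hn
      have : f n x = 1 := h1 n ⟨hF4 ((le_max_left _ _).trans hn) hn0, by
        rw [mem_closedBall_zero_iff]
        exact hn1.trans (by exact_mod_cast (le_max_right _ _).trans hn)⟩
      rw [this]; simp
    · rw [indicator_of_notMem hx]; exact zero_le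

lemma MG_null {d : ℕ} [NeZero d] (p q : ℝ) (hp : 1 < p) (hq : 1 ≤ q) (C : ℝ≥0)
    (hC : ∀ g : Euc d → ℂ, Continuous g → HasCompactSupport g → MG C q (fun y => ‖g y‖ₑ) ((∫⁻ y, ‖g y‖ₑ ^ p) ^ (1/p)))
    (N : Set (Euc d)) (hN : volume N = 0) :
    ∀ᵐ x, ∀ t ∈ Icc (1:ℝ) 2, ∀ᵐ y ∂(sphereMeasure d), x - t • y ∉ N := by
  have hp0 : 0 < p := by linarith
  have hex : ∀ k : ℕ, ∃ U ⊇ N, IsOpen U ∧ volume U < (((4:ℝ≥0∞)⁻¹)^k)^p := fun k =>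
    N.exists_isOpen_lt_of_lt _ (by
      rw [hN]
      exact ENNReal.rpow_pos (ENNReal.pow_pos (by simp) _) (ENNReal.pow_ne_top (by simp)))
  choose U hU1 hU2 hU3 using hex
  have hMG : ∀ k, MG C q ((U k).indicator fun _ => 1) (((4:ℝ≥0∞)⁻¹)^k) := fun k => by
    refine MG_mono (by linarith) ?_ (MG_open p q hp (by linarith) C hC (U k) (hU2 k))
    have := ENNReal.rpow_le_rpow (hU3 k).le (show 0 ≤ 1/p by positivity)
    rwa [← ENNReal.rpow_mul, mul_one_div_cancel hp0.ne', ENNReal.rpow_one] at this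
  choose W h1 h2 h3 using hMG
  filter_upwards [ae_all_iff.2 h2, ae_summable volume W (fun n => (h1 n).aemeasurable) q hq C (by simp) h3] with x hx hs t ht
  have hW := ENNReal.tendsto_atTop_zero_of_tsum_ne_top hs
  have h4 : Filter.Tendsto (fun n : ℕ => (C : ℝ≥0∞) * ((4:ℝ≥0∞)⁻¹)^n) Filter.atTop (nhds 0) := by
    have := ENNReal.Tendsto.const_mul (a := (C : ℝ≥0∞)) (ENNReal.tendsto_pow_atTop_nhds_zero_of_lt_one (r := (4:ℝ≥0∞)⁻¹)
      (by rw [ENNReal.inv_lt_one]; norm_num)) (Or.inr (by simp))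
    simpa using this
  have h5 := hW.add h4
  rw [add_zero] at h5
  rw [ae_iff]
  refine le_antisymm (ge_of_tendsto' h5 fun n => ?_) zero_le
  refine le_trans ?_ (hx n t ht)
  have e : ∫⁻ y, (U n).indicator (fun _ => (1:ℝ≥0∞)) (x - t • y) ∂(sphereMeasure d) =
      sphereMeasure d ((fun y => x - t • y) ⁻¹' (U n)) := by
    rw [← lintegral_indicator_one ((hU2 n).measurableSet.preimage (by fun_prop))]
    rfl
  rw [e]
  refine measure_mono fun y hy => hU1 n ?_
  simpa using hy

lemma good_Lp (d : ℕ) (hd : 3 ≤ d) [NeZero d] (p : ℝ) (hp : ((d : ℝ) ^ 2 + 1) / ((d : ℝ) * ((d : ℝ) - 1)) < p) :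
    ∃ C : ℝ≥0, ∀ f : Euc d → ℂ, MemLp f (ENNReal.ofReal p) volume →
      Good p (p * d) f (C * (eLpNorm f (ENNReal.ofReal p) volume) ^ (p * d)) := by
  obtain ⟨C, hC⟩ := good_Cc d hd p hp
  obtain ⟨K, hK⟩ := MG_Cc d hd p hp
  obtain ⟨hp1, -⟩ := pick_delta d hd p hp
  have hp0 : 0 < p := by linarith
  have hdd : (0:ℝ) < d := by exact_mod_cast (by omega : 0 < d)
  have hd1 : (1:ℝ) ≤ d := by exact_mod_cast (by omega : 1 ≤ d)
  have hq : 1 ≤ p * d := by nlinarith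
  have hpe : (1:ℝ≥0∞) ≤ ENNReal.ofReal p := by rw [ENNReal.one_le_ofReal]; exact hp1.le
  have hnorm : ∀ g : Euc d → ℂ, (∫⁻ y, ‖g y‖ₑ ^ p) ^ (1/p) = eLpNorm g (ENNReal.ofReal p) volume := by
    intro g
    rw [eLpNorm_eq_lintegral_rpow_enorm_toReal (by simpa using hp0) (by simp), ENNReal.toReal_ofReal hp0.le]
  simp only [hnorm] at hC
  have hK' := hK
  simp only [hnorm] at hK'
  refine ⟨C, fun f hf => ?_⟩
  have hex : ∀ n : ℕ, ∃ g : Euc d → ℂ, HasCompactSupport g ∧ eLpNorm (f - g) (ENNReal.ofReal p) volume ≤ ((4:ℝ≥0∞)⁻¹)^n ∧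
      Continuous g ∧ MemLp g (ENNReal.ofReal p) volume := fun n =>
    hf.exists_hasCompactSupport_eLpNorm_sub_le (by simp) (ENNReal.pow_pos (by simp) _).ne'
  choose fn hs hsub hc hm using hex
  have hpow : ∀ n : ℕ, ∫⁻ x, ‖f x - fn n x‖ₑ ^ p ≤ 1 * (((4:ℝ≥0∞)⁻¹)^n)^p := by
    intro n
    have := ENNReal.rpow_le_rpow (hsub n) hp0.le
    rw [← hnorm, ← ENNReal.rpow_mul, one_div_mul_cancel hp0.ne', ENNReal.rpow_one] at this
    rw [one_mul]; exact this
  have hae := ae_summable volume (fun n x => ‖f x - fn n x‖ₑ) (fun n => (hf.1.sub (hm n).1).enorm) p hp1.le 1 (by simp) hpow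
  have hN : ∀ᵐ x, Filter.Tendsto (fun n => fn n x) Filter.atTop (nhds (f x)) := by
    filter_upwards [hae] with x hx
    have := ENNReal.tendsto_atTop_zero_of_tsum_ne_top hx
    rw [tendsto_iff_edist_tendsto_0]
    simpa only [edist_eq_enorm_sub, enorm_sub_comm'] using this
  have hN' := MG_null p (p * d) hp1 hq K hK _ (ae_iff.1 hN)
  have hMG : ∀ n, MG K (p * d) (fun y => ‖fn n y - fn (n+1) y‖ₑ) (2 * ((4:ℝ≥0∞)⁻¹)^n) := by
    intro n
    refine MG_mono (by linarith) ?_ (hK' (fun y => fn n y - fn (n+1) y) ((hc n).sub (hc (n+1))) ?_)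
    · calc _ = eLpNorm ((f - fn (n+1)) - (f - fn n)) (ENNReal.ofReal p) volume := by
            congr 1; ext y; simp
        _ ≤ eLpNorm (f - fn (n+1)) (ENNReal.ofReal p) volume + eLpNorm (f - fn n) (ENNReal.ofReal p) volume :=
            eLpNorm_sub_le (hf.1.sub (hm _).1) (hf.1.sub (hm _).1) hpe
        _ ≤ ((4:ℝ≥0∞)⁻¹)^(n+1) + ((4:ℝ≥0∞)⁻¹)^n := add_le_add (hsub _) (hsub _)
        _ ≤ ((4:ℝ≥0∞)⁻¹)^n + ((4:ℝ≥0∞)⁻¹)^n :=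
            add_le_add (pow_le_pow_of_le_one zero_le (by simp [ENNReal.inv_le_one]) (Nat.le_succ n)) le_rfl
        _ = _ := (two_mul _).symm
    · exact (hs n).sub (hs (n+1))
  choose W h1 h2 h3 using hMG
  have hW := ae_summable volume W (fun n => (h1 n).aemeasurable) (p * d) hq (K * (2:ℝ≥0∞)^(p * d))
    (ENNReal.mul_ne_top (by simp) (ENNReal.rpow_ne_top_of_nonneg (by linarith) (by simp))) (fun n => by
      have := h3 n
      rwa [ENNReal.mul_rpow_of_nonneg _ _ (by linarith), ← mul_assoc] at this)
  have hfin := good_lim p (p * d) hp1.le (by linarith) fn f _ (fun n => hC (fn n) (hc n) (hs n)) ?_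
  · obtain ⟨V, hV1, hV2, hV3⟩ := hfin
    refine ⟨V, hV1, hV2, hV3.trans ?_⟩
    have hle : ∀ n : ℕ, (C : ℝ≥0∞) * eLpNorm (fn n) (ENNReal.ofReal p) volume ^ (p * d) ≤
        C * (eLpNorm f (ENNReal.ofReal p) volume + ((4:ℝ≥0∞)⁻¹)^n) ^ (p * d) := by
      intro n
      refine mul_le_mul_right (ENNReal.rpow_le_rpow ?_ (by linarith)) _
      calc _ = eLpNorm (f - (f - fn n)) (ENNReal.ofReal p) volume := by congr 1; ext y; simp
        _ ≤ _ := eLpNorm_sub_le hf.1 (hf.1.sub (hm _).1) hpe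
        _ ≤ _ := add_le_add le_rfl (hsub n)
    refine (Filter.liminf_le_liminf (Filter.Eventually.of_forall hle)).trans (le_of_eq ?_)
    apply Filter.Tendsto.liminf_eq
    refine ENNReal.Tendsto.const_mul ?_ (Or.inr (by simp))
    apply Filter.Tendsto.ennrpow_const
    have := (ENNReal.tendsto_pow_atTop_nhds_zero_of_lt_one (r := (4:ℝ≥0∞)⁻¹)
      (by rw [ENNReal.inv_lt_one]; norm_num)).const_add (eLpNorm f (ENNReal.ofReal p) volume)
    simpa using this
  · filter_upwards [hN', ae_all_iff.2 h2, hW] with x hx1 hx2 hx3 t ht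
    have hx1' : ∀ᵐ y ∂(sphereMeasure d), Filter.Tendsto (fun n => fn n (x - t • y)) Filter.atTop (nhds (f (x - t • y))) := by
      filter_upwards [hx1 t ht] with y hy
      simpa using hy
    have hsum : ∑' n : ℕ, (W n x + K * (2 * ((4:ℝ≥0∞)⁻¹)^n)) ≠ ∞ := by
      rw [ENNReal.tsum_add, ENNReal.tsum_mul_left, ENNReal.tsum_mul_left, ENNReal.tsum_geometric]
      refine ENNReal.add_ne_top.2 ⟨hx3, ENNReal.mul_ne_top (by simp) (ENNReal.mul_ne_top (by simp) ?_)⟩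
      rw [ENNReal.inv_ne_top]
      refine (tsub_pos_of_lt ?_).ne'
      rw [ENNReal.inv_lt_one]; norm_num
    have htail := ENNReal.tendsto_sum_nat_add _ hsum
    have hcn : ∀ n, Continuous fun y : Euc d => fn n (x - t • y) := fun n => (hc n).comp (by fun_prop)
    unfold sphAvg
    refine tendsto_integral_of_L1 _ (aestronglyMeasurable_of_tendsto_ae _ (fun n => (hcn n).aestronglyMeasurable) hx1')
      (Filter.Eventually.of_forall fun n => integrable_sphere (hcn n)) ?_
    refine tendsto_of_tendsto_of_tendsto_of_le_of_le tendsto_const_nhds htail (fun _ => zero_le) fun n => ?_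
    beta_reduce
    calc _ ≤ ∫⁻ y, ∑' k, ‖fn (k+n) (x - t • y) - fn (k+n+1) (x - t • y)‖ₑ ∂(sphereMeasure d) := by
          refine lintegral_mono_ae ?_
          filter_upwards [hx1'] with y hy
          have := edist_le_tsum_of_edist_le_of_tendsto (fun k => ‖fn k (x - t • y) - fn (k+1) (x - t • y)‖ₑ)
            (fun k => by rw [edist_eq_enorm_sub]) hy n
          rw [edist_eq_enorm_sub] at this
          simpa only [add_comm n] using this
      _ = ∑' k, ∫⁻ y, ‖fn (k+n) (x - t • y) - fn (k+n+1) (x - t • y)‖ₑ ∂(sphereMeasure d) :=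
          lintegral_tsum fun k => ((hcn _).sub (hcn _)).measurable.enorm.aemeasurable
      _ ≤ _ := ENNReal.tsum_le_tsum fun k => hx2 (k+n) t ht

lemma rVar_anti {p r : ℝ} (hp : 1 ≤ p) (hpr : p ≤ r) (E : Set ℝ) (a : ℝ → ℂ) : rVar r E a ≤ rVar p E a := by
  apply rVar_le
  intro N t h1 h2
  refine le_trans ?_ (le_rVar (r := p) N t h1 h2)
  have hp0 : 0 < p := by linarith
  have hr0 : 0 < r := by linarith
  obtain ⟨b, hb⟩ : ∃ b : Fin N → ℝ≥0∞, b = fun i => ‖a (t i.succ) - a (t i.castSucc)‖ₑ := ⟨_, rfl⟩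
  have e : ∀ i, ‖a (t i.succ) - a (t i.castSucc)‖ₑ = b i := fun i => by rw [hb]
  simp only [e]
  obtain ⟨T, hT⟩ : ∃ T, T = (∑ i, b i ^ p) ^ (1/p) := ⟨_, rfl⟩
  rw [← hT]
  have hTp : T ^ p = ∑ i, b i ^ p := by rw [hT, ← ENNReal.rpow_mul, one_div_mul_cancel hp0.ne', ENNReal.rpow_one]
  have hbT : ∀ i, b i ≤ T := by
    intro i
    rw [← ENNReal.rpow_le_rpow_iff hp0, hTp]
    exact Finset.single_le_sum (f := fun i => b i ^ p) (fun _ _ => zero_le) (Finset.mem_univ i)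
  have : ∑ i, b i ^ r ≤ T ^ r := by
    calc ∑ i, b i ^ r = ∑ i, b i ^ p * b i ^ (r - p) := by
          refine Finset.sum_congr rfl fun i _ => ?_
          rw [← ENNReal.rpow_add_of_nonneg _ _ hp0.le (by linarith)]; congr 1; ring
      _ ≤ ∑ i, b i ^ p * T ^ (r - p) :=
          Finset.sum_le_sum fun i _ => mul_le_mul_right (ENNReal.rpow_le_rpow (hbT i) (by linarith)) _
      _ = T ^ p * T ^ (r - p) := by rw [← Finset.sum_mul, hTp]
      _ = T ^ r := by rw [← ENNReal.rpow_add_of_nonneg _ _ hp0.le (by linarith)]; congr 1; ring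
  have := ENNReal.rpow_le_rpow this (show 0 ≤ 1/r by positivity)
  rwa [← ENNReal.rpow_mul, mul_one_div_cancel hr0.ne', ENNReal.rpow_one] at this

lemma suff (d : ℕ) (hd : 3 ≤ d) (p : ℝ) (hp : ((d : ℝ) ^ 2 + 1) / ((d : ℝ) * ((d : ℝ) - 1)) < p) (r : ℝ) (hpr : p ≤ r) :
    IsBddR d r p (p * d) := by
  haveI : NeZero d := ⟨by omega⟩
  obtain ⟨C, hC⟩ := good_Lp d hd p hp
  obtain ⟨hp1, -⟩ := pick_delta d hd p hp
  have hdd : (0:ℝ) < d := by exact_mod_cast (by omega : 0 < d)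
  have hq : 0 < p * d := by positivity
  refine ⟨C ^ (1/(p * d)), fun f hf => ?_⟩
  obtain ⟨W, h1, h2, h3⟩ := hC f hf
  unfold lqNorm
  rw [if_neg (by simp), ENNReal.toReal_ofReal hq.le]
  have h4 : ∫⁻ x, VrIA r f x ^ (p * d) ≤ C * (eLpNorm f (ENNReal.ofReal p) volume) ^ (p * d) := by
    refine le_trans (lintegral_mono_ae ?_) h3
    filter_upwards [h2] with x hx
    exact ENNReal.rpow_le_rpow ((rVar_anti hp1.le hpr _ _).trans hx) hq.le
  have := ENNReal.rpow_le_rpow h4 (show 0 ≤ 1/(p * d) by positivity)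
  refine this.trans (le_of_eq ?_)
  rw [ENNReal.mul_rpow_of_nonneg _ _ (by positivity), ← ENNReal.rpow_mul, mul_one_div_cancel hq.ne', ENNReal.rpow_one,
    ENNReal.coe_rpow_of_nonneg _ (by positivity)]

/-- alternating shells -/
def shellF (d n : ℕ) (u : Euc d) : ℂ :=
  (ball (0 : Euc d) 2).indicator (fun u => if Even ⌊2 * (n:ℝ) * (‖u‖ - 1)⌋ then (1:ℂ) else 0) u

lemma shellF_meas (d n : ℕ) : Measurable (shellF d n) := by
  unfold shellF
  refine Measurable.indicator ?_ measurableSet_ball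
  refine Measurable.ite ?_ measurable_const measurable_const
  have : Measurable fun u : Euc d => ⌊2 * (n:ℝ) * (‖u‖ - 1)⌋ := Int.measurable_floor.comp (by fun_prop)
  exact this (MeasurableSet.of_discrete (s := {k : ℤ | Even k}))

lemma shellF_le (d n : ℕ) (u : Euc d) : ‖shellF d n u‖ ≤ ‖(ball (0 : Euc d) 2).indicator (fun _ => (1:ℂ)) u‖ := by
  unfold shellF
  by_cases hu : u ∈ ball (0 : Euc d) 2
  · rw [indicator_of_mem hu, indicator_of_mem hu]
    split_ifs <;> simp
  · rw [indicator_of_notMem hu, indicator_of_notMem hu]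

lemma shellF_avg (d n : ℕ) [NeZero d] (hn : 0 < n) (i : ℕ) (hi : i < 2 * n) (x : Euc d) (hx : x ∈ ball (0 : Euc d) ((4 * (n:ℝ))⁻¹)) :
    sphAvg (shellF d n) (1 + (2 * i + 1) * (4 * (n:ℝ))⁻¹) x = if Even i then 1 else 0 := by
  unfold sphAvg
  have hn' : (0:ℝ) < n := by exact_mod_cast hn
  have hδ : (0:ℝ) < (4 * (n:ℝ))⁻¹ := by positivity
  obtain ⟨δ, hδe⟩ : ∃ δ, δ = (4 * (n:ℝ))⁻¹ := ⟨_, rfl⟩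
  have hδn : (n:ℝ) * δ = 1/4 := by rw [hδe]; field_simp
  rw [← hδe] at hδ hx ⊢
  rw [mem_ball_zero_iff] at hx
  have : ∀ᵐ y ∂(sphereMeasure d), shellF d n (x - (1 + (2 * (i:ℝ) + 1) * δ) • y) = if Even i then 1 else 0 := by
    filter_upwards [sphere_ae_norm] with y hy
    obtain ⟨t, ht⟩ : ∃ t, t = 1 + (2 * (i:ℝ) + 1) * δ := ⟨_, rfl⟩
    rw [← ht]
    have ht0 : 0 < t := by rw [ht]; positivity
    have hty : ‖t • y‖ = t := by rw [norm_smul, hy, mul_one, Real.norm_of_nonneg ht0.le]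
    have hlo : t - δ < ‖x - t • y‖ := by
      have := norm_sub_norm_le (t • y) x
      rw [norm_sub_rev, hty] at this; linarith
    have hup : ‖x - t • y‖ < t + δ := by
      have := norm_sub_le x (t • y)
      rw [hty] at this; linarith
    have hi' : (i:ℝ) + 1 ≤ 2 * n := by exact_mod_cast hi
    have hfl : ⌊2 * (n:ℝ) * (‖x - t • y‖ - 1)⌋ = (i:ℤ) := by
      rw [Int.floor_eq_iff]
      have e1 : 2 * (n:ℝ) * (t - δ - 1) = i := by rw [ht]; linear_combination 4 * (i:ℝ) * hδn
      have e2 : 2 * (n:ℝ) * (t + δ - 1) = i + 1 := by rw [ht]; linear_combination (4 * (i:ℝ) + 4) * hδn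
      constructor
      · push_cast; rw [← e1]; gcongr
      · push_cast; rw [← e2]; gcongr
    have hball : x - t • y ∈ ball (0 : Euc d) 2 := by
      rw [mem_ball_zero_iff]
      have : ((i:ℝ) + 1) * δ ≤ 2 * n * δ := by gcongr
      rw [ht] at hup ⊢
      nlinarith
    unfold shellF
    rw [indicator_of_mem hball, hfl]
    simp
  rw [integral_congr_ae this]
  simp

lemma shellF_var (d n : ℕ) [NeZero d] (hn : 0 < n) (r : ℝ) (hr : 1 ≤ r) (x : Euc d) (hx : x ∈ ball (0 : Euc d) ((4 * (n:ℝ))⁻¹)) :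
    (n : ℝ≥0∞) ^ (1/r) ≤ VrIA r (shellF d n) x := by
  unfold VrIA
  have hn' : (0:ℝ) < n := by exact_mod_cast hn
  have hδ : (0:ℝ) < (4 * (n:ℝ))⁻¹ := by positivity
  have hδn : (n:ℝ) * (4 * (n:ℝ))⁻¹ = 1/4 := by field_simp
  have hn1 : (1:ℝ) ≤ n := by exact_mod_cast hn
  refine le_trans (le_of_eq ?_) (le_rVar n (fun i : Fin (n+1) => 1 + (2 * ((i:ℕ):ℝ) + 1) * (4 * (n:ℝ))⁻¹) ?_ ?_)
  · have : ∀ i : Fin n, ‖sphAvg (shellF d n) (1 + (2 * ((i.succ:ℕ):ℝ) + 1) * (4 * (n:ℝ))⁻¹) x -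
        sphAvg (shellF d n) (1 + (2 * ((i.castSucc:ℕ):ℝ) + 1) * (4 * (n:ℝ))⁻¹) x‖ₑ ^ r = 1 := by
      intro i
      have hi := i.2
      rw [shellF_avg d n hn _ (by simp; omega) x hx, shellF_avg d n hn _ (by simp; omega) x hx]
      simp only [Fin.val_succ, Fin.val_castSucc, Nat.even_add_one]
      by_cases h : Even (i:ℕ) <;> simp [h]
    rw [Finset.sum_congr rfl fun i _ => this i]
    simp
  · intro i j hij
    have : ((i:ℕ):ℝ) < ((j:ℕ):ℝ) := by exact_mod_cast hij
    beta_reduce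
    gcongr
  · intro i
    have hi : ((i:ℕ):ℝ) ≤ n := by exact_mod_cast Nat.lt_succ_iff.1 i.2
    constructor
    · have : 0 ≤ (2 * ((i:ℕ):ℝ) + 1) * (4 * (n:ℝ))⁻¹ := by positivity
      linarith
    · have : (2 * ((i:ℕ):ℝ) + 1) * (4 * (n:ℝ))⁻¹ ≤ (2 * n + n) * (4 * (n:ℝ))⁻¹ := by gcongr
      nlinarith

lemma nec (d : ℕ) (hd : 3 ≤ d) (p : ℝ) (hp1 : 1 < p) (r : ℝ) (hr : 1 ≤ r) (H : IsBddR d r p (p * d)) : p ≤ r := by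
  haveI : NeZero d := ⟨by omega⟩
  obtain ⟨C, hC⟩ := H
  by_contra! hlt
  have hp0 : 0 < p := by linarith
  have hr0 : 0 < r := by linarith
  have hdd : (0:ℝ) < d := by exact_mod_cast (by omega : 0 < d)
  have hq : 0 < p * d := by positivity
  have hs : 0 < 1/r - 1/p := by
    have := one_div_lt_one_div_of_lt hr0 hlt
    linarith
  have hone : MemLp ((ball (0 : Euc d) 2).indicator (fun _ => (1:ℂ))) (ENNReal.ofReal p) volume :=
    memLp_indicator_const _ measurableSet_ball _ (Or.inr measure_ball_lt_top.ne)
  obtain ⟨K, hK⟩ : ∃ K : ℝ≥0∞, K = C * eLpNorm ((ball (0 : Euc d) 2).indicator (fun _ => (1:ℂ))) (ENNReal.ofReal p) volume := ⟨_, rfl⟩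
  have hKt : K ≠ ∞ := by rw [hK]; exact ENNReal.mul_ne_top (by simp) hone.2.ne
  obtain ⟨c, hc⟩ : ∃ c : ℝ≥0∞, c = ENNReal.ofReal ((4:ℝ)⁻¹ ^ (1/p)) * volume (ball (0 : Euc d) 1) ^ (1/(p * d)) := ⟨_, rfl⟩
  have hc0 : c ≠ 0 := by
    rw [hc]
    refine mul_ne_zero ?_ ?_
    · rw [Ne, ENNReal.ofReal_eq_zero, not_le]; positivity
    · exact (ENNReal.rpow_pos (measure_ball_pos _ _ one_pos) measure_ball_lt_top.ne).ne'
  have main : ∀ n : ℕ, 0 < n → ENNReal.ofReal ((n:ℝ) ^ (1/r - 1/p)) * c ≤ K := by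
    intro n hn
    have hn' : (0:ℝ) < n := by exact_mod_cast hn
    have hmem : MemLp (shellF d n) (ENNReal.ofReal p) volume :=
      hone.mono (shellF_meas d n).aestronglyMeasurable (Filter.Eventually.of_forall (shellF_le d n))
    have h1 := hC _ hmem
    have h2 : eLpNorm (shellF d n) (ENNReal.ofReal p) volume ≤ _ := eLpNorm_mono (shellF_le d n)
    have h3 := h1.trans (mul_le_mul_right h2 _)
    rw [← hK] at h3
    refine le_trans ?_ h3
    unfold lqNorm
    rw [if_neg (by simp), ENNReal.toReal_ofReal hq.le]
    have h4 : ((n : ℝ≥0∞) ^ (1/r)) ^ (p * d) * volume (ball (0 : Euc d) ((4 * (n:ℝ))⁻¹)) ≤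
        ∫⁻ x, VrIA r (shellF d n) x ^ (p * d) := by
      rw [← setLIntegral_const]
      refine le_trans (setLIntegral_mono' measurableSet_ball fun x hx => ?_) (setLIntegral_le_lintegral _ _)
      exact ENNReal.rpow_le_rpow (shellF_var d n hn r hr x hx) hq.le
    have h5 := ENNReal.rpow_le_rpow h4 (show 0 ≤ 1/(p * d) by positivity)
    refine le_trans (le_of_eq ?_) h5
    rw [ENNReal.mul_rpow_of_nonneg _ _ (by positivity), ← ENNReal.rpow_mul _ (p * d), mul_one_div_cancel hq.ne', ENNReal.rpow_one,
      Measure.addHaar_ball _ _ (by positivity), ENNReal.mul_rpow_of_nonneg _ _ (by positivity), hc, ← mul_assoc, ← mul_assoc]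
    congr 1
    rw [finrank_euclideanSpace, Fintype.card_fin, ENNReal.ofReal_rpow_of_pos (by positivity), ← ENNReal.ofReal_natCast,
      ENNReal.ofReal_rpow_of_pos hn', ← ENNReal.ofReal_mul (by positivity), ← ENNReal.ofReal_mul (by positivity)]
    congr 1
    rw [← Real.rpow_natCast, ← Real.rpow_mul (by positivity), show (d:ℝ) * (1/(p * d)) = 1/p by field_simp,
      mul_inv, Real.mul_rpow (by positivity) (by positivity), Real.rpow_sub hn', Real.inv_rpow hn'.le]
    ring
  have ht : Filter.Tendsto (fun n : ℕ => (n:ℝ) ^ (1/r - 1/p)) Filter.atTop Filter.atTop :=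
    (tendsto_rpow_atTop hs).comp tendsto_natCast_atTop_atTop
  obtain ⟨n, hn1, hn2⟩ := ((ht.eventually_gt_atTop (K / c).toReal).and (Filter.eventually_gt_atTop 0)).exists
  have h6 := main n hn2
  rw [← ENNReal.le_div_iff_mul_le (Or.inl hc0) (Or.inr hKt)] at h6
  have hne : K / c ≠ ∞ := ENNReal.div_ne_top hKt hc0
  have h7 := ENNReal.toReal_mono hne h6
  rw [ENNReal.toReal_ofReal (by positivity)] at h7
  linarith

/-- Corollary 1.3: for `d ≥ 3` and `(d²+1)/(d(d-1)) < p < ∞`, the operator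
`V_r^I A : L^p → L^{pd}` is bounded if and only if `r ≥ p`. -/
theorem lower_edge_characterization (d : ℕ) (hd : 3 ≤ d) (p : ℝ)
    (hp : ((d : ℝ) ^ 2 + 1) / ((d : ℝ) * ((d : ℝ) - 1)) < p) (r : ℝ) (hr : 1 ≤ r) :
    IsBddR d r p (p * d) ↔ p ≤ r :=
  ⟨nec d hd p (pick_delta d hd p hp).1 r hr, suff d hd p hp r⟩
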